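/- Let Γ' be a finite-index subgroup of SL(2,ℤ) and let k ≥ 2 be an even integer. Then dim S_k(Γ') = δ_{2,k} + ((k−1)/12)·ν₀(Γ') + (⌊k/4⌋ − (k−1)/4)·ν₂(Γ') + (⌊k/3⌋ − (k−1)/3)·ν₃(Γ') − ν_∞(Γ')/2, and dim M_k(Γ') = dim S_k(Γ') + ν_∞(Γ') − δ_{2,k}, where δ_{2,k} = 1 if k = 2 and 0 otherwise. -/

import Mathlib

open Matrix CongruenceSubgroup UpperHalfPlane OnePoint
open scoped MatrixGroups

/-- The subgroup `{±I}` of `SL(2, ℤ)`, realised as the (cyclic) subgroup generated by `-I`. -/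
def plusMinusOne : Subgroup SL(2, ℤ) := Subgroup.zpowers (-1 : SL(2, ℤ))

instance : plusMinusOne.Normal := by
  constructor
  rintro x ⟨n, rfl⟩ g
  have h : Commute g (-1 : SL(2, ℤ)) := by
    ext i j
    simp [mul_neg, neg_mul]
  have : g * (-1 : SL(2, ℤ)) ^ n * g⁻¹ = (-1) ^ n := by
    rw [(h.zpow_right n).eq, mul_assoc, mul_inv_cancel, mul_one]
  rw [this]
  exact ⟨n, rfl⟩

/-- `ν₀(Γ')`: the index of the image of `Γ'` in `PSL(2, ℤ) = SL(2, ℤ)/{±I}`. -/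
noncomputable def nuZero (Γ' : Subgroup SL(2, ℤ)) : ℕ :=
  (Subgroup.map (QuotientGroup.mk' plusMinusOne) Γ').index

/-- The action of `SL(2, ℤ)` on the set of cusps `ℚ ∪ {∞}` by fractional linear
transformations. -/
def slOnePoint (γ : SL(2, ℤ)) (x : OnePoint ℚ) : OnePoint ℚ :=
  match x with
  | ∞ => if (γ 1 0 : ℚ) = 0 then ∞ else ((γ 0 0 : ℚ) / (γ 1 0 : ℚ) : ℚ)
  | (q : ℚ) => if (γ 1 0 : ℚ) * q + (γ 1 1 : ℚ) = 0 then ∞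
      else (((γ 0 0 : ℚ) * q + (γ 0 1 : ℚ)) / ((γ 1 0 : ℚ) * q + (γ 1 1 : ℚ)) : ℚ)

/-- `ν_∞(Γ')`: the number of `Γ'`-orbits of cusps `ℚ ∪ {∞}`. -/
noncomputable def numCuspOrbits (Γ' : Subgroup SL(2, ℤ)) : ℕ :=
  Nat.card {O : Set (OnePoint ℚ) // ∃ x : OnePoint ℚ,
    O = {y | ∃ γ ∈ Γ', slOnePoint γ x = y}}

/-- The natural homomorphism `SL(2, ℤ) →* PSL(2, ℝ)`. -/
noncomputable def toPSL : SL(2, ℤ) →* (SL(2, ℝ) ⧸ Subgroup.center SL(2, ℝ)) :=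
  (QuotientGroup.mk' (Subgroup.center SL(2, ℝ))).comp
    (Matrix.SpecialLinearGroup.map (Int.castRingHom ℝ))

/-- A point `z ∈ ℍ` is an elliptic point of order `n` for a subgroup `Γ'` of `SL(2, ℤ)` if
the stabiliser of `z` in the image of `Γ'` in `PSL(2, ℝ)` — equivalently, the image in
`PSL(2, ℝ)` of the stabiliser `Γ' ⊓ Stab(z)` (since `−I` acts trivially on `ℍ`) — is a
cyclic group of order `n`. -/
def IsEllipticPointOfOrder (Γ' : Subgroup SL(2, ℤ)) (n : ℕ) (z : ℍ) : Prop :=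
  IsCyclic (Subgroup.map toPSL (Γ' ⊓ MulAction.stabilizer SL(2, ℤ) z)) ∧
  Nat.card (Subgroup.map toPSL (Γ' ⊓ MulAction.stabilizer SL(2, ℤ) z)) = n

/-- `ν_n(Γ')`: the number of `Γ'`-orbits of elliptic points of order `n` in `ℍ`. -/
noncomputable def numEllipticOrbits (Γ' : Subgroup SL(2, ℤ)) (n : ℕ) : ℕ :=
  Nat.card {O : Set ℍ // ∃ z : ℍ, IsEllipticPointOfOrder Γ' n z ∧
    O = {w : ℍ | ∃ γ ∈ Γ', γ • z = w}}

namespace DimFormula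

open ModularForm Filter Topology Manifold

variable {Γ : Subgroup SL(2, ℤ)} {k l : ℤ} {f g : ℍ → ℂ}

/-- Holomorphic functions on the upper half-plane which are weight `k` invariant under `Γ` and
bounded at all cusps. -/
def modSub (Γ : Subgroup SL(2, ℤ)) (k : ℤ) : Submodule ℂ (ℍ → ℂ) where
  carrier := {f | MDiff f ∧ (∀ γ ∈ Γ, f ∣[k] γ = f) ∧ ∀ γ : SL(2, ℤ), IsBoundedAtImInfty (f ∣[k] γ)}
  zero_mem' := ⟨mdifferentiable_const, fun γ _ ↦ by simp, fun γ ↦ by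
    rw [SlashAction.zero_slash]; exact Filter.const_boundedAtFilter _ 0⟩
  add_mem' := by
    rintro f g ⟨hf, hf', hf''⟩ ⟨hg, hg', hg''⟩
    refine ⟨hf.add hg, fun γ hγ ↦ by rw [SlashAction.add_slash, hf' γ hγ, hg' γ hγ], fun γ ↦ ?_⟩
    rw [SlashAction.add_slash]
    exact (hf'' γ).add (hg'' γ)
  smul_mem' := by
    rintro c f ⟨hf, hf', hf''⟩
    refine ⟨hf.const_smul c, fun γ hγ ↦ by rw [SL_smul_slash, hf' γ hγ], fun γ ↦ ?_⟩
    rw [SL_smul_slash]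
    exact (hf'' γ).smul c

/-- The functions in `modSub Γ k` which vanish at all cusps. -/
def cuspSub (Γ : Subgroup SL(2, ℤ)) (k : ℤ) : Submodule ℂ (ℍ → ℂ) where
  carrier := {f | MDiff f ∧ (∀ γ ∈ Γ, f ∣[k] γ = f) ∧ ∀ γ : SL(2, ℤ), IsZeroAtImInfty (f ∣[k] γ)}
  zero_mem' := ⟨mdifferentiable_const, fun γ _ ↦ by simp, fun γ ↦ by
    rw [SlashAction.zero_slash]; exact Filter.zero_zeroAtFilter _⟩
  add_mem' := by
    rintro f g ⟨hf, hf', hf''⟩ ⟨hg, hg', hg''⟩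
    refine ⟨hf.add hg, fun γ hγ ↦ by rw [SlashAction.add_slash, hf' γ hγ, hg' γ hγ], fun γ ↦ ?_⟩
    rw [SlashAction.add_slash]
    exact (hf'' γ).add (hg'' γ)
  smul_mem' := by
    rintro c f ⟨hf, hf', hf''⟩
    refine ⟨hf.const_smul c, fun γ hγ ↦ by rw [SL_smul_slash, hf' γ hγ], fun γ ↦ ?_⟩
    rw [SL_smul_slash]
    exact (hf'' γ).smul c

lemma isBounded_of_isZero (h : IsZeroAtImInfty f) : IsBoundedAtImInfty f :=
  Filter.ZeroAtFilter.boundedAtFilter h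

lemma cuspSub_le_modSub : cuspSub Γ k ≤ modSub Γ k :=
  fun _ h ↦ ⟨h.1, h.2.1, fun γ ↦ isBounded_of_isZero (h.2.2 γ)⟩

lemma modSub_mono {Γ₁ Γ₂ : Subgroup SL(2, ℤ)} (h : Γ₁ ≤ Γ₂) : modSub Γ₂ k ≤ modSub Γ₁ k :=
  fun _ hf ↦ ⟨hf.1, fun γ hγ ↦ hf.2.1 γ (h hγ), hf.2.2⟩

lemma mul_mem_modSub (hf : f ∈ modSub Γ k) (hg : g ∈ modSub Γ l) : f * g ∈ modSub Γ (k + l) := by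
  refine ⟨hf.1.mul hg.1, fun γ hγ ↦ by rw [mul_slash_SL2, hf.2.1 γ hγ, hg.2.1 γ hγ], fun γ ↦ ?_⟩
  rw [mul_slash_SL2]
  exact (hf.2.2 γ).mul (hg.2.2 γ)

lemma isZero_mul_isBounded (hf : IsZeroAtImInfty f) (hg : IsBoundedAtImInfty g) :
    IsZeroAtImInfty (f * g) := by
  have := Asymptotics.IsLittleO.mul_isBigO ((Asymptotics.isLittleO_one_iff ℝ).2 hf) hg
  simp only [Pi.one_apply, mul_one] at this
  exact (Asymptotics.isLittleO_one_iff ℝ).1 this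

section equiv

variable {𝒢 : Subgroup (GL (Fin 2) ℝ)} [𝒢.IsArithmetic]

lemma slash_inv_iff (h : 𝒢 = Γ.map (Matrix.SpecialLinearGroup.mapGL ℝ)) :
    (∀ γ ∈ 𝒢, f ∣[k] γ = f) ↔ ∀ γ ∈ Γ, f ∣[k] γ = f := by
  subst h
  constructor
  · intro h γ hγ
    exact h _ ⟨γ, hγ, rfl⟩
  · rintro h _ ⟨γ, hγ, rfl⟩
    exact h γ hγ

lemma bdd_iff : (∀ c, IsCusp c 𝒢 → c.IsBoundedAt f k) ↔
    ∀ γ : SL(2, ℤ), IsBoundedAtImInfty (f ∣[k] γ) := by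
  simp only [Subgroup.IsArithmetic.isCusp_iff_isCusp_SL2Z]
  constructor
  · intro h γ
    have hc : IsCusp (Matrix.SpecialLinearGroup.mapGL ℝ γ • ∞) 𝒮ℒ := isCusp_SL2Z_iff'.2 ⟨γ, rfl⟩
    exact (OnePoint.isBoundedAt_iff_forall_SL2Z hc).1 (h _ hc) γ rfl
  · intro h c hc
    exact (OnePoint.isBoundedAt_iff_forall_SL2Z hc).2 fun γ _ ↦ h γ

lemma zero_iff : (∀ c, IsCusp c 𝒢 → c.IsZeroAt f k) ↔
    ∀ γ : SL(2, ℤ), IsZeroAtImInfty (f ∣[k] γ) := by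
  simp only [Subgroup.IsArithmetic.isCusp_iff_isCusp_SL2Z]
  constructor
  · intro h γ
    have hc : IsCusp (Matrix.SpecialLinearGroup.mapGL ℝ γ • ∞) 𝒮ℒ := isCusp_SL2Z_iff'.2 ⟨γ, rfl⟩
    exact (OnePoint.isZeroAt_iff_forall_SL2Z hc).1 (h _ hc) γ rfl
  · intro h c hc
    exact (OnePoint.isZeroAt_iff_forall_SL2Z hc).2 fun γ _ ↦ h γ

/-- Modular forms as functions. -/
noncomputable def modEquiv (h : 𝒢 = Γ.map (Matrix.SpecialLinearGroup.mapGL ℝ)) [𝒢.HasDetOne] :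
    ModularForm 𝒢 k ≃ₗ[ℂ] modSub Γ k where
  toFun F := ⟨F, F.holo', (slash_inv_iff h).1 fun γ hγ ↦ F.slash_action_eq' γ hγ,
    (bdd_iff (𝒢 := 𝒢)).1 fun _ hc ↦ F.bdd_at_cusps' hc⟩
  map_add' _ _ := rfl
  map_smul' _ _ := rfl
  invFun f := { toFun := f.1, holo' := f.2.1, slash_action_eq' := (slash_inv_iff h).2 f.2.2.1
                bdd_at_cusps' := fun hc ↦ (bdd_iff (𝒢 := 𝒢)).2 f.2.2.2 _ hc }
  left_inv _ := rfl
  right_inv _ := rfl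

/-- Cusp forms as functions. -/
noncomputable def cuspEquiv (h : 𝒢 = Γ.map (Matrix.SpecialLinearGroup.mapGL ℝ)) [𝒢.HasDetOne] :
    CuspForm 𝒢 k ≃ₗ[ℂ] cuspSub Γ k where
  toFun F := ⟨F, F.holo', (slash_inv_iff h).1 fun γ hγ ↦ F.slash_action_eq' γ hγ,
    (zero_iff (𝒢 := 𝒢)).1 fun _ hc ↦ F.zero_at_cusps' hc⟩
  map_add' _ _ := rfl
  map_smul' _ _ := rfl
  invFun f := { toFun := f.1, holo' := f.2.1, slash_action_eq' := (slash_inv_iff h).2 f.2.2.1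
                zero_at_cusps' := fun hc ↦ (zero_iff (𝒢 := 𝒢)).2 f.2.2.2 _ hc }
  left_inv _ := rfl
  right_inv _ := rfl

end equiv

lemma SL_eq_map_top : 𝒮ℒ = (⊤ : Subgroup SL(2, ℤ)).map (Matrix.SpecialLinearGroup.mapGL ℝ) :=
  (MonoidHom.range_eq_map _)

lemma mem_modSub_top : f ∈ modSub ⊤ k ↔ ∃ F : ModularForm 𝒮ℒ k, ⇑F = f :=
  ⟨fun hf ↦ ⟨(modEquiv SL_eq_map_top).symm ⟨f, hf⟩, rfl⟩,
    fun ⟨F, hF⟩ ↦ hF ▸ (modEquiv SL_eq_map_top F).2⟩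

lemma mem_cuspSub_top : f ∈ cuspSub ⊤ k ↔ ∃ F : CuspForm 𝒮ℒ k, ⇑F = f :=
  ⟨fun hf ↦ ⟨(cuspEquiv SL_eq_map_top).symm ⟨f, hf⟩, rfl⟩,
    fun ⟨F, hF⟩ ↦ hF ▸ (cuspEquiv SL_eq_map_top F).2⟩

section

open Real

lemma tendsto_of_isBigO_sub {L : ℂ} (h : (fun τ ↦ f τ - L) =O[atImInfty] discriminant) :
    Tendsto f atImInfty (𝓝 L) := by
  have : Tendsto (fun τ ↦ f τ - L) atImInfty (𝓝 0) :=
    h.trans_tendsto discriminant_isZeroAtImInfty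
  simpa using this.add_const L

lemma periodic_decay (hf : MDiff f) (hp : ∀ τ : ℍ, f ((1 : ℝ) +ᵥ τ) = f τ)
    (hb : IsBoundedAtImInfty f) :
    ∃ L, (fun τ ↦ f τ - L) =O[atImInfty] discriminant := by
  refine ⟨valueAtInfty f, (exp_decay_sub_atImInfty (h := 1) one_pos ?_ hf hb).trans
    (by simpa using exp_isBigO_discriminant)⟩
  intro w
  by_cases! hw : 0 < w.im
  · have : 0 < (w + (1 : ℝ)).im := by simp [hw]
    simp only [Function.comp_apply, ofComplex_apply_of_im_pos this, ofComplex_apply_of_im_pos hw]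
    convert! hp ⟨w, hw⟩ using 2
    ext
    simp [add_comm]
  · have : (w + (1 : ℝ)).im ≤ 0 := by simpa using hw
    simp only [Function.comp_apply]
    rw [ofComplex_apply_of_im_nonpos this, ofComplex_apply_of_im_nonpos hw]

lemma disc_mem : discriminant ∈ cuspSub ⊤ 12 := mem_cuspSub_top.2 ⟨CuspForm.discriminant, rfl⟩

lemma disc_slash (γ : SL(2, ℤ)) : discriminant ∣[(12 : ℤ)] γ = discriminant :=
  disc_mem.2.1 γ trivial

lemma div_disc (hf : f ∈ modSub Γ k) (h : ∀ γ : SL(2, ℤ), (f ∣[k] γ) =O[atImInfty] discriminant) :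
    f / discriminant ∈ modSub Γ (k - 12) := by
  have key (γ : SL(2, ℤ)) : (f / discriminant) ∣[k - 12] γ = (f ∣[k] γ) / discriminant := by
    rw [div_slash_SL2, disc_slash]
  refine ⟨hf.1.div disc_mem.1 discriminant_ne_zero, fun γ hγ ↦ by rw [key, hf.2.1 γ hγ], fun γ ↦ ?_⟩
  rw [key]
  exact (Asymptotics.div_isBoundedUnder_of_isBigO (h γ)).isBigO_one ℝ

lemma mul_div_disc : discriminant * (f / discriminant) = f := by
  ext τ
  simp [mul_div_cancel₀ _ (discriminant_ne_zero τ)]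

lemma denom_SL (γ : SL(2, ℤ)) (τ : ℍ) : denom γ τ = (γ 1 0 : ℂ) * τ + (γ 1 1 : ℂ) := by
  simp [ModularGroup.denom_apply]

lemma slash_T (f : ℍ → ℂ) (k : ℤ) (τ : ℍ) : (f ∣[k] ModularGroup.T) τ = f ((1 : ℝ) +ᵥ τ) := by
  rw [SL_slash_apply, denom_SL, UpperHalfPlane.modular_T_smul]
  simp [ModularGroup.T]

lemma slash_neg_one (f : ℍ → ℂ) (k : ℤ) : f ∣[k] (-1 : SL(2, ℤ)) = fun τ ↦ (-1) ^ k * f τ := by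
  ext τ
  rw [SL_slash_apply, denom_SL, ModularGroup.SL_neg_smul, one_smul]
  rcases Int.even_or_odd k with h | h <;> simp [h.neg_one_zpow]

lemma slash_vadd (hf : ∀ γ ∈ (⊤ : Subgroup SL(2, ℤ)), f ∣[k] γ = f) (τ : ℍ) :
    f ((1 : ℝ) +ᵥ τ) = f τ := by
  rw [← slash_T f k, hf _ trivial]

lemma top_limit (hf : f ∈ modSub ⊤ k) : ∃ L, (fun τ ↦ f τ - L) =O[atImInfty] discriminant :=
  periodic_decay hf.1 (slash_vadd hf.2.1) (by simpa using hf.2.2 1)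

lemma top_div_disc (hf : f ∈ modSub ⊤ k) (h0 : Tendsto f atImInfty (𝓝 0)) :
    f / discriminant ∈ modSub ⊤ (k - 12) := by
  apply div_disc hf
  intro γ
  rw [hf.2.1 γ trivial]
  obtain ⟨L, hL⟩ := top_limit hf
  obtain rfl := tendsto_nhds_unique (tendsto_of_isBigO_sub hL) h0
  simpa using hL

/-- The Eisenstein series of weight four as a function. -/
noncomputable def E4f : ℍ → ℂ := ⇑E₄

/-- The Eisenstein series of weight six as a function. -/
noncomputable def E6f : ℍ → ℂ := ⇑E₆

lemma E4f_mem : E4f ∈ modSub ⊤ 4 := mem_modSub_top.2 ⟨E₄, rfl⟩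

lemma E6f_mem : E6f ∈ modSub ⊤ 6 := mem_modSub_top.2 ⟨E₆, rfl⟩

lemma disc_eq : discriminant = (1 / 1728 : ℂ) • (E4f ^ 3 - E6f ^ 2) := by
  ext τ
  rw [discriminant_eq_E₄_cube_sub_E₆_sq]
  simp [E4f, E6f]; ring

lemma tendsto_of_coeff_zero {n : ℕ} (F : ModularForm 𝒮ℒ n) (h : (qExpansion 1 F).coeff 0 = 1) :
    Tendsto F atImInfty (𝓝 1) := by
  obtain ⟨L, hL⟩ := top_limit (mem_modSub_top.2 ⟨F, rfl⟩)
  have hm := (mem_modSub_top.2 ⟨F, rfl⟩ : (F : ℍ → ℂ) ∈ modSub ⊤ n)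
  have h1 := tendsto_of_isBigO_sub hL
  have h2 : (qExpansion 1 F).coeff 0 = valueAtInfty F :=
    UpperHalfPlane.qExpansion_coeff_zero one_pos
      (ModularFormClass.analyticAt_cuspFunction_zero F one_pos one_mem_strictPeriods_SL)
      (SlashInvariantFormClass.periodic_comp_ofComplex F one_mem_strictPeriods_SL)
  rw [h, valueAtInfty, h1.limUnder_eq] at h2
  rwa [h2]

lemma E4f_tendsto : Tendsto E4f atImInfty (𝓝 1) :=
  tendsto_of_coeff_zero E₄ (EisensteinSeries.E_qExpansion_coeff_zero _ ⟨2, rfl⟩)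

lemma E6f_tendsto : Tendsto E6f atImInfty (𝓝 1) :=
  tendsto_of_coeff_zero E₆ (EisensteinSeries.E_qExpansion_coeff_zero _ ⟨3, rfl⟩)

lemma const_mem (c : ℂ) : (fun _ ↦ c : ℍ → ℂ) ∈ modSub Γ 0 :=
  ⟨mdifferentiable_const, fun γ _ ↦ is_invariant_const γ c, fun γ ↦ by
    rw [show (fun _ ↦ c : ℍ → ℂ) ∣[(0 : ℤ)] γ = fun _ ↦ c from is_invariant_const γ c]
    exact Filter.const_boundedAtFilter _ c⟩

lemma one_mem : (1 : ℍ → ℂ) ∈ modSub Γ 0 := const_mem 1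

lemma pow_mem_modSub (hf : f ∈ modSub Γ k) (n : ℕ) : f ^ n ∈ modSub Γ (n * k) := by
  induction n with
  | zero => simpa using! one_mem
  | succ n ih =>
    rw [pow_succ]
    convert mul_mem_modSub ih hf using 1
    push_cast; ring_nf

/-- A product of Eisenstein series with limit `1` at the cusp. -/
lemma exists_eis {n : ℤ} (hn : 4 ≤ n) (he : Even n) :
    ∃ e ∈ modSub ⊤ n, Tendsto e atImInfty (𝓝 1) ∧
      ((∃ e' ∈ modSub ⊤ (n - 4), e = E4f * e') ∨ ∃ e' ∈ modSub ⊤ (n - 6), e = E6f * e') := by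
  obtain ⟨a, b, hab⟩ : ∃ a b : ℕ, 4 * a + 6 * b = n := by
    obtain ⟨m, rfl⟩ := he
    rcases Int.even_or_odd' m with ⟨c, rfl | rfl⟩
    · exact ⟨c.toNat, 0, by omega⟩
    · exact ⟨(c - 1).toNat, 1, by omega⟩
  have mem (a b : ℕ) : E4f ^ a * E6f ^ b ∈ modSub ⊤ (a * 4 + b * 6) :=
    mul_mem_modSub (pow_mem_modSub E4f_mem a) (pow_mem_modSub E6f_mem b)
  refine ⟨E4f ^ a * E6f ^ b, by convert mem a b using 1; rw [← hab]; ring_nf, ?_, ?_⟩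
  · simpa using! (E4f_tendsto.pow a).mul (E6f_tendsto.pow b)
  · rcases Nat.exists_eq_succ_of_ne_zero (n := a + b) (by omega) with ⟨c, hc⟩
    rcases a with - | a
    · rcases b with - | b
      · omega
      · exact .inr ⟨E4f ^ 0 * E6f ^ b, by
          convert mem 0 b using 1; congr 1; push_cast at hab ⊢; omega, by ring⟩
    · exact .inl ⟨E4f ^ a * E6f ^ b, by
          convert mem a b using 1; congr 1; push_cast at hab ⊢; omega, by ring⟩

lemma modSub_neg_weight [Γ.FiniteIndex] (hk : k < 0) (hf : f ∈ modSub Γ k) : f = 0 := by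
  have := isZero_of_neg_weight hk ((modEquiv (𝒢 := Γ) rfl).symm ⟨f, hf⟩)
  have h2 := congrArg (fun F : ModularForm Γ k ↦ (F : ℍ → ℂ)) this
  exact h2

lemma modSub_zero_weight [Γ.FiniteIndex] (hf : f ∈ modSub Γ 0) : ∃ c, f = fun _ ↦ c :=
  eq_const_of_weight_zero ((modEquiv (𝒢 := Γ) rfl).symm ⟨f, hf⟩)

lemma cuspSub_nonpos [Γ.FiniteIndex] (hk : k ≤ 0) (hf : f ∈ cuspSub Γ k) : f = 0 := by
  rcases hk.lt_or_eq with hk | rfl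
  · exact modSub_neg_weight hk (cuspSub_le_modSub hf)
  · obtain ⟨c, rfl⟩ := modSub_zero_weight (cuspSub_le_modSub hf)
    have h : IsZeroAtImInfty fun _ : ℍ ↦ c := by simpa using hf.2.2 1
    have : c = 0 := tendsto_nhds_unique tendsto_const_nhds h
    subst this; rfl

lemma modSub_odd (hΓ : -1 ∈ Γ) (hk : Odd k) (hf : f ∈ modSub Γ k) : f = 0 := by
  have h := hf.2.1 _ hΓ
  rw [slash_neg_one, hk.neg_one_zpow] at h
  ext τ
  have h2 := congrFun h τ
  simp only [neg_mul, one_mul] at h2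
  simpa using! self_eq_neg.1 h2.symm

lemma level_one_gen {n : ℤ} (hn : n ≠ 0) (hf : f ∈ modSub ⊤ n) :
    ∃ u ∈ modSub ⊤ (n - 4), ∃ v ∈ modSub ⊤ (n - 6), f = E4f * u + E6f * v := by
  have triv : f = 0 → ∃ u ∈ modSub ⊤ (n - 4), ∃ v ∈ modSub ⊤ (n - 6), f = E4f * u + E6f * v :=
    fun h ↦ ⟨0, zero_mem _, 0, zero_mem _, by simp [h]⟩
  rcases hn.lt_or_gt with hn | hn
  · exact triv (modSub_neg_weight hn hf)
  rcases Int.even_or_odd n with he | ho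
  swap
  · exact triv (modSub_odd (Subgroup.mem_top _) ho hf)
  obtain ⟨m, hm⟩ := he
  rcases eq_or_ne m 1 with rfl | hm1
  · obtain ⟨F, rfl⟩ := mem_modSub_top.1 hf
    apply triv
    obtain rfl : n = 2 := hm
    have := rank_zero_iff_forall_zero.1 levelOne_weight_two_rank_zero F
    exact congrArg (fun F : ModularForm 𝒮ℒ 2 ↦ (F : ℍ → ℂ)) this
  obtain ⟨e, he, het, hed⟩ := exists_eis (n := n) (by omega) ⟨m, hm⟩
  obtain ⟨L, hL⟩ := top_limit hf
  have hf0 : Tendsto (f - L • e) atImInfty (𝓝 0) := by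
    simpa using! (tendsto_of_isBigO_sub hL).sub (het.const_smul L)
  have hr := top_div_disc (sub_mem hf ((modSub ⊤ n).smul_mem L he)) hf0
  set r := (f - L • e) / discriminant with hr'
  have hfr : f = L • e + discriminant * r := by rw [hr', mul_div_disc]; abel
  have h1 : (1 / 1728 : ℂ) • (E4f ^ 2 * r) ∈ modSub ⊤ (n - 4) := by
    refine (modSub ⊤ _).smul_mem _ ?_
    convert mul_mem_modSub (pow_mem_modSub E4f_mem 2) hr using 1
    congr 1; push_cast; ring
  have h2 : (-(1 / 1728) : ℂ) • (E6f * r) ∈ modSub ⊤ (n - 6) := by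
    refine (modSub ⊤ _).smul_mem _ ?_
    convert mul_mem_modSub E6f_mem hr using 1
    congr 1; ring
  have h3 : discriminant * r = E4f * ((1 / 1728 : ℂ) • (E4f ^ 2 * r)) +
      E6f * ((-(1 / 1728) : ℂ) • (E6f * r)) := by
    rw [disc_eq]; ext τ; simp; ring
  rcases hed with ⟨e', he', rfl⟩ | ⟨e', he', rfl⟩
  · refine ⟨_, add_mem ((modSub ⊤ _).smul_mem L he') h1, _, h2, ?_⟩
    rw [hfr, h3]; ext τ; simp; ring
  · refine ⟨_, h1, _, add_mem ((modSub ⊤ _).smul_mem L he') h2, ?_⟩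
    rw [hfr, h3]; ext τ; simp; ring

lemma E4E6_ne (τ : ℍ) : E4f τ ≠ 0 ∨ E6f τ ≠ 0 := by
  by_contra! h
  apply discriminant_ne_zero τ
  rw [disc_eq]
  simp [h.1, h.2]

end

section Koszul

variable {A : Type} [CommRing A] [Algebra ℂ A]

/-- The degree `k` part of the submodule generated by `a` (degree 4) and `b` (degree 6). -/
def genSub (V : ℤ → Submodule ℂ A) (a b : A) (k : ℤ) : Submodule ℂ A :=
  (V (k - 4)).map (LinearMap.mulLeft ℂ a) ⊔ (V (k - 6)).map (LinearMap.mulLeft ℂ b)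

lemma mem_genSub {V : ℤ → Submodule ℂ A} {a b : A} {k : ℤ} {w : A} :
    w ∈ genSub V a b k ↔ ∃ u ∈ V (k - 4), ∃ v ∈ V (k - 6), w = a * u + b * v := by
  simp only [genSub, Submodule.mem_sup, Submodule.mem_map, LinearMap.mulLeft_apply]
  constructor
  · rintro ⟨_, ⟨u, hu, rfl⟩, _, ⟨v, hv, rfl⟩, rfl⟩
    exact ⟨u, hu, v, hv, rfl⟩
  · rintro ⟨u, hu, v, hv, rfl⟩
    exact ⟨_, ⟨u, hu, rfl⟩, _, ⟨v, hv, rfl⟩, rfl⟩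

lemma exists_minimal_generators (V : ℤ → Submodule ℂ A) (a b : A) :
    ∃ (I : Type) (κ : I → ℤ) (φ : I → A), (∀ i, φ i ∈ V (κ i)) ∧
      (∀ (k : ℤ) (S : Finset I) (c : I → ℂ), (∀ i ∈ S, κ i = k) →
        ∑ i ∈ S, c i • φ i ∈ genSub V a b k → ∀ i ∈ S, c i = 0) ∧
      ∀ k, ∀ v ∈ V k, ∃ (S : Finset I) (c : I → ℂ), (∀ i ∈ S, κ i = k) ∧
        v - ∑ i ∈ S, c i • φ i ∈ genSub V a b k := by
  classical
  let W (k : ℤ) : Submodule ℂ (V k) := (genSub V a b k).comap (V k).subtype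
  let B (k : ℤ) := Module.Basis.ofVectorSpace ℂ (V k ⧸ W k)
  choose L hL using fun (k : ℤ) (x : V k ⧸ W k) ↦ Submodule.Quotient.mk_surjective (W k) x
  let φ (i : Σ k, ↥(Module.Basis.ofVectorSpaceIndex ℂ (V k ⧸ W k))) : A := (L i.1 (B i.1 i.2) : A)
  refine ⟨Σ k, ↥(Module.Basis.ofVectorSpaceIndex ℂ (V k ⧸ W k)), fun i ↦ i.1, φ, fun i ↦ (L _ _).2, ?_, ?_⟩
  · intro k S c hS hc i hi
    have key : ∑ i ∈ S, c i • φ i = ∑ j ∈ S.preimage (Sigma.mk k) sigma_mk_injective.injOn,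
        c ⟨k, j⟩ • φ ⟨k, j⟩ := by
      rw [Finset.sum_preimage (Sigma.mk k) S sigma_mk_injective.injOn (fun i ↦ c i • φ i)]
      rintro ⟨k', j⟩ hj hn
      obtain rfl : k' = k := hS _ hj
      exact (hn ⟨j, rfl⟩).elim
    rw [key] at hc
    have h0 : ∑ j ∈ S.preimage (Sigma.mk k) sigma_mk_injective.injOn,
        c ⟨k, j⟩ • B k j = 0 := by
      have : ∑ j ∈ S.preimage (Sigma.mk k) sigma_mk_injective.injOn, c ⟨k, j⟩ • B k j =
          (W k).mkQ (∑ j ∈ S.preimage (Sigma.mk k) sigma_mk_injective.injOn,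
            c ⟨k, j⟩ • L k (B k j)) := by
        rw [map_sum]
        refine Finset.sum_congr rfl fun j _ ↦ ?_
        rw [_root_.map_smul, Submodule.mkQ_apply, hL]
      rw [this, Submodule.mkQ_apply, Submodule.Quotient.mk_eq_zero]
      simpa [W, φ] using hc
    obtain ⟨k', j⟩ := i
    obtain rfl : k' = k := hS _ hi
    exact linearIndependent_iff'.1 (B k').linearIndependent _ _ h0 j (by simpa using hi)
  · intro k v hv
    let x : V k ⧸ W k := (W k).mkQ ⟨v, hv⟩
    let c := (B k).repr x
    refine ⟨c.support.map ⟨Sigma.mk k, sigma_mk_injective⟩,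
      fun i ↦ if h : i.1 = k then c (h ▸ i.2) else 0, ?_, ?_⟩
    · simp only [Finset.mem_map]
      rintro _ ⟨j, -, rfl⟩
      rfl
    · rw [Finset.sum_map]
      simp only [Function.Embedding.coeFn_mk, dite_true]
      have : (⟨v, hv⟩ - ∑ j ∈ c.support, c j • L k (B k j) : V k) ∈ W k := by
        rw [← Submodule.Quotient.mk_eq_zero, ← Submodule.mkQ_apply, map_sub, map_sum, sub_eq_zero]
        conv_lhs => rw [show (W k).mkQ ⟨v, hv⟩ = x from rfl, ← (B k).linearCombination_repr x]
        rw [Finsupp.linearCombination_apply, Finsupp.sum]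
        refine Finset.sum_congr rfl fun j _ ↦ ?_
        rw [_root_.map_smul, Submodule.mkQ_apply, hL]
      simpa [W, φ] using this

/-- A graded module over `R` on which `a, b` is a regular sequence is free, provided that `a, b`
generate the ideal of elements of nonzero degree of `R`. -/
lemma exists_graded_basis (R V : ℤ → Submodule ℂ A) (a b : A)
    (ha : a ∈ R 4) (hb : b ∈ R 6)
    (hR0 : ∀ r ∈ R 0, ∃ c : ℂ, r = algebraMap ℂ A c) (h1 : 1 ∈ R 0)
    (hRgen : ∀ n ≠ 0, ∀ r ∈ R n, ∃ u ∈ R (n - 4), ∃ v ∈ R (n - 6), r = a * u + b * v)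
    (hRR : ∀ m n, ∀ r ∈ R m, ∀ s ∈ R n, r * s ∈ R (m + n))
    (hRneg : ∀ n < 0, ∀ r ∈ R n, r = 0)
    (hVneg : ∀ n < 0, ∀ r ∈ V n, r = 0)
    (hRV : ∀ m n, ∀ r ∈ R m, ∀ s ∈ V n, r * s ∈ V (m + n))
    (hK : ∀ k, ∀ u ∈ V (k - 4), ∀ v ∈ V (k - 6), a * u + b * v = 0 →
      ∃ z ∈ V (k - 10), u = b * z ∧ v = -(a * z)) :
    ∃ (I : Type) (κ : I → ℤ) (φ : I → A), (∀ i, φ i ∈ V (κ i)) ∧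
      (∀ k, ∀ v ∈ V k, ∃ (S : Finset I) (r : I → A), (∀ i, r i ∈ R (k - κ i)) ∧
        v = ∑ i ∈ S, r i * φ i) ∧
      ∀ (k : ℤ) (S : Finset I) (r : I → A), (∀ i, r i ∈ R (k - κ i)) →
        ∑ i ∈ S, r i * φ i = 0 → ∀ i ∈ S, r i = 0 := by
  classical
  obtain ⟨I, κ, φ, hφ, hind, hgen⟩ := exists_minimal_generators V a b
  have hκ (i : I) : 0 ≤ κ i := by
    by_contra! h
    have := hind (κ i) {i} (fun _ ↦ 1) (by simp) (by simp [hVneg _ h _ (hφ i)]) i (by simp)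
    simp at this
  have hRa {n : ℤ} {r : A} (hr : r ∈ R (n - 4)) : a * r ∈ R n := by
    simpa using hRR _ _ _ ha _ hr
  have hRb {n : ℤ} {r : A} (hr : r ∈ R (n - 6)) : b * r ∈ R n := by
    simpa using hRR _ _ _ hb _ hr
  have hmem (k : ℤ) (S : Finset I) (r : I → A) (hr : ∀ i, r i ∈ R (k - κ i)) :
      ∑ i ∈ S, r i * φ i ∈ V k :=
    sum_mem fun i _ ↦ by simpa using hRV _ _ _ (hr i) _ (hφ i)
  -- combining two representations
  have hadd (k : ℤ) (S₁ S₂ : Finset I) (r₁ r₂ : I → A) (hr₁ : ∀ i, r₁ i ∈ R (k - κ i))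
      (hr₂ : ∀ i, r₂ i ∈ R (k - κ i)) : ∃ (S : Finset I) (r : I → A), (∀ i, r i ∈ R (k - κ i)) ∧
      ∑ i ∈ S₁, r₁ i * φ i + ∑ i ∈ S₂, r₂ i * φ i = ∑ i ∈ S, r i * φ i := by
    refine ⟨S₁ ∪ S₂, fun i ↦ (if i ∈ S₁ then r₁ i else 0) + if i ∈ S₂ then r₂ i else 0, ?_, ?_⟩
    · intro i
      refine add_mem ?_ ?_ <;> split_ifs <;> simp [hr₁, hr₂]
    · simp only [add_mul, Finset.sum_add_distrib, ite_mul, zero_mul, Finset.sum_ite_mem]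
      rw [Finset.inter_eq_right.2 Finset.subset_union_left,
        Finset.inter_eq_right.2 Finset.subset_union_right]
  have gen : ∀ (n : ℕ) (k : ℤ), k < n → ∀ v ∈ V k, ∃ (S : Finset I) (r : I → A),
      (∀ i, r i ∈ R (k - κ i)) ∧ v = ∑ i ∈ S, r i * φ i := by
    intro n
    induction n with
    | zero =>
      intro k hk v hv
      exact ⟨∅, 0, fun i ↦ zero_mem _, by simp [hVneg k (by simpa using hk) v hv]⟩
    | succ n ih =>
      intro k hk v hv
      push_cast at hk
      obtain ⟨S, c, hS, hw⟩ := hgen k v hv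
      obtain ⟨u, hu, u', hu', hw⟩ := mem_genSub.1 hw
      obtain ⟨S₁, r₁, hr₁, rfl⟩ := ih _ (by omega) u hu
      obtain ⟨S₂, r₂, hr₂, rfl⟩ := ih _ (by omega) u' hu'
      obtain ⟨S₃, r₃, hr₃, h₃⟩ := hadd k S₁ S₂ (fun i ↦ a * r₁ i) (fun i ↦ b * r₂ i)
        (fun i ↦ hRa (by convert hr₁ i using 2; ring)) (fun i ↦ hRb (by convert hr₂ i using 2; ring))
      obtain ⟨S₄, r₄, hr₄, h₄⟩ := hadd k S₃ S r₃ (fun i ↦ if κ i = k then algebraMap ℂ A (c i) else 0)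
        hr₃ (fun i ↦ by
          split_ifs with h
          · rw [h, sub_self, Algebra.algebraMap_eq_smul_one]
            exact (R 0).smul_mem _ h1
          · exact zero_mem _)
      refine ⟨S₄, r₄, hr₄, ?_⟩
      rw [← h₄, ← h₃, ← sub_eq_iff_eq_add]
      convert hw using 1
      · congr 1
        refine Finset.sum_congr rfl fun i hi ↦ ?_
        rw [if_pos (hS i hi), Algebra.smul_def]
      · simp [Finset.mul_sum, mul_assoc]
  have ind : ∀ (n : ℕ) (k : ℤ), k < n → ∀ (S : Finset I) (r : I → A), (∀ i, r i ∈ R (k - κ i)) →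
        ∑ i ∈ S, r i * φ i = 0 → ∀ i ∈ S, r i = 0 := by
    intro n
    induction n with
    | zero =>
      intro k hk S r hr _ i _
      exact hRneg _ (by have := hκ i; simp at hk; omega) _ (hr i)
    | succ n ih =>
      intro k hk S r hr hsum
      push_cast at hk
      have hst (i : I) : ∃ u ∈ R (k - κ i - 4), ∃ v ∈ R (k - κ i - 6), ∃ c : ℂ,
          (κ i ≠ k → c = 0) ∧ r i = a * u + b * v + algebraMap ℂ A c := by
        by_cases h : κ i = k
        · obtain ⟨c, hc⟩ := hR0 (r i) (by simpa [h] using hr i)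
          exact ⟨0, zero_mem _, 0, zero_mem _, c, fun h' ↦ (h' h).elim, by simp [hc]⟩
        · obtain ⟨u, hu, v, hv, h'⟩ := hRgen _ (sub_ne_zero.2 (Ne.symm h)) _ (hr i)
          exact ⟨u, hu, v, hv, 0, fun _ ↦ rfl, by simp [h']⟩
      choose s hs t ht c hc hrst using hst
      have hs' (i : I) : s i ∈ R (k - 4 - κ i) := by convert hs i using 2; ring
      have ht' (i : I) : t i ∈ R (k - 6 - κ i) := by convert ht i using 2; ring
      have hdecomp : a * ∑ i ∈ S, s i * φ i + b * ∑ i ∈ S, t i * φ i + ∑ i ∈ S, c i • φ i = 0 := by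
        rw [← hsum, Finset.mul_sum, Finset.mul_sum, ← Finset.sum_add_distrib,
          ← Finset.sum_add_distrib]
        refine Finset.sum_congr rfl fun i _ ↦ ?_
        rw [hrst i, Algebra.smul_def]; ring
      have hc0 : ∀ i ∈ S, c i = 0 := by
        have h1 : ∑ i ∈ S, c i • φ i = ∑ i ∈ S.filter (fun i ↦ κ i = k), c i • φ i := by
          rw [Finset.sum_filter]
          refine Finset.sum_congr rfl fun i _ ↦ ?_
          split_ifs with h
          · rfl
          · rw [hc i h, zero_smul]
        have h2 := hind k (S.filter (fun i ↦ κ i = k)) c (by simp) (by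
          rw [← h1, mem_genSub]
          refine ⟨_, neg_mem (hmem _ S s hs'), _, neg_mem (hmem _ S t ht'), ?_⟩
          linear_combination hdecomp)
        intro i hi
        by_cases h : κ i = k
        · exact h2 i (by simp [hi, h])
        · exact hc i h
      have hc1 : ∑ i ∈ S, c i • φ i = 0 := Finset.sum_eq_zero fun i hi ↦ by simp [hc0 i hi]
      rw [hc1, add_zero] at hdecomp
      obtain ⟨z, hz, hz1, hz2⟩ := hK k _ (hmem _ S s hs') _ (hmem _ S t ht') hdecomp
      obtain ⟨S', w, hw, rfl⟩ := gen n _ (by omega) z hz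
      have restr (S : Finset I) (f : I → A) : ∑ i ∈ S, f i * φ i =
          ∑ i ∈ S ∪ S', (if i ∈ S then f i else 0) * φ i := by
        simp only [ite_mul, zero_mul, Finset.sum_ite_mem]
        rw [Finset.inter_eq_right.2 Finset.subset_union_left]
      have final (S₀ : Finset I) (m : ℤ) (hm : m < n) (f g : I → A) (hf : ∀ i, f i ∈ R (m - κ i))
          (hg : ∀ i, g i ∈ R (m - κ i)) (h : ∑ i ∈ S₀, f i * φ i = ∑ i ∈ S', g i * φ i) :
          ∀ i ∈ S₀, f i = if i ∈ S' then g i else 0 := by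
        have e1 : ∑ i ∈ S₀ ∪ S', ((if i ∈ S₀ then f i else 0) - if i ∈ S' then g i else 0) * φ i = 0 := by
          simp only [sub_mul, Finset.sum_sub_distrib, ite_mul, zero_mul, Finset.sum_ite_mem]
          rw [Finset.inter_eq_right.2 Finset.subset_union_left,
            Finset.inter_eq_right.2 Finset.subset_union_right, h, sub_self]
        intro i hi
        have := ih m hm _ _ (fun i ↦ by
          refine sub_mem ?_ ?_ <;> split_ifs <;> simp [hf, hg]) e1 i (by simp [hi])
        simpa [hi, sub_eq_zero] using this
      have f1 := final S _ (by omega) s (fun i ↦ b * w i) hs' (fun i ↦ hRb (by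
        convert hw i using 2; ring)) (by rw [hz1, Finset.mul_sum]; simp [mul_assoc])
      have f2 := final S _ (by omega) t (fun i ↦ -(a * w i)) ht' (fun i ↦ neg_mem (hRa (by
        convert hw i using 2; ring))) (by rw [hz2, Finset.mul_sum]; simp [mul_assoc])
      intro i hi
      rw [hrst i, f1 i hi, f2 i hi, hc0 i hi]
      split_ifs <;> simp
      ring
  refine ⟨I, κ, φ, hφ, fun k ↦ gen (k.toNat + 1) k (by omega), fun k ↦ ind (k.toNat + 1) k (by omega)⟩

end Koszul

lemma eq_of_mul_E (h4 : E4f * f = E4f * g) (h6 : E6f * f = E6f * g) : f = g := by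
  ext τ
  rcases E4E6_ne τ with h | h
  · exact mul_left_cancel₀ h (congrFun h4 τ)
  · exact mul_left_cancel₀ h (congrFun h6 τ)

lemma mdiff_quotient (hu : MDiff f) (hv : MDiff g) {z : ℍ → ℂ} (hz4 : E4f * z = f)
    (hz6 : E6f * z = g) : MDiff z := by
  have aux (E F : ℍ → ℂ) (hE : MDiff E) (hF : MDiff F) (h : E * z = F) (τ : ℍ) (hτ : E τ ≠ 0) :
      MDiffAt z τ := by
    rw [UpperHalfPlane.mdifferentiableAt_iff]
    have h1 := UpperHalfPlane.mdifferentiableAt_iff.1 (hF τ)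
    have h2 := UpperHalfPlane.mdifferentiableAt_iff.1 (hE τ)
    refine (h1.div h2 (by simpa using hτ)).congr_of_eventuallyEq ?_
    have h3 := h2.continuousAt.eventually_ne (y := 0) (by simpa using hτ)
    filter_upwards [h3] with w hw
    simp only [Function.comp_apply, Pi.div_apply, ← h, Pi.mul_apply] at hw ⊢
    field_simp
  intro τ
  rcases E4E6_ne τ with h | h
  · exact aux _ _ E4f_mem.1 hu hz4 τ h
  · exact aux _ _ E6f_mem.1 hv hz6 τ h

lemma koszul (hu : f ∈ modSub Γ (k - 4)) (hv : g ∈ modSub Γ (k - 6))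
    (h : E4f * f + E6f * g = 0) : ∃ z ∈ modSub Γ (k - 10), f = E6f * z ∧ g = -(E4f * z) := by
  obtain ⟨z, hz6, hz4⟩ : ∃ z : ℍ → ℂ, E6f * z = f ∧ E4f * z = -g := by
    refine ⟨fun τ ↦ if E6f τ = 0 then -g τ / E4f τ else f τ / E6f τ, ?_, ?_⟩ <;> ext τ <;>
    · have h1 := congrFun h τ
      simp only [Pi.add_apply, Pi.mul_apply, Pi.zero_apply] at h1
      have h2 := E4E6_ne τ
      simp only [Pi.mul_apply, Pi.neg_apply]
      split_ifs with h6
      · have : E4f τ ≠ 0 := by tauto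
        simp [h6] at h1 ⊢
        first | field_simp | tauto
      · field_simp
        try linear_combination h1
  have hs (γ : SL(2, ℤ)) : E6f * (z ∣[k - 10] γ) = f ∣[k - 4] γ ∧
      E4f * (z ∣[k - 10] γ) = (-g) ∣[k - 6] γ := by
    constructor
    · rw [← hz6, show k - 4 = 6 + (k - 10) by ring, mul_slash_SL2, E6f_mem.2.1 γ trivial]
    · rw [← hz4, show k - 6 = 4 + (k - 10) by ring, mul_slash_SL2, E4f_mem.2.1 γ trivial]
  refine ⟨z, ⟨mdiff_quotient hv.1.neg hu.1 hz4 hz6, fun γ hγ ↦ ?_, fun γ ↦ ?_⟩, hz6.symm,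
    by rw [hz4, neg_neg]⟩
  · apply eq_of_mul_E
    · rw [(hs γ).2, hz4, (neg_mem hv : -g ∈ modSub Γ _).2.1 γ hγ]
    · rw [(hs γ).1, hz6, hu.2.1 γ hγ]
  · have h1 := hu.2.2 γ
    rw [← (hs γ).1] at h1
    have h2 : Tendsto (fun τ ↦ (E6f τ)⁻¹) atImInfty (𝓝 1) := by
      simpa using E6f_tendsto.inv₀ one_ne_zero
    have h3 : IsBoundedAtImInfty (fun τ ↦ (E6f τ)⁻¹) := h2.isBigO_one ℝ
    refine (h3.mul h1).congr' ?_ (by simp)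
    filter_upwards [E6f_tendsto.eventually_ne one_ne_zero] with τ hτ
    simp [hτ]

/-- `modSub Γ` is a free graded module over the ring of modular forms of level one. -/
lemma exists_basis (Γ : Subgroup SL(2, ℤ)) [Γ.FiniteIndex] :
    ∃ (I : Type) (κ : I → ℤ) (φ : I → ℍ → ℂ), (∀ i, φ i ∈ modSub Γ (κ i)) ∧
      (∀ k, ∀ v ∈ modSub Γ k, ∃ (S : Finset I) (r : I → ℍ → ℂ), (∀ i, r i ∈ modSub ⊤ (k - κ i)) ∧
        v = ∑ i ∈ S, r i * φ i) ∧
      ∀ (k : ℤ) (S : Finset I) (r : I → ℍ → ℂ), (∀ i, r i ∈ modSub ⊤ (k - κ i)) →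
        ∑ i ∈ S, r i * φ i = 0 → ∀ i ∈ S, r i = 0 :=
  exists_graded_basis (modSub ⊤) (modSub Γ) E4f E6f E4f_mem E6f_mem
    (fun _ ↦ modSub_zero_weight) one_mem (fun _ hn _ ↦ level_one_gen hn)
    (fun _ _ _ hr _ ↦ mul_mem_modSub hr) (fun _ hn _ ↦ modSub_neg_weight hn)
    (fun _ hn _ ↦ modSub_neg_weight hn)
    (fun _ _ _ hr _ ↦ mul_mem_modSub (modSub_mono le_top hr)) (fun _ _ hu _ ↦ koszul hu)

/-- The vector of translates of `f`, indexed by the cosets of `Γ`. -/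
noncomputable def vec (k : ℤ) (f : ℍ → ℂ) (x : SL(2, ℤ) ⧸ Γ) : ℍ → ℂ := f ∣[k] (x.out)⁻¹

lemma vec_mk (hf : ∀ γ ∈ Γ, f ∣[k] γ = f) (g : SL(2, ℤ)) :
    vec k f (g : SL(2, ℤ) ⧸ Γ) = f ∣[k] g⁻¹ := by
  obtain ⟨γ, hγ⟩ := QuotientGroup.mk_out_eq_mul Γ g
  rw [vec, hγ, _root_.mul_inv_rev, SlashAction.slash_mul, hf _ (inv_mem γ.2)]

lemma vec_slash (hf : ∀ γ ∈ Γ, f ∣[k] γ = f) (x : SL(2, ℤ) ⧸ Γ) (γ : SL(2, ℤ)) :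
    (vec k f x) ∣[k] γ = vec k f (γ⁻¹ • x) := by
  induction x using QuotientGroup.induction_on with
  | H g =>
    rw [MulAction.Quotient.smul_mk, vec_mk hf, vec_mk hf, ← SlashAction.slash_mul]
    simp

lemma vec_one (hf : ∀ γ ∈ Γ, f ∣[k] γ = f) : vec k f ((1 : SL(2, ℤ)) : SL(2, ℤ) ⧸ Γ) = f := by
  rw [vec_mk hf, inv_one, SlashAction.slash_one]

lemma vec_add (x : SL(2, ℤ) ⧸ Γ) : vec k (f + g) x = vec k f x + vec k g x :=
  SlashAction.add_slash _ _ _ _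

lemma vec_smul (c : ℂ) (x : SL(2, ℤ) ⧸ Γ) : vec k (c • f) x = c • vec k f x :=
  SL_smul_slash _ _ _ _

lemma vec_sum {ι : Type*} (s : Finset ι) (F : ι → ℍ → ℂ) (x : SL(2, ℤ) ⧸ Γ) :
    vec k (∑ i ∈ s, F i) x = ∑ i ∈ s, vec k (F i) x :=
  by simp [vec, SlashAction.sum_slash]

lemma vec_mul {r : ℍ → ℂ} (hr : r ∈ modSub ⊤ k) (x : SL(2, ℤ) ⧸ Γ) :
    vec (k + l) (r * f) x = r * vec l f x := by
  rw [vec, mul_slash_SL2, hr.2.1 _ trivial, vec]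

lemma mdiff_slash (hf : MDiff f) (k : ℤ) (γ : SL(2, ℤ)) : MDiff (f ∣[k] γ) := by
  rw [SL_slash]; exact MDifferentiable.slash hf k _

lemma vec_mdiff (hf : MDiff f) (x : SL(2, ℤ) ⧸ Γ) : MDiff (vec k f x) := mdiff_slash hf _ _

lemma vec_bdd (hf : f ∈ modSub Γ k) (x : SL(2, ℤ) ⧸ Γ) : IsBoundedAtImInfty (vec k f x) :=
  hf.2.2 _

/-- An equivariant family is the vector of translates of an invariant function. -/
lemma equivariant_mem {F : SL(2, ℤ) ⧸ Γ → ℍ → ℂ} (hF : ∀ (x) (γ : SL(2, ℤ)), (F x) ∣[k] γ = F (γ⁻¹ • x))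
    (hd : ∀ x, MDiff (F x)) (hb : ∀ x, IsBoundedAtImInfty (F x)) :
    ∃ f ∈ modSub Γ k, ∀ x, vec k f x = F x := by
  have h1 (γ : SL(2, ℤ)) : (F (1 : SL(2, ℤ))) ∣[k] γ = F (γ⁻¹ : SL(2, ℤ)) := by
    rw [hF, MulAction.Quotient.smul_mk, smul_eq_mul, mul_one]
  have h2 : ∀ γ ∈ Γ, (F (1 : SL(2, ℤ))) ∣[k] γ = F (1 : SL(2, ℤ)) := fun γ hγ ↦ by
    rw [h1]; congr 1
    exact QuotientGroup.eq.2 (by simpa using hγ)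
  refine ⟨F (1 : SL(2, ℤ)), ⟨hd _, h2, fun γ ↦ by rw [h1]; exact hb _⟩, fun x ↦ ?_⟩
  induction x using QuotientGroup.induction_on with
  | H g => rw [vec_mk h2, h1, inv_inv]

/-- The numerator of `γ • z - conj w`. -/
noncomputable def polarNum (w : ℍ) (γ : SL(2, ℤ)) (z : ℂ) : ℂ :=
  (γ 0 0 * z + γ 0 1) - (starRingEnd ℂ) (w : ℂ) * (γ 1 0 * z + γ 1 1)

/-- A function with a pole of order `k` at the conjugate of `w`. -/
noncomputable def polar (w : ℍ) (k : ℤ) (τ : ℍ) : ℂ := ((τ : ℂ) - (starRingEnd ℂ) (w : ℂ)) ^ (-k)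

lemma denom_int_ne (γ : SL(2, ℤ)) (z : ℍ) : (γ 1 0 * z + γ 1 1 : ℂ) ≠ 0 := by
  rw [← denom_SL]; exact denom_ne_zero _ _

lemma coe_smul_SL (γ : SL(2, ℤ)) (z : ℍ) :
    ((γ • z : ℍ) : ℂ) = (γ 0 0 * z + γ 0 1) / (γ 1 0 * z + γ 1 1) := by
  rw [specialLinearGroup_apply]; simp

lemma polarNum_eq (w : ℍ) (γ : SL(2, ℤ)) (z : ℍ) : polarNum w γ z =
    (((γ • z : ℍ) : ℂ) - (starRingEnd ℂ) (w : ℂ)) * (γ 1 0 * z + γ 1 1) := by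
  rw [coe_smul_SL, sub_mul, div_mul_cancel₀ _ (denom_int_ne γ z), polarNum]

lemma polar_slash (w : ℍ) (k : ℤ) (γ : SL(2, ℤ)) (z : ℍ) :
    ((polar w k) ∣[k] γ) z = polarNum w γ z ^ (-k) := by
  rw [SL_slash_apply, denom_SL, polar, ← mul_zpow, polarNum_eq]

lemma norm_sub_conj_ge (w z : ℍ) : w.im ≤ ‖(z : ℂ) - (starRingEnd ℂ) (w : ℂ)‖ := by
  refine le_trans ?_ (Complex.abs_im_le_norm _)
  have h1 := z.im_pos
  have h2 := w.im_pos
  refine le_trans ?_ (le_abs_self _)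
  simp; linarith

lemma polarNum_lower (w : ℍ) : ∃ c > 0, ∀ (γ : SL(2, ℤ)) (z : ℍ),
    c * ‖(γ 0 0 * z + γ 0 1 : ℂ)‖ ≤ ‖polarNum w γ z‖ ∧
    c * ‖(γ 1 0 * z + γ 1 1 : ℂ)‖ ≤ ‖polarNum w γ z‖ := by
  have hw := w.im_pos
  have hD : 0 < 1 + w.im + ‖(w : ℂ)‖ := by positivity
  have key (z : ℍ) : w.im / (1 + w.im + ‖(w : ℂ)‖) * ‖(z : ℂ)‖ ≤
      ‖(z : ℂ) - (starRingEnd ℂ) (w : ℂ)‖ ∧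
      w.im / (1 + w.im + ‖(w : ℂ)‖) ≤ ‖(z : ℂ) - (starRingEnd ℂ) (w : ℂ)‖ := by
    have h1 := norm_sub_conj_ge w z
    have h2 : ‖(z : ℂ)‖ ≤ ‖(z : ℂ) - (starRingEnd ℂ) (w : ℂ)‖ + ‖(w : ℂ)‖ := by
      have := norm_add_le ((z : ℂ) - (starRingEnd ℂ) (w : ℂ)) ((starRingEnd ℂ) (w : ℂ))
      simpa using this
    have h3 := norm_nonneg (w : ℂ)
    constructor
    · rw [div_mul_eq_mul_div, div_le_iff₀ hD]
      nlinarith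
    · rw [div_le_iff₀ hD]
      nlinarith
  refine ⟨w.im / (1 + w.im + ‖(w : ℂ)‖), by positivity, fun γ z ↦ ?_⟩
  obtain ⟨h1, h2⟩ := key (γ • z)
  rw [polarNum_eq, norm_mul]
  refine ⟨?_, mul_le_mul_of_nonneg_right h2 (norm_nonneg _)⟩
  have : (γ 0 0 * z + γ 0 1 : ℂ) = ((γ • z : ℍ) : ℂ) * (γ 1 0 * z + γ 1 1) := by
    rw [coe_smul_SL, div_mul_cancel₀ _ (denom_int_ne γ z)]
  rw [this, norm_mul, ← mul_assoc]
  exact mul_le_mul_of_nonneg_right h1 (norm_nonneg _)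

lemma row_ne_zero (γ : SL(2, ℤ)) (i : Fin 2) : γ.1 i ≠ 0 := fun h ↦ by
  have := γ.2
  rw [Matrix.det_fin_two] at this
  have h0 := congrFun h 0
  have h1 := congrFun h 1
  fin_cases i <;> simp_all

lemma summable_rows {m : ℕ} (hm : 3 ≤ m) :
    Summable fun γ : SL(2, ℤ) ↦ (‖γ.1 0‖ ^ m)⁻¹ * (‖γ.1 1‖ ^ m)⁻¹ := by
  have h1 : Summable fun x : Fin 2 → ℤ ↦ (‖x‖ ^ m)⁻¹ := by
    have := EisensteinSeries.summable_one_div_norm_rpow (k := m) (by exact_mod_cast hm)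
    refine this.congr fun x ↦ ?_
    rw [Real.rpow_neg (norm_nonneg _), Real.rpow_natCast]
  have h2 := h1.mul_of_nonneg h1 (fun x ↦ by positivity) (fun x ↦ by positivity)
  refine h2.comp_injective (i := fun γ : SL(2, ℤ) ↦ (γ.1 0, γ.1 1)) fun γ δ h ↦ ?_
  simp only [Prod.mk.injEq] at h
  apply Subtype.ext
  funext i
  fin_cases i
  · exact h.1
  · exact h.2

lemma polarNum_ne (w : ℍ) (γ : SL(2, ℤ)) (z : ℍ) : polarNum w γ z ≠ 0 := by
  rw [polarNum_eq]
  refine mul_ne_zero (fun h ↦ ?_) (denom_int_ne γ z)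
  have := norm_sub_conj_ge w (γ • z)
  rw [h, norm_zero] at this
  exact absurd w.im_pos (not_lt.2 this)

lemma polar_bound (w : ℍ) {m : ℕ} (hm : 3 ≤ m) (A : ℝ) {B : ℝ} (hB : 0 < B) :
    ∃ u : SL(2, ℤ) → ℝ, Summable u ∧ (∀ γ, 0 ≤ u γ) ∧ ∀ γ, ∀ z ∈ verticalStrip A B,
      ‖polarNum w γ z ^ (-(2 * m : ℤ))‖ ≤ u γ := by
  obtain ⟨c, hc, h⟩ := polarNum_lower w
  set r := EisensteinSeries.r ⟨⟨A, B⟩, hB⟩ with hr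
  have hr0 : 0 < r := EisensteinSeries.r_pos _
  refine ⟨fun γ ↦ ((c * r) ^ (2 * m))⁻¹ * ((‖γ.1 0‖ ^ m)⁻¹ * (‖γ.1 1‖ ^ m)⁻¹),
    (summable_rows hm).mul_left _, fun γ ↦ by positivity, fun γ z hz ↦ ?_⟩
  have hrow (i : Fin 2) : r * ‖γ.1 i‖ ≤ ‖(γ i 0 * z + γ i 1 : ℂ)‖ :=
    le_trans (mul_le_mul_of_nonneg_right (EisensteinSeries.r_lower_bound_on_verticalStrip z hB hz)
      (norm_nonneg _)) (EisensteinSeries.r_mul_max_le z (row_ne_zero γ i))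
  have e0 : c * r * ‖γ.1 0‖ ≤ ‖polarNum w γ z‖ := by
    refine le_trans ?_ (h γ z).1
    rw [mul_assoc]; exact mul_le_mul_of_nonneg_left (hrow 0) hc.le
  have e1 : c * r * ‖γ.1 1‖ ≤ ‖polarNum w γ z‖ := by
    refine le_trans ?_ (h γ z).2
    rw [mul_assoc]; exact mul_le_mul_of_nonneg_left (hrow 1) hc.le
  have p0 : 0 < ‖γ.1 0‖ := norm_pos_iff.2 (row_ne_zero γ 0)
  have p1 : 0 < ‖γ.1 1‖ := norm_pos_iff.2 (row_ne_zero γ 1)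
  have : (-(2 * m : ℤ)) = -((2 * m : ℕ) : ℤ) := by push_cast; ring
  rw [this, _root_.zpow_neg, zpow_natCast, norm_inv, norm_pow]
  calc (‖polarNum w γ z‖ ^ (2 * m))⁻¹
      ≤ ((c * r * ‖γ.1 0‖) ^ m * (c * r * ‖γ.1 1‖) ^ m)⁻¹ := by
        rw [two_mul m, pow_add]
        apply inv_anti₀ (by positivity)
        gcongr
    _ = _ := by
        rw [mul_pow _ ‖γ.1 0‖, mul_pow _ ‖γ.1 1‖, two_mul m, pow_add]
        field_simp

open Classical in
/-- The summands of the Poincaré series attached to a coset `y`. -/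
noncomputable def poincareTerm (w : ℍ) (m : ℕ) (y x : SL(2, ℤ) ⧸ Γ) (γ : SL(2, ℤ)) (z : ℂ) : ℂ :=
  if γ • x = y then polarNum w γ z ^ (-(2 * m : ℤ)) else 0

lemma poincareTerm_of_eq {w : ℍ} {m : ℕ} {y x : SL(2, ℤ) ⧸ Γ} {γ : SL(2, ℤ)} {z : ℂ}
    (h : γ • x = y) : poincareTerm w m y x γ z = polarNum w γ z ^ (-(2 * m : ℤ)) := if_pos h

lemma poincareTerm_of_ne {w : ℍ} {m : ℕ} {y x : SL(2, ℤ) ⧸ Γ} {γ : SL(2, ℤ)} {z : ℂ}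
    (h : γ • x ≠ y) : poincareTerm w m y x γ z = 0 := if_neg h

lemma norm_poincareTerm_le (w : ℍ) (m : ℕ) (y x : SL(2, ℤ) ⧸ Γ) (γ : SL(2, ℤ)) (z : ℂ) :
    ‖poincareTerm w m y x γ z‖ ≤ ‖polarNum w γ z ^ (-(2 * m : ℤ))‖ := by
  unfold poincareTerm
  split_ifs
  · exact le_rfl
  · rw [norm_zero]; exact norm_nonneg _

/-- The Poincaré series attached to a coset `y`, as a family indexed by the cosets. -/
noncomputable def poincare (w : ℍ) (m : ℕ) (y x : SL(2, ℤ) ⧸ Γ) (z : ℍ) : ℂ :=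
  ∑' γ : SL(2, ℤ), poincareTerm w m y x γ z

lemma polarNum_mul (w : ℍ) (m : ℤ) (γ δ : SL(2, ℤ)) (z : ℍ) :
    polarNum w γ ((δ • z : ℍ) : ℂ) ^ (-m) * (δ 1 0 * z + δ 1 1 : ℂ) ^ (-m) =
      polarNum w (γ * δ) z ^ (-m) := by
  rw [← polar_slash w m (γ * δ), SlashAction.slash_mul, SL_slash_apply, denom_SL, polar_slash]

lemma poincare_slash (w : ℍ) (m : ℕ) (y x : SL(2, ℤ) ⧸ Γ) (δ : SL(2, ℤ)) :
    (poincare w m y x) ∣[(2 * m : ℤ)] δ = poincare w m y (δ⁻¹ • x) := by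
  funext z
  rw [SL_slash_apply, denom_SL, poincare, poincare, ← tsum_mul_right,
    ← (Equiv.mulRight δ).tsum_eq (fun γ ↦ poincareTerm w m y (δ⁻¹ • x) γ z)]
  refine tsum_congr fun γ ↦ ?_
  have e : (γ * δ) • δ⁻¹ • x = γ • x := by rw [smul_smul, _root_.mul_inv_cancel_right]
  rw [Equiv.coe_mulRight]
  by_cases h : γ • x = y
  · rw [poincareTerm_of_eq h, poincareTerm_of_eq (e.trans h), polarNum_mul]
  · rw [poincareTerm_of_ne h, poincareTerm_of_ne (fun h' ↦ h (e.symm.trans h')), zero_mul]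

lemma poincare_bound (w : ℍ) {m : ℕ} (hm : 3 ≤ m) (y : SL(2, ℤ) ⧸ Γ) (A : ℝ) {B : ℝ} (hB : 0 < B) :
    ∃ M, ∀ x, ∀ z ∈ verticalStrip A B, ‖poincare w m y x z‖ ≤ M := by
  obtain ⟨u, hu, -, h⟩ := polar_bound w hm A hB
  refine ⟨∑' γ, u γ, fun x z hz ↦ tsum_of_norm_bounded hu.hasSum fun γ ↦ ?_⟩
  exact (norm_poincareTerm_le _ _ _ _ _ _).trans (h γ z hz)

lemma poincare_isBounded (w : ℍ) {m : ℕ} (hm : 3 ≤ m) (y x : SL(2, ℤ) ⧸ Γ) :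
    IsBoundedAtImInfty (poincare w m y x) := by
  obtain ⟨M, hM⟩ := poincare_bound w hm y 1 one_pos
  rw [isBoundedAtImInfty_iff]
  refine ⟨M, 1, fun z hz ↦ ?_⟩
  have h1 := congrFun (poincare_slash w m y x (ModularGroup.T ^ ⌊z.re⌋))
    (ModularGroup.T ^ (-⌊z.re⌋) • z)
  rw [SL_slash_apply, smul_smul, ← _root_.zpow_add, add_neg_cancel, _root_.zpow_zero, one_smul, denom_SL,
    ModularGroup.coe_T_zpow] at h1
  simp only [Matrix.of_apply, Matrix.cons_val', Matrix.cons_val_zero, Matrix.cons_val_one,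
    Int.cast_zero, Int.cast_one, zero_mul, zero_add, _root_.one_zpow, mul_one] at h1
  rw [h1]
  apply hM
  rw [mem_verticalStrip_iff, modular_T_zpow_smul]
  refine ⟨?_, by simpa using hz⟩
  rw [vadd_re, Int.cast_neg, neg_add_eq_sub, Int.self_sub_floor, Int.abs_fract]
  exact (Int.fract_lt_one _).le

lemma polarNum_differentiable (w : ℍ) (γ : SL(2, ℤ)) : Differentiable ℂ (polarNum w γ) := by
  unfold polarNum; fun_prop

lemma poincare_mdiff (w : ℍ) {m : ℕ} (hm : 3 ≤ m) (y x : SL(2, ℤ) ⧸ Γ) :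
    MDiff (poincare w m y x) := by
  rw [UpperHalfPlane.mdifferentiable_iff]
  intro z₀ hz₀
  have hz₀' : 0 < z₀.im := hz₀
  set U : Set ℂ := {z | |z.re| < |z₀.re| + 1 ∧ z₀.im / 2 < z.im} with hU
  have hUo : IsOpen U := by
    apply IsOpen.inter
    · exact isOpen_lt (f := fun z : ℂ ↦ |z.re|) (by fun_prop) continuous_const
    · exact isOpen_lt (g := fun z : ℂ ↦ z.im) continuous_const (by fun_prop)
  have hz₀U : z₀ ∈ U := ⟨by linarith, by linarith⟩
  have hpos : ∀ z ∈ U, 0 < z.im := fun z hz ↦ by have := hz.2; linarith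
  obtain ⟨u, hu, -, h⟩ := polar_bound w hm (|z₀.re| + 1) (half_pos hz₀')
  have hd : DifferentiableOn ℂ (fun z ↦ ∑' γ, poincareTerm w m y x γ z) U := by
    refine Complex.differentiableOn_tsum_of_summable_norm hu (fun γ ↦ ?_) hUo fun γ z hz ↦ ?_
    · unfold poincareTerm
      split_ifs
      · intro z hz
        refine DifferentiableAt.differentiableWithinAt ?_
        exact ((polarNum_differentiable w γ) z).zpow
          (Or.inl (polarNum_ne w γ ⟨z, hpos z hz⟩))
      · exact differentiableOn_const _
    · refine (norm_poincareTerm_le _ _ _ _ _ _).trans (h γ ⟨z, hpos z hz⟩ ⟨hz.1.le, hz.2.le⟩)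
  refine (DifferentiableAt.congr_of_eventuallyEq (hd.differentiableAt (hUo.mem_nhds hz₀U))
    ?_).differentiableWithinAt
  filter_upwards [hUo.mem_nhds hz₀U] with z hz
  simp only [Function.comp_apply, poincare]
  rw [ofComplex_apply_of_im_pos (hpos z hz)]

lemma poincare_mem (w : ℍ) {m : ℕ} (hm : 3 ≤ m) (y : SL(2, ℤ) ⧸ Γ) :
    ∃ f ∈ modSub Γ (2 * m), ∀ x, vec (2 * m) f x = poincare w m y x :=
  equivariant_mem (poincare_slash w m y) (poincare_mdiff w hm y) (poincare_isBounded w hm y)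

lemma normSq_polarNum_self (w : ℍ) (γ : SL(2, ℤ)) : Complex.normSq (polarNum w γ w) =
    4 * w.im ^ 2 +
      Complex.normSq ((γ 0 0 * w + γ 0 1 : ℂ) - (w : ℂ) * (γ 1 0 * w + γ 1 1)) := by
  have hdet : (γ 0 0 : ℝ) * γ 1 1 - γ 0 1 * γ 1 0 = 1 := by
    have := γ.det_coe
    rw [Matrix.det_fin_two] at this
    exact_mod_cast this
  simp only [polarNum, Complex.normSq_apply, Complex.sub_re, Complex.add_re, Complex.mul_re,
    Complex.sub_im, Complex.add_im, Complex.mul_im, Complex.intCast_re, Complex.intCast_im,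
    Complex.conj_re, Complex.conj_im, coe_re, coe_im]
  linear_combination (4 * w.im ^ 2) * hdet

/-- The normalised value of `polarNum` at the base point. -/
noncomputable def rho (w : ℍ) (γ : SL(2, ℤ)) : ℂ :=
  polarNum w γ w / ((w : ℂ) - (starRingEnd ℂ) (w : ℂ))

lemma sub_conj_ne (w : ℍ) : (w : ℂ) - (starRingEnd ℂ) (w : ℂ) ≠ 0 := fun h ↦ by
  have := norm_sub_conj_ge w w
  rw [h, norm_zero] at this
  exact absurd w.im_pos (not_lt.2 this)

lemma normSq_sub_conj (w : ℍ) :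
    Complex.normSq ((w : ℂ) - (starRingEnd ℂ) (w : ℂ)) = 4 * w.im ^ 2 := by
  simp [Complex.normSq_apply]; ring

lemma normSq_rho (w : ℍ) (γ : SL(2, ℤ)) : Complex.normSq (rho w γ) = 1 +
    Complex.normSq ((γ 0 0 * w + γ 0 1 : ℂ) - (w : ℂ) * (γ 1 0 * w + γ 1 1)) /
      (4 * w.im ^ 2) := by
  have := w.im_pos
  rw [rho, map_div₀, normSq_sub_conj, normSq_polarNum_self, add_div, div_self (by positivity)]

lemma one_le_norm_rho (w : ℍ) (γ : SL(2, ℤ)) : 1 ≤ ‖rho w γ‖ := by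
  have h := normSq_rho w γ
  have := w.im_pos
  rw [Complex.normSq_eq_norm_sq] at h
  have h2 : 0 ≤ Complex.normSq ((γ 0 0 * w + γ 0 1 : ℂ) - (w : ℂ) * (γ 1 0 * w + γ 1 1)) /
      (4 * w.im ^ 2) := div_nonneg (Complex.normSq_nonneg _) (by positivity)
  nlinarith [norm_nonneg (rho w γ)]

lemma fixed_of_norm_rho (w : ℍ) (γ : SL(2, ℤ)) (h1 : ‖rho w γ‖ = 1) :
    (γ 0 0 * w + γ 0 1 : ℂ) = (w : ℂ) * (γ 1 0 * w + γ 1 1) ∧ rho w γ = γ 1 0 * w + γ 1 1 := by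
  have h := normSq_rho w γ
  have := w.im_pos
  rw [Complex.normSq_eq_norm_sq, h1] at h
  have h2 : Complex.normSq ((γ 0 0 * w + γ 0 1 : ℂ) - (w : ℂ) * (γ 1 0 * w + γ 1 1)) /
      (4 * w.im ^ 2) = 0 := by linarith
  rw [div_eq_zero_iff, or_iff_left (by positivity), Complex.normSq_eq_zero, sub_eq_zero] at h2
  refine ⟨h2, ?_⟩
  rw [rho, polarNum, h2, div_eq_iff (sub_conj_ne w)]
  ring

lemma rho_unit (w : ℍ) (γ : SL(2, ℤ)) (h1 : ‖rho w γ‖ = 1) :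
    rho w γ ^ 12 = 1 ∧ (rho w γ ^ 2 = 1 → γ = 1 ∨ γ = -1) := by
  obtain ⟨h2, h3⟩ := fixed_of_norm_rho w γ h1
  have hdet : (γ 0 0 : ℂ) * γ 1 1 - γ 0 1 * γ 1 0 = 1 := by
    have := γ.det_coe
    rw [Matrix.det_fin_two] at this
    exact_mod_cast this
  set t : ℤ := γ 0 0 + γ 1 1 with ht
  set j := rho w γ with hj
  have hq : j ^ 2 = t * j - 1 := by
    rw [h3, ht]; push_cast
    linear_combination (-(γ 1 0 : ℂ)) * h2 - hdet
  have hn : j * (starRingEnd ℂ) j = 1 := by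
    rw [Complex.mul_conj, Complex.normSq_eq_norm_sq, h1]; simp
  have hj0 : j ≠ 0 := fun h ↦ by rw [h] at h1; simp at h1
  have ht2 : (t : ℝ) = 2 * j.re := by
    have : (t : ℂ) = j + (starRingEnd ℂ) j := by
      apply mul_left_cancel₀ hj0
      linear_combination (-1 : ℂ) * hq - hn
    rw [Complex.add_conj] at this
    exact_mod_cast this
  have hre : |j.re| ≤ 1 := h1 ▸ Complex.abs_re_le_norm j
  rw [abs_le] at hre
  have t1 : -2 ≤ t := by
    have : (-2 : ℝ) ≤ t := by linarith
    exact_mod_cast this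
  have t2 : t ≤ 2 := by
    have : (t : ℝ) ≤ 2 := by linarith
    exact_mod_cast this
  constructor
  · clear_value t j
    interval_cases t
    · have : (j + 1) ^ 2 = 0 := by push_cast at hq; linear_combination hq
      have : j = -1 := by linear_combination (pow_eq_zero_iff two_ne_zero).1 this
      rw [this]; norm_num
    · have : j ^ 3 = 1 := by push_cast at hq; linear_combination (j - 1) * hq
      rw [show j ^ 12 = (j ^ 3) ^ 4 by ring, this]; norm_num
    · have : j ^ 2 = -1 := by push_cast at hq; linear_combination hq
      rw [show j ^ 12 = (j ^ 2) ^ 6 by ring, this]; norm_num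
    · have : j ^ 3 = -1 := by push_cast at hq; linear_combination (j + 1) * hq
      rw [show j ^ 12 = (j ^ 3) ^ 4 by ring, this]; norm_num
    · have : (j - 1) ^ 2 = 0 := by push_cast at hq; linear_combination hq
      have : j = 1 := by linear_combination (pow_eq_zero_iff two_ne_zero).1 this
      rw [this]; norm_num
  · intro hs
    have him : j.im = 0 := by
      rcases sq_eq_one_iff.1 hs with h | h <;> simp [h]
    have h10 : γ 1 0 = 0 := by
      rw [h3] at him
      have : (γ 1 0 : ℝ) * w.im = 0 := by simpa using him
      rcases mul_eq_zero.1 this with h | h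
      · exact_mod_cast h
      · exact absurd h w.im_ne_zero
    rw [h10, Int.cast_zero, zero_mul, zero_add] at h3
    rw [h3] at hs
    have hd : γ 1 1 ^ 2 = 1 := by exact_mod_cast hs
    have hdet' : γ 0 0 * γ 1 1 = 1 := by
      rw [h10] at hdet
      push_cast at hdet
      have : (γ 0 0 : ℂ) * γ 1 1 = 1 := by linear_combination hdet
      exact_mod_cast this
    have ha : γ 0 0 = γ 1 1 := by linear_combination (γ 1 1) * hdet' - (γ 0 0) * hd
    have hb : γ 0 1 = 0 := by
      rw [h10, ha] at h2
      have : (γ 0 1 : ℂ) = 0 := by push_cast at h2; linear_combination h2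
      exact_mod_cast this
    rcases sq_eq_one_iff.1 hd with h | h
    · left
      ext i j
      fin_cases i <;> fin_cases j <;> simp [h10, ha, hb, h]
    · right
      ext i j
      fin_cases i <;> fin_cases j <;> simp [h10, ha, hb, h]

lemma rho_ne (w : ℍ) (γ : SL(2, ℤ)) : rho w γ ≠ 0 := fun h ↦ by
  have := one_le_norm_rho w γ
  rw [h, norm_zero] at this
  norm_num at this

lemma rho_one (w : ℍ) : rho w 1 = 1 := by
  rw [rho, polarNum]
  simp [div_self (sub_conj_ne w)]

lemma rho_neg_one (w : ℍ) : rho w (-1) = -1 := by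
  rw [rho, polarNum, div_eq_iff (sub_conj_ne w)]
  simp
  ring

lemma polarNum_eq_rho (w : ℍ) (γ : SL(2, ℤ)) (m : ℕ) :
    ((w : ℂ) - (starRingEnd ℂ) (w : ℂ)) ^ (2 * m) * polarNum w γ w ^ (-(2 * m : ℤ)) =
      ((rho w γ)⁻¹ ^ 2) ^ m := by
  have h1 := sub_conj_ne w
  have h2 : polarNum w γ w = rho w γ * ((w : ℂ) - (starRingEnd ℂ) (w : ℂ)) := by
    rw [rho, div_mul_cancel₀ _ h1]
  have h3 := rho_ne w γ
  have : (-(2 * m : ℤ)) = -((2 * m : ℕ) : ℤ) := by push_cast; ring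
  rw [h2, this, _root_.zpow_neg, zpow_natCast, mul_pow, ← pow_mul, inv_pow]
  field_simp

lemma tendsto_geom_rho (w : ℍ) (γ : SL(2, ℤ)) :
    Tendsto (fun K : ℕ ↦ ∑ r ∈ Finset.range 6, ((rho w γ)⁻¹ ^ 2) ^ (6 * K + r)) atTop
      (𝓝 (if γ = 1 ∨ γ = -1 then 6 else 0)) := by
  set q := (rho w γ)⁻¹ ^ 2 with hq
  have e (K : ℕ) : ∑ r ∈ Finset.range 6, q ^ (6 * K + r) =
      (q ^ 6) ^ K * ∑ r ∈ Finset.range 6, q ^ r := by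
    rw [Finset.mul_sum]
    exact Finset.sum_congr rfl fun r _ ↦ by rw [pow_add, pow_mul]
  simp_rw [e]
  rcases (one_le_norm_rho w γ).lt_or_eq with h | h
  · have hn : ‖q ^ 6‖ < 1 := by
      rw [hq, ← pow_mul, norm_pow, norm_inv]
      exact pow_lt_one₀ (by positivity) (inv_lt_one_of_one_lt₀ h) (by norm_num)
    have h1 : ¬ (γ = 1 ∨ γ = -1) := by
      rintro (h' | h') <;> rw [h'] at h <;> refine absurd h (not_lt.2 ?_)
      · simp [rho_one]
      · simp [rho_neg_one]
    rw [if_neg h1]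
    simpa using (tendsto_pow_atTop_nhds_zero_of_norm_lt_one hn).mul_const
      (∑ r ∈ Finset.range 6, q ^ r)
  · obtain ⟨h1, h2⟩ := rho_unit w γ h.symm
    have h6 : q ^ 6 = 1 := by
      rw [hq, ← pow_mul, inv_pow, h1, inv_one]
    simp only [h6, one_pow, one_mul]
    convert tendsto_const_nhds using 2
    by_cases hq1 : q = 1
    · rw [if_pos, hq1]
      · simp
      · apply h2
        rw [hq, inv_pow, inv_eq_one] at hq1
        exact hq1
    · rw [if_neg, geom_sum_eq hq1, h6, sub_self, zero_div]
      rintro (h' | h') <;> refine hq1 ?_ <;> rw [hq, h']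
      · simp [rho_one]
      · simp [rho_neg_one]

lemma neg_one_smul (hneg : (-1 : SL(2, ℤ)) ∈ Γ) (x : SL(2, ℤ) ⧸ Γ) : (-1 : SL(2, ℤ)) • x = x := by
  induction x using QuotientGroup.induction_on with
  | H g =>
    rw [MulAction.Quotient.smul_mk, QuotientGroup.eq]
    have : ((-1 : SL(2, ℤ)) • g)⁻¹ * g = -1 := by
      rw [smul_eq_mul, neg_mul, one_mul, inv_neg, neg_mul, inv_mul_cancel]
    rw [this]; exact hneg

open Classical in
lemma tendsto_poincare (hneg : (-1 : SL(2, ℤ)) ∈ Γ) (w : ℍ) (y x : SL(2, ℤ) ⧸ Γ) :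
    Tendsto (fun K : ℕ ↦ ∑ r ∈ Finset.range 6,
      ((w : ℂ) - (starRingEnd ℂ) (w : ℂ)) ^ (2 * (6 * K + r)) * poincare w (6 * K + r) y x w) atTop
      (𝓝 (if x = y then 12 else 0)) := by
  obtain ⟨u, hu, hu0, hub⟩ := polar_bound w (m := 6) (by norm_num) |w.re| w.im_pos
  have hb (γ : SL(2, ℤ)) (m : ℕ) (hm : 6 ≤ m) : ‖((rho w γ)⁻¹ ^ 2) ^ m‖ ≤
      ‖((w : ℂ) - (starRingEnd ℂ) (w : ℂ)) ^ (2 * 6)‖ * u γ := by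
    calc _ ≤ ‖((rho w γ)⁻¹ ^ 2) ^ 6‖ := by
          rw [norm_pow, norm_pow _ 6]
          refine pow_le_pow_of_le_one (norm_nonneg _) ?_ hm
          rw [norm_pow, norm_inv]
          exact pow_le_one₀ (by positivity) (inv_le_one_of_one_le₀ (one_le_norm_rho w γ))
      _ ≤ _ := by
          rw [← polarNum_eq_rho, norm_mul]
          exact mul_le_mul_of_nonneg_left (hub γ w ⟨le_rfl, le_rfl⟩) (norm_nonneg _)
  have hterm (m : ℕ) (γ : SL(2, ℤ)) : ((w : ℂ) - (starRingEnd ℂ) (w : ℂ)) ^ (2 * m) *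
      poincareTerm w m y x γ w = if γ • x = y then ((rho w γ)⁻¹ ^ 2) ^ m else 0 := by
    split_ifs with h
    · rw [poincareTerm_of_eq h, polarNum_eq_rho]
    · rw [poincareTerm_of_ne h, mul_zero]
  have hsum (m : ℕ) (hm : 6 ≤ m) :
      Summable fun γ : SL(2, ℤ) ↦ if γ • x = y then ((rho w γ)⁻¹ ^ 2) ^ m else 0 := by
    refine Summable.of_norm_bounded
      (hu.mul_left ‖((w : ℂ) - (starRingEnd ℂ) (w : ℂ)) ^ (2 * 6)‖) fun γ ↦ ?_
    split_ifs
    · exact hb γ m hm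
    · rw [norm_zero]; exact mul_nonneg (norm_nonneg _) (hu0 γ)
  have hlim : (if x = y then 12 else 0 : ℂ) = ∑' γ : SL(2, ℤ),
      if γ • x = y then (if γ = 1 ∨ γ = -1 then 6 else 0) else 0 := by
    rw [tsum_eq_sum (s := {1, -1})]
    · have h1 : (1 : SL(2, ℤ)) ≠ -1 := fun h ↦ by
        have := congrArg (fun g : SL(2, ℤ) ↦ g 0 0) h
        simp at this
      rw [Finset.sum_pair h1, one_smul, neg_one_smul hneg]
      rw [if_pos (Or.inl rfl), if_pos (Or.inr rfl)]
      split_ifs <;> norm_num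
    · intro γ hγ
      have : ¬ (γ = 1 ∨ γ = -1) := by simpa using hγ
      rw [if_neg this, ite_self]
  rw [hlim]
  have hK : (fun K : ℕ ↦ ∑' γ : SL(2, ℤ), if γ • x = y then
      ∑ r ∈ Finset.range 6, ((rho w γ)⁻¹ ^ 2) ^ (6 * K + r) else 0) =ᶠ[atTop]
      (fun K : ℕ ↦ ∑ r ∈ Finset.range 6,
      ((w : ℂ) - (starRingEnd ℂ) (w : ℂ)) ^ (2 * (6 * K + r)) *
        poincare w (6 * K + r) y x w) := by
    filter_upwards [eventually_ge_atTop 1] with K hK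
    simp_rw [poincare, ← tsum_mul_left, hterm]
    rw [← Summable.tsum_finsetSum]
    · refine tsum_congr fun γ ↦ ?_
      split_ifs <;> simp
    · intro r _
      exact hsum _ (by omega)
  refine Tendsto.congr' hK ?_
  refine tendsto_tsum_of_dominated_convergence
    (bound := fun γ ↦ 6 * (‖((w : ℂ) - (starRingEnd ℂ) (w : ℂ)) ^ (2 * 6)‖ * u γ))
    ((hu.mul_left _).mul_left _) (fun γ ↦ ?_) ?_
  · split_ifs
    · exact tendsto_geom_rho w γ |>.congr' (by rfl) |> fun h ↦ by simpa [*] using h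
    · exact tendsto_geom_rho w γ |>.congr' (by rfl) |> fun h ↦ by simpa [*] using h
    · exact tendsto_const_nhds
  · filter_upwards [eventually_ge_atTop 1] with K hK γ
    split_ifs
    · refine (norm_sum_le _ _).trans ?_
      refine (Finset.sum_le_card_nsmul _ _ _ fun r _ ↦ hb γ (6 * K + r) (by omega)).trans ?_
      simp
    · rw [norm_zero]
      exact mul_nonneg (by norm_num) (mul_nonneg (norm_nonneg _) (hu0 γ))

/-- Values of forms at a point span the whole space of vectors indexed by cosets. -/
theorem span_vec [Γ.FiniteIndex] (hneg : (-1 : SL(2, ℤ)) ∈ Γ) (w : ℍ) :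
    Submodule.span ℂ {v : SL(2, ℤ) ⧸ Γ → ℂ | ∃ k, ∃ f ∈ modSub Γ k, v = fun x ↦ vec k f x w} = ⊤ := by
  classical
  have : Fintype (SL(2, ℤ) ⧸ Γ) := Fintype.ofFinite _
  set V := Submodule.span ℂ
    {v : SL(2, ℤ) ⧸ Γ → ℂ | ∃ k, ∃ f ∈ modSub Γ k, v = fun x ↦ vec k f x w} with hV
  have key (y : SL(2, ℤ) ⧸ Γ) : (fun x ↦ if x = y then (12 : ℂ) else 0) ∈ V := by
    have hc : IsClosed (V : Set (SL(2, ℤ) ⧸ Γ → ℂ)) := V.closed_of_finiteDimensional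
    refine hc.mem_of_tendsto (f := fun K : ℕ ↦ ∑ r ∈ Finset.range 6,
      ((w : ℂ) - (starRingEnd ℂ) (w : ℂ)) ^ (2 * (6 * K + r)) •
        fun x ↦ poincare w (6 * K + r) y x w) (b := atTop) ?_ ?_
    · rw [tendsto_pi_nhds]
      intro x
      simpa only [Finset.sum_apply, Pi.smul_apply, smul_eq_mul] using tendsto_poincare hneg w y x
    · filter_upwards [eventually_ge_atTop 1] with K hK
      refine Submodule.sum_mem _ fun r _ ↦ Submodule.smul_mem _ _ (Submodule.subset_span ?_)
      obtain ⟨f, hf, h⟩ := poincare_mem w (m := 6 * K + r) (by omega) y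
      exact ⟨_, f, hf, funext fun x ↦ by rw [h]⟩
  rw [eq_top_iff]
  intro v _
  have : v = ∑ y, (v y / 12) • (fun x ↦ if x = y then (12 : ℂ) else 0) := by
    funext x
    simp
  rw [this]
  exact Submodule.sum_mem _ fun y _ ↦ Submodule.smul_mem _ _ (key y)

lemma card_eigenvalue_one {X : Type*} [Fintype X] {G : Type*} [Group G] [MulAction G X] (t : G)
    (b : Module.Basis X ℂ (X → ℂ)) (μ : X → ℂ) (h : ∀ l x, b l (t • x) = μ l * b l x) :
    Nat.card {l // μ l = 1} = Nat.card (MulAction.orbitRel.Quotient (Subgroup.zpowers t) X) := by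
  classical
  set W : Submodule ℂ (X → ℂ) := LinearMap.ker (LinearMap.funLeft ℂ ℂ (t • · : X → X) - LinearMap.id)
    with hW
  have memW (v : X → ℂ) : v ∈ W ↔ ∀ x, v (t • x) = v x := by
    rw [hW, LinearMap.mem_ker, LinearMap.sub_apply, sub_eq_zero, funext_iff]
    rfl
  have h1 : Module.finrank ℂ W = Nat.card {l // μ l = 1} := by
    have hli : LinearIndependent ℂ (fun l : {l // μ l = 1} ↦ b l) :=
      b.linearIndependent.comp _ Subtype.val_injective
    rw [Nat.card_eq_fintype_card, ← finrank_span_eq_card hli]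
    have : W = Submodule.span ℂ (Set.range fun l : {l // μ l = 1} ↦ b l) := by
      apply le_antisymm
      · intro v hv
        rw [memW] at hv
        have hc : ∀ l, b.repr v l * (μ l - 1) = 0 := by
          have : ∑ l, (b.repr v l * (μ l - 1)) • b l = 0 := by
            funext x
            have e1 := congrFun (b.sum_repr v) (t • x)
            have e2 := congrFun (b.sum_repr v) x
            rw [hv, ← e2] at e1
            simp only [Finset.sum_apply, Pi.smul_apply, smul_eq_mul, h, Pi.zero_apply] at e1 ⊢
            rw [← sub_eq_zero, ← Finset.sum_sub_distrib] at e1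
            rw [← e1]
            exact Finset.sum_congr rfl fun l _ ↦ by ring
          exact fun l ↦ Fintype.linearIndependent_iff.1 b.linearIndependent _ this l
        rw [← b.sum_repr v]
        refine Submodule.sum_mem _ fun l _ ↦ ?_
        rcases mul_eq_zero.1 (hc l) with h0 | h0
        · rw [h0, zero_smul]; exact Submodule.zero_mem _
        · exact Submodule.smul_mem _ _ (Submodule.subset_span ⟨⟨l, sub_eq_zero.1 h0⟩, rfl⟩)
      · rw [Submodule.span_le]
        rintro _ ⟨l, rfl⟩
        rw [SetLike.mem_coe, memW]
        intro x
        change b l (t • x) = b l x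
        rw [h, l.2, one_mul]
    rw [this]
  rw [← h1]
  let Q := MulAction.orbitRel.Quotient (Subgroup.zpowers t) X
  have : Finite Q := Quotient.finite _
  have : Fintype Q := Fintype.ofFinite _
  let π : X → Q := Quotient.mk _
  have hπ : Function.Surjective π := Quotient.mk_surjective
  have hinj := LinearMap.funLeft_injective_of_surjective ℂ ℂ π hπ
  have hr : LinearMap.range (LinearMap.funLeft ℂ ℂ π) = W := by
    ext v
    rw [memW, LinearMap.mem_range]
    constructor
    · rintro ⟨u, rfl⟩ x
      change u (π (t • x)) = u (π x)
      congr 1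
      exact Quotient.sound ⟨⟨t, Subgroup.mem_zpowers t⟩, rfl⟩
    · intro hv
      have hz : ∀ (n : ℤ) x, v (t ^ n • x) = v x := by
        intro n
        induction n using Int.induction_on with
        | zero => simp
        | succ n ih => intro x; rw [_root_.zpow_add_one, mul_smul, ih, hv]
        | pred n ih =>
          intro x; rw [_root_.zpow_sub_one, mul_smul, ih, ← hv, smul_inv_smul]
      refine ⟨Quotient.lift v ?_, rfl⟩
      rintro x y ⟨⟨g, n, hg⟩, hxy⟩
      change g • y = x at hxy
      rw [← hxy, ← hg]
      exact hz n y
  rw [← hr, LinearMap.finrank_range_of_inj hinj, Module.finrank_fintype_fun_eq_card,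
    Nat.card_eq_fintype_card]

lemma exists_eigenbasis {X : Type*} [Fintype X] {G : Type*} [Group G] [MulAction G X] (t : G) :
    ∃ (b : Module.Basis X ℂ (X → ℂ)) (μ : X → ℂ), (∀ l x, b l (t • x) = μ l * b l x) ∧
      ∀ l, ‖μ l‖ = 1 := by
  classical
  set P : Module.End ℂ (X → ℂ) := LinearMap.funLeft ℂ ℂ (t • · : X → X) with hP
  set N := orderOf (MulAction.toPerm t : Equiv.Perm X) with hN
  have hN0 : N ≠ 0 := (orderOf_pos _).ne'
  have hpow (n : ℕ) (v : X → ℂ) (x : X) : (P ^ n) v x = v (t ^ n • x) := by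
    induction n generalizing v with
    | zero => simp
    | succ n ih =>
      rw [pow_succ, Module.End.mul_apply, ih, hP, LinearMap.funLeft_apply, smul_smul, ← pow_succ']
  have htN (x : X) : t ^ N • x = x := by
    have := congrArg (fun σ : Equiv.Perm X ↦ σ x) (pow_orderOf_eq_one (MulAction.toPerm t))
    rw [← hN, ← MulAction.toPermHom_apply, ← map_pow] at this
    simpa using this
  have hPN : P ^ N = 1 := by
    ext v x
    simp [hpow, htN]
  have hss : P.IsSemisimple := by
    refine Module.End.isSemisimple_of_squarefree_aeval_eq_zero
      (p := Polynomial.X ^ N - Polynomial.C 1) ?_ ?_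
    · exact (Polynomial.separable_X_pow_sub_C (1 : ℂ) (by exact_mod_cast hN0) one_ne_zero).squarefree
    · simp [hPN]
  have hinternal : DirectSum.IsInternal P.eigenspace :=
    DirectSum.isInternal_submodule_of_iSupIndep_of_iSup_eq_top P.eigenspaces_iSupIndep
      hss.iSup_eigenspace_eq_top
  let b := hinternal.collectedBasis fun μ ↦ Module.Free.chooseBasis ℂ (P.eigenspace μ)
  have hb (a) : P (b a) = a.1 • b a :=
    Module.End.mem_eigenspace_iff.1 (hinternal.collectedBasis_mem _ a)
  have : Fintype (Σ μ, Module.Free.ChooseBasisIndex ℂ (P.eigenspace μ)) :=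
    FiniteDimensional.fintypeBasisIndex b
  have hcard := Module.finrank_eq_card_basis b
  rw [Module.finrank_fintype_fun_eq_card] at hcard
  let e := Fintype.equivOfCardEq hcard
  refine ⟨b.reindex e.symm, fun l ↦ (e l).1, fun l x ↦ ?_, fun l ↦ ?_⟩
  · rw [Module.Basis.reindex_apply, Equiv.symm_symm]
    exact congrFun (hb (e l)) x
  · have hpw (n : ℕ) : (P ^ n) (b (e l)) = (e l).1 ^ n • b (e l) := by
      induction n with
      | zero => simp
      | succ n ih => rw [pow_succ', Module.End.mul_apply, ih, _root_.map_smul, hb, smul_smul, pow_succ]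
    have h1 := hpw N
    rw [hPN, Module.End.one_apply] at h1
    have h2 : (e l).1 ^ N = 1 := by
      have h3 : ((e l).1 ^ N - 1) • b (e l) = 0 := by
        rw [sub_smul, one_smul, ← h1, sub_self]
      exact sub_eq_zero.1 ((smul_eq_zero.1 h3).resolve_right (b.ne_zero _))
    exact Complex.norm_eq_one_of_pow_eq_one h2 hN0

section

open Real

/-- The exponent in `[0, 1)` of a complex number of norm one. -/
noncomputable def fracExp (μ : ℂ) : ℝ := Int.fract (μ.arg / (2 * π))

lemma exp_fracExp {μ : ℂ} (hμ : ‖μ‖ = 1) : Complex.exp (2 * π * Complex.I * fracExp μ) = μ := by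
  have h : (2 * π * Complex.I * fracExp μ : ℂ) =
      μ.arg * Complex.I + (-⌊μ.arg / (2 * π)⌋ : ℤ) * (2 * π * Complex.I) := by
    rw [fracExp, Int.fract]
    have : (π : ℂ) ≠ 0 := by exact_mod_cast pi_ne_zero
    push_cast
    field_simp
    ring
  rw [h, Complex.exp_add, Complex.exp_int_mul_two_pi_mul_I, mul_one]
  have := Complex.norm_mul_exp_arg_mul_I μ
  rwa [hμ, Complex.ofReal_one, one_mul] at this

lemma fracExp_nonneg (μ : ℂ) : 0 ≤ fracExp μ := Int.fract_nonneg _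

lemma fracExp_lt_one (μ : ℂ) : fracExp μ < 1 := Int.fract_lt_one _

lemma fracExp_one : fracExp 1 = 0 := by simp [fracExp]

/-- The multiplier making an eigenfunction of translation periodic. -/
noncomputable def twist (μ : ℂ) (τ : ℍ) : ℂ := Complex.exp (-(2 * π * Complex.I * fracExp μ * τ))

lemma twist_one : twist 1 = 1 := by
  ext τ; simp [twist, fracExp_one]

lemma norm_twist (μ : ℂ) (τ : ℍ) : ‖twist μ τ‖ = Real.exp (2 * π * fracExp μ * τ.im) := by
  rw [twist, Complex.norm_exp]
  congr 1
  simp [Complex.mul_re]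

lemma twist_vadd {μ : ℂ} (hμ : ‖μ‖ = 1) (τ : ℍ) :
    twist μ ((1 : ℝ) +ᵥ τ) * μ = twist μ τ := by
  have e := exp_fracExp hμ
  rw [twist, twist]
  conv_lhs => arg 2; rw [← e]
  rw [← Complex.exp_add]
  congr 1
  rw [coe_vadd]
  push_cast
  ring

lemma mdiff_exp_mul (c : ℂ) : MDiff fun τ : ℍ ↦ Complex.exp (c * τ) := by
  rw [UpperHalfPlane.mdifferentiable_iff]
  have : DifferentiableOn ℂ (fun z : ℂ ↦ Complex.exp (c * z)) {z | 0 < z.im} := by fun_prop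
  refine this.congr fun z hz ↦ ?_
  simp [ofComplex_apply_of_im_pos hz]

lemma twist_mdiff (μ : ℂ) : MDiff (twist μ) := by
  convert mdiff_exp_mul (-(2 * π * Complex.I * fracExp μ)) using 1
  ext τ; rw [twist]; congr 1; ring

lemma disc_isBigO_exp : discriminant =O[atImInfty] fun τ ↦ Real.exp (-2 * π * τ.im) := by
  have := CuspFormClass.exp_decay_atImInfty (h := 1) CuspForm.discriminant one_pos
    one_mem_strictPeriods_SL
  simpa using this

lemma tendsto_exp_neg {c : ℝ} (hc : 0 < c) :
    Tendsto (fun τ : ℍ ↦ Real.exp (-(c * τ.im))) atImInfty (𝓝 0) := by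
  refine Real.tendsto_exp_neg_atTop_nhds_zero.comp ?_
  exact (tendsto_comap (f := UpperHalfPlane.im)).const_mul_atTop hc

/-- Bounded eigenfunctions of translation have a regular leading term at the cusp. -/
lemma eigen_decay {ψ : ℍ → ℂ} (hd : MDiff ψ) (hb : IsBoundedAtImInfty ψ) {μ : ℂ} (hμ : ‖μ‖ = 1)
    (h : ∀ τ, ψ ((1 : ℝ) +ᵥ τ) = μ * ψ τ) :
    ∃ L, (fun τ ↦ (twist μ * ψ) τ - L) =O[atImInfty] discriminant := by
  have hper (τ : ℍ) : (twist μ * ψ) ((1 : ℝ) +ᵥ τ) = (twist μ * ψ) τ := by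
    rw [Pi.mul_apply, Pi.mul_apply, h, ← mul_assoc, twist_vadd hμ]
  have hφd : MDiff (twist μ * ψ) := (twist_mdiff μ).mul hd
  set q : ℍ → ℂ := fun τ ↦ Complex.exp (2 * π * Complex.I * τ) with hq
  have hqd : MDiff q := mdiff_exp_mul _
  have hqp (τ : ℍ) : q ((1 : ℝ) +ᵥ τ) = q τ := by
    simp only [hq, coe_vadd]
    rw [Complex.ofReal_one, mul_add, Complex.exp_add, mul_one, Complex.exp_two_pi_mul_I, one_mul]
  have hqn (τ : ℍ) : ‖q τ‖ = Real.exp (-2 * π * τ.im) := by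
    rw [hq, Complex.norm_exp]
    congr 1
    simp [Complex.mul_re]
  have hm := fracExp_lt_one μ
  have hχ0 : Tendsto (q * (twist μ * ψ)) atImInfty (𝓝 0) := by
    have h1 : (q * (twist μ * ψ)) =O[atImInfty]
        fun τ : ℍ ↦ Real.exp (-(2 * π * (1 - fracExp μ) * τ.im)) := by
      have h2 : (q * twist μ) =O[atImInfty]
          fun τ : ℍ ↦ Real.exp (-(2 * π * (1 - fracExp μ) * τ.im)) := by
        refine Asymptotics.isBigO_of_le _ fun τ ↦ ?_
        rw [Pi.mul_apply, norm_mul, hqn, norm_twist, ← Real.exp_add, Real.norm_eq_abs,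
          Real.abs_exp]
        apply le_of_eq
        congr 1
        ring
      have h3 := h2.mul hb
      rw [← mul_assoc]
      exact h3.congr_right fun τ ↦ by simp
    refine h1.trans_tendsto (tendsto_exp_neg ?_)
    have := pi_pos
    have : 0 < 1 - fracExp μ := by linarith
    positivity
  have hχb : IsBoundedAtImInfty (q * (twist μ * ψ)) := hχ0.isBigO_one ℝ
  obtain ⟨L, hL⟩ := periodic_decay (hqd.mul hφd)
    (fun τ ↦ by
      change q _ * (twist μ * ψ) _ = q τ * (twist μ * ψ) τ
      rw [hqp, hper]) hχb
  obtain rfl := tendsto_nhds_unique (tendsto_of_isBigO_sub hL) hχ0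
  have hb' : IsBoundedAtImInfty (twist μ * ψ) := by
    have h1 : (q * (twist μ * ψ)) =O[atImInfty] fun τ ↦ Real.exp (-2 * π * τ.im) := by
      refine Asymptotics.IsBigO.trans ?_ disc_isBigO_exp
      exact hL.congr_left fun τ ↦ sub_zero _
    obtain ⟨C, hC⟩ := h1.bound
    refine Asymptotics.IsBigO.of_bound C ?_
    filter_upwards [hC] with τ hτ
    rw [Pi.mul_apply, norm_mul, hqn, Real.norm_eq_abs, Real.abs_exp, mul_comm C] at hτ
    have := le_of_mul_le_mul_left hτ (Real.exp_pos _)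
    simpa using this
  exact periodic_decay hφd hper hb'

end

lemma isZero_sum_smul {ι : Type*} [Fintype ι] (c : ι → ℂ) {F : ι → ℍ → ℂ}
    (h : ∀ i, IsZeroAtImInfty (F i)) : IsZeroAtImInfty (∑ i, c i • F i) := by
  have := tendsto_finsetSum Finset.univ fun i _ ↦ Tendsto.const_smul (h i) (c i)
  simp only [smul_zero, Finset.sum_const_zero] at this
  refine Tendsto.congr (fun τ ↦ ?_) this
  simp

section Cusp

variable [Fintype (SL(2, ℤ) ⧸ Γ)]
  (b : Module.Basis (SL(2, ℤ) ⧸ Γ) ℂ (SL(2, ℤ) ⧸ Γ → ℂ)) (μ : SL(2, ℤ) ⧸ Γ → ℂ)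

/-- The coordinates of a vector of translates in a basis of eigenvectors. -/
noncomputable def psi (k : ℤ) (f : ℍ → ℂ) (j : SL(2, ℤ) ⧸ Γ) : ℍ → ℂ :=
  ∑ x, b j x • vec k f x

open Classical in
lemma sum_repr_mul (x y : SL(2, ℤ) ⧸ Γ) :
    ∑ j, b.repr (Pi.single x 1) j * b j y = if x = y then 1 else 0 := by
  have := congrFun (b.sum_repr (Pi.single x 1)) y
  rw [Finset.sum_apply] at this
  simpa [Pi.single_apply, eq_comm] using this

open Classical in
lemma vec_eq_sum_psi (x : SL(2, ℤ) ⧸ Γ) :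
    vec k f x = ∑ j, b.repr (Pi.single x 1) j • psi b k f j := by
  simp only [psi, Finset.smul_sum, smul_smul]
  rw [Finset.sum_comm]
  simp only [← Finset.sum_smul, sum_repr_mul]
  simp

lemma psi_add (j : SL(2, ℤ) ⧸ Γ) : psi b k (f + g) j = psi b k f j + psi b k g j := by
  simp only [psi, vec_add, smul_add, Finset.sum_add_distrib]

lemma psi_smul (c : ℂ) (j : SL(2, ℤ) ⧸ Γ) : psi b k (c • f) j = c • psi b k f j := by
  simp only [psi, vec_smul, Finset.smul_sum]
  exact Finset.sum_congr rfl fun x _ ↦ smul_comm _ _ _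

lemma psi_mul {r : ℍ → ℂ} (hr : r ∈ modSub ⊤ k) (j : SL(2, ℤ) ⧸ Γ) :
    psi b (k + l) (r * f) j = r * psi b l f j := by
  simp only [psi, vec_mul hr, Finset.mul_sum, mul_smul_comm]

lemma psi_mdiff (hf : f ∈ modSub Γ k) (j : SL(2, ℤ) ⧸ Γ) : MDiff (psi b k f j) := by
  rw [psi]
  refine Finset.sum_induction _ (fun h : ℍ → ℂ ↦ MDiff h) (fun _ _ h₁ h₂ ↦ h₁.add h₂)
    mdifferentiable_const fun x _ ↦ (vec_mdiff hf.1 x).const_smul _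

lemma psi_bdd (hf : f ∈ modSub Γ k) (j : SL(2, ℤ) ⧸ Γ) : IsBoundedAtImInfty (psi b k f j) := by
  rw [psi]
  refine Finset.sum_induction _ (fun h : ℍ → ℂ ↦ IsBoundedAtImInfty h) (fun _ _ h₁ h₂ ↦ h₁.add h₂)
    (zero_form_isBoundedAtImInfty) fun x _ ↦ (vec_bdd hf x).const_smul_left _

variable {b μ}

lemma psi_vadd (hb : ∀ j x, b j (ModularGroup.T • x) = μ j * b j x) (hf : f ∈ modSub Γ k)
    (j : SL(2, ℤ) ⧸ Γ) (τ : ℍ) : psi b k f j ((1 : ℝ) +ᵥ τ) = μ j * psi b k f j τ := by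
  have h (x : SL(2, ℤ) ⧸ Γ) : vec k f x ((1 : ℝ) +ᵥ τ) = vec k f (ModularGroup.T⁻¹ • x) τ := by
    rw [← slash_T (vec k f x) k, vec_slash hf.2.1]
  simp only [psi, Finset.sum_apply, Pi.smul_apply, h, smul_eq_mul, Finset.mul_sum]
  rw [← Equiv.sum_comp (MulAction.toPerm (ModularGroup.T : SL(2, ℤ)))]
  refine Finset.sum_congr rfl fun x _ ↦ ?_
  rw [MulAction.toPerm_apply, hb, inv_smul_smul, mul_assoc]

lemma psi_decay (hb : ∀ j x, b j (ModularGroup.T • x) = μ j * b j x) (hμ : ∀ j, ‖μ j‖ = 1)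
    (hf : f ∈ modSub Γ k) (j : SL(2, ℤ) ⧸ Γ) :
    ∃ L, (fun τ ↦ (twist (μ j) * psi b k f j) τ - L) =O[atImInfty] discriminant :=
  eigen_decay (psi_mdiff b hf j) (psi_bdd b hf j) (hμ j) (psi_vadd hb hf j)

variable (b μ) in
/-- The leading terms of `f` at the cusps. -/
noncomputable def cuspVal (k : ℤ) (f : ℍ → ℂ) (j : SL(2, ℤ) ⧸ Γ) : ℂ :=
  limUnder atImInfty (twist (μ j) * psi b k f j)

lemma cuspVal_spec (hb : ∀ j x, b j (ModularGroup.T • x) = μ j * b j x) (hμ : ∀ j, ‖μ j‖ = 1)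
    (hf : f ∈ modSub Γ k) (j : SL(2, ℤ) ⧸ Γ) :
    (fun τ ↦ (twist (μ j) * psi b k f j) τ - cuspVal b μ k f j) =O[atImInfty] discriminant := by
  obtain ⟨L, hL⟩ := psi_decay hb hμ hf j
  have := (tendsto_of_isBigO_sub hL).limUnder_eq
  rw [cuspVal]
  rwa [← this] at hL

lemma cuspVal_tendsto (hb : ∀ j x, b j (ModularGroup.T • x) = μ j * b j x)
    (hμ : ∀ j, ‖μ j‖ = 1) (hf : f ∈ modSub Γ k) (j : SL(2, ℤ) ⧸ Γ) :
    Tendsto (twist (μ j) * psi b k f j) atImInfty (𝓝 (cuspVal b μ k f j)) :=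
  tendsto_of_isBigO_sub (cuspVal_spec hb hμ hf j)

lemma cuspVal_add (hb : ∀ j x, b j (ModularGroup.T • x) = μ j * b j x) (hμ : ∀ j, ‖μ j‖ = 1)
    (hf : f ∈ modSub Γ k) (hg : g ∈ modSub Γ k) :
    cuspVal b μ k (f + g) = cuspVal b μ k f + cuspVal b μ k g := by
  ext j
  refine Eq.trans ?_ ((cuspVal_tendsto hb hμ hf j).add (cuspVal_tendsto hb hμ hg j)).limUnder_eq
  rw [cuspVal, psi_add]
  congr 1
  rw [mul_add]; rfl

lemma cuspVal_smul (hb : ∀ j x, b j (ModularGroup.T • x) = μ j * b j x) (hμ : ∀ j, ‖μ j‖ = 1)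
    (c : ℂ) (hf : f ∈ modSub Γ k) :
    cuspVal b μ k (c • f) = c • cuspVal b μ k f := by
  ext j
  refine Eq.trans ?_ ((cuspVal_tendsto hb hμ hf j).const_smul c).limUnder_eq
  rw [cuspVal, psi_smul, mul_smul_comm]; rfl

lemma cuspVal_mul (hb : ∀ j x, b j (ModularGroup.T • x) = μ j * b j x) (hμ : ∀ j, ‖μ j‖ = 1)
    {r : ℍ → ℂ} (hr : r ∈ modSub ⊤ k) {c : ℂ} (hc : Tendsto r atImInfty (𝓝 c))
    (hf : f ∈ modSub Γ l) :
    cuspVal b μ (k + l) (r * f) = c • cuspVal b μ l f := by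
  ext j
  refine Eq.trans ?_ (hc.mul (cuspVal_tendsto hb hμ hf j)).limUnder_eq
  rw [cuspVal, psi_mul _ hr, mul_left_comm]; rfl

lemma div_disc_of_cuspVal (hb : ∀ j x, b j (ModularGroup.T • x) = μ j * b j x)
    (hμ : ∀ j, ‖μ j‖ = 1) (hf : f ∈ modSub Γ k) (h0 : cuspVal b μ k f = 0) :
    f / discriminant ∈ modSub Γ (k - 12) := by
  classical
  refine div_disc hf fun γ ↦ ?_
  have h1 (j : SL(2, ℤ) ⧸ Γ) : psi b k f j =O[atImInfty] discriminant := by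
    have h := cuspVal_spec hb hμ hf j
    rw [h0] at h
    refine Asymptotics.IsBigO.trans ?_ h
    refine Asymptotics.isBigO_of_le _ fun τ ↦ ?_
    rw [Pi.zero_apply, sub_zero, Pi.mul_apply, norm_mul, norm_twist]
    refine le_mul_of_one_le_left (norm_nonneg _) (Real.one_le_exp ?_)
    have := fracExp_nonneg (μ j)
    have := τ.im_pos
    have := Real.pi_pos
    positivity
  have h2 : f ∣[k] γ = vec k f ((γ⁻¹ : SL(2, ℤ)) : SL(2, ℤ) ⧸ Γ) := by
    rw [vec_mk hf.2.1, inv_inv]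
  rw [h2, vec_eq_sum_psi b]
  have := Asymptotics.IsBigO.sum (s := Finset.univ) fun j (_ : j ∈ Finset.univ) ↦
    (h1 j).const_smul_left (b.repr (Pi.single ((γ⁻¹ : SL(2, ℤ)) : SL(2, ℤ) ⧸ Γ) 1) j)
  exact this.congr_left fun τ ↦ by simp

lemma mem_cuspSub_iff (hb : ∀ j x, b j (ModularGroup.T • x) = μ j * b j x)
    (hμ : ∀ j, ‖μ j‖ = 1) (hf : f ∈ modSub Γ k) :
    f ∈ cuspSub Γ k ↔ ∀ j, μ j = 1 → cuspVal b μ k f j = 0 := by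
  classical
  constructor
  · intro h j hj
    have h1 : IsZeroAtImInfty (psi b k f j) := by
      rw [psi]
      exact isZero_sum_smul _ fun x ↦ h.2.2 _
    have h2 := cuspVal_tendsto hb hμ hf j
    rw [hj, twist_one, one_mul] at h2
    exact tendsto_nhds_unique h2 h1
  · intro h
    refine ⟨hf.1, hf.2.1, fun γ ↦ ?_⟩
    have h1 (j : SL(2, ℤ) ⧸ Γ) : IsZeroAtImInfty (psi b k f j) := by
      have h2 := cuspVal_tendsto hb hμ hf j
      by_cases hj : μ j = 1
      · rw [h j hj, hj, twist_one, one_mul] at h2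
        exact h2
      · have h0 : 0 < fracExp (μ j) := by
          refine lt_of_le_of_ne (fracExp_nonneg _) fun h3 ↦ hj ?_
          rw [← exp_fracExp (hμ j), ← h3]; simp
        have h3 : psi b k f j =O[atImInfty]
            fun τ : ℍ ↦ Real.exp (-(2 * Real.pi * fracExp (μ j) * τ.im)) := by
          obtain ⟨C, hC⟩ := (h2.isBigO_one ℝ).bound
          refine Asymptotics.IsBigO.of_bound C ?_
          filter_upwards [hC] with τ hτ
          rw [Pi.mul_apply, norm_mul, norm_twist, norm_one, mul_one] at hτ
          rw [Real.norm_eq_abs, Real.abs_exp, Real.exp_neg, ← div_eq_mul_inv,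
            le_div_iff₀ (Real.exp_pos _), mul_comm]
          exact hτ
        refine h3.trans_tendsto (tendsto_exp_neg ?_)
        have := Real.pi_pos
        positivity
    have h2 : f ∣[k] γ = vec k f ((γ⁻¹ : SL(2, ℤ)) : SL(2, ℤ) ⧸ Γ) := by
      rw [vec_mk hf.2.1, inv_inv]
    rw [h2, vec_eq_sum_psi b]
    exact isZero_sum_smul _ h1

end Cusp

section Frame

variable [Fintype (SL(2, ℤ) ⧸ Γ)]
  {b : Module.Basis (SL(2, ℤ) ⧸ Γ) ℂ (SL(2, ℤ) ⧸ Γ → ℂ)} {μ : SL(2, ℤ) ⧸ Γ → ℂ}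

lemma cuspVal_sum (hb : ∀ j x, b j (ModularGroup.T • x) = μ j * b j x) (hμ : ∀ j, ‖μ j‖ = 1)
    {ι : Type*} (s : Finset ι) {F : ι → ℍ → ℂ} (hF : ∀ i ∈ s, F i ∈ modSub Γ k) :
    cuspVal b μ k (∑ i ∈ s, F i) = ∑ i ∈ s, cuspVal b μ k (F i) := by
  classical
  induction s using Finset.induction_on with
  | empty =>
    have := cuspVal_smul (k := k) hb hμ 0 (zero_mem (modSub Γ k))
    simpa using this
  | insert i s hi ih =>
    have h := fun j hj ↦ hF j (Finset.mem_insert_of_mem hj)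
    rw [Finset.sum_insert hi, Finset.sum_insert hi, ← ih h,
      cuspVal_add hb hμ (hF i (Finset.mem_insert_self _ _)) (sum_mem h)]

/-- Leading terms of a basis of modular forms are linearly independent. -/
lemma linearIndependent_cuspVal (hneg : (-1 : SL(2, ℤ)) ∈ Γ)
    (hb : ∀ j x, b j (ModularGroup.T • x) = μ j * b j x) (hμ : ∀ j, ‖μ j‖ = 1)
    {I : Type*} {κ : I → ℤ} {φ : I → ℍ → ℂ} (hφ : ∀ i, φ i ∈ modSub Γ (κ i))
    (hgen : ∀ k, ∀ v ∈ modSub Γ k, ∃ (S : Finset I) (r : I → ℍ → ℂ),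
      (∀ i, r i ∈ modSub ⊤ (k - κ i)) ∧ v = ∑ i ∈ S, r i * φ i)
    (hind : ∀ (k : ℤ) (S : Finset I) (r : I → ℍ → ℂ), (∀ i, r i ∈ modSub ⊤ (k - κ i)) →
      ∑ i ∈ S, r i * φ i = 0 → ∀ i ∈ S, r i = 0) :
    (∀ i, Even (κ i)) ∧ LinearIndependent ℂ fun i ↦ cuspVal b μ (κ i) (φ i) := by
  classical
  have hev (i : I) : Even (κ i) := by
    by_contra h
    have h0 := modSub_odd hneg (Int.not_even_iff_odd.1 h) (hφ i)
    have := hind (κ i) {i} (fun j ↦ if j = i then 1 else 0) (fun j ↦ by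
      split_ifs with hj
      · rw [hj, sub_self]; exact one_mem
      · exact zero_mem _) (by simp [h0]) i (by simp)
    simp at this
  refine ⟨hev, linearIndependent_iff'.2 fun S c hc i₀ hi₀ ↦ ?_⟩
  set K : ℤ := 4 + 2 * ∑ i ∈ S, |κ i| with hK
  have hKi (i) (hi : i ∈ S) : 4 ≤ K - κ i := by
    have h1 := Finset.single_le_sum (f := fun i ↦ |κ i|) (fun i _ ↦ abs_nonneg _) hi
    have h2 := le_abs_self (κ i)
    have h3 := abs_nonneg (κ i)
    omega
  have hKe : Even K := ⟨2 + ∑ i ∈ S, |κ i|, by omega⟩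
  have he (i : I) : ∃ e ∈ modSub ⊤ (K - κ i), i ∈ S → Tendsto e atImInfty (𝓝 1) := by
    by_cases hi : i ∈ S
    · obtain ⟨e, h1, h2, -⟩ := exists_eis (hKi i hi) (hKe.sub (hev i))
      exact ⟨e, h1, fun _ ↦ h2⟩
    · exact ⟨0, zero_mem _, fun h ↦ absurd h hi⟩
  choose e he1 he2 using he
  have hmem (i : I) : e i * φ i ∈ modSub Γ K := by
    have := mul_mem_modSub (modSub_mono le_top (he1 i)) (hφ i)
    rwa [sub_add_cancel] at this
  have hval (i) (hi : i ∈ S) : cuspVal b μ K (e i * φ i) = cuspVal b μ (κ i) (φ i) := by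
    have := cuspVal_mul hb hμ (he1 i) (he2 i hi) (hφ i)
    rwa [sub_add_cancel, one_smul] at this
  set F := ∑ i ∈ S, c i • (e i * φ i) with hF
  have hFm : F ∈ modSub Γ K := sum_mem fun i _ ↦ Submodule.smul_mem _ _ (hmem i)
  have hF0 : cuspVal b μ K F = 0 := by
    rw [hF, cuspVal_sum hb hμ _ fun i _ ↦ Submodule.smul_mem _ _ (hmem i), ← hc]
    exact Finset.sum_congr rfl fun i hi ↦ by rw [cuspVal_smul hb hμ _ (hmem i), hval i hi]
  obtain ⟨S', r, hr, hFr⟩ := hgen _ _ (div_disc_of_cuspVal hb hμ hFm hF0)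
  have hF' : F = ∑ i ∈ S', discriminant * r i * φ i := by
    rw [← mul_div_disc (f := F), hFr, Finset.mul_sum]
    simp only [mul_assoc]
  have h1 : ∑ i ∈ S ∪ S', ((if i ∈ S then c i • e i else 0)
      - if i ∈ S' then discriminant * r i else 0) * φ i = 0 := by
    simp only [sub_mul, Finset.sum_sub_distrib, ite_mul, zero_mul, Finset.sum_ite_mem]
    rw [Finset.union_inter_cancel_left, Finset.union_inter_cancel_right, ← hF', hF, sub_eq_zero]
    exact Finset.sum_congr rfl fun i _ ↦ smul_mul_assoc _ _ _
  have h2 := hind K _ _ (fun i ↦ by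
    refine Submodule.sub_mem _ ?_ ?_
    · split_ifs
      · exact Submodule.smul_mem _ _ (he1 i)
      · exact zero_mem _
    · split_ifs
      · have := mul_mem_modSub (cuspSub_le_modSub disc_mem) (hr i)
        convert this using 2
        ring
      · exact zero_mem _) h1 i₀ (Finset.mem_union_left _ hi₀)
  rw [if_pos hi₀, sub_eq_zero] at h2
  have h3 : Tendsto (c i₀ • e i₀) atImInfty (𝓝 (c i₀)) := by
    have := (he2 i₀ hi₀).const_smul (c i₀)
    rwa [smul_eq_mul, mul_one] at this
  have h4 : Tendsto (c i₀ • e i₀) atImInfty (𝓝 0) := by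
    rw [h2]
    split_ifs with h
    · have hd : IsZeroAtImInfty discriminant := by simpa using disc_mem.2.2 1
      have hb' : IsBoundedAtImInfty (r i₀) := by simpa using (hr i₀).2.2 1
      exact isZero_mul_isBounded hd hb'
    · exact tendsto_const_nhds
  exact tendsto_nhds_unique h3 h4

/-- A basis of modular forms over the ring of level one forms, indexed by the cosets. -/
lemma exists_frame [Γ.FiniteIndex] (hneg : (-1 : SL(2, ℤ)) ∈ Γ)
    (hb : ∀ j x, b j (ModularGroup.T • x) = μ j * b j x) (hμ : ∀ j, ‖μ j‖ = 1) :
    ∃ (κ : SL(2, ℤ) ⧸ Γ → ℤ) (φ : SL(2, ℤ) ⧸ Γ → ℍ → ℂ), (∀ i, φ i ∈ modSub Γ (κ i)) ∧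
      (∀ i, Even (κ i)) ∧
      (∀ k, ∀ v ∈ modSub Γ k, ∃ r : SL(2, ℤ) ⧸ Γ → ℍ → ℂ, (∀ i, r i ∈ modSub ⊤ (k - κ i)) ∧
        v = ∑ i, r i * φ i) ∧
      (∀ (k : ℤ) (r : SL(2, ℤ) ⧸ Γ → ℍ → ℂ), (∀ i, r i ∈ modSub ⊤ (k - κ i)) →
        ∑ i, r i * φ i = 0 → ∀ i, r i = 0) ∧
      (∀ w, LinearIndependent ℂ fun i x ↦ vec (Γ := Γ) (κ i) (φ i) x w) ∧
      LinearIndependent ℂ fun i ↦ cuspVal b μ (κ i) (φ i) := by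
  classical
  obtain ⟨I, κ, φ, hφ, hgen, hind⟩ := exists_basis Γ
  obtain ⟨hev, hli⟩ := linearIndependent_cuspVal hneg hb hμ hφ hgen hind
  have := hli.finite
  have := Fintype.ofFinite I
  have hspan (w : ℍ) : ⊤ ≤ Submodule.span ℂ
      (Set.range fun i x ↦ vec (Γ := Γ) (κ i) (φ i) x w) := by
    rw [← span_vec hneg w, Submodule.span_le]
    rintro _ ⟨k, f, hf, rfl⟩
    obtain ⟨S, r, hr, rfl⟩ := hgen k f hf
    have : (fun x ↦ vec (Γ := Γ) k (∑ i ∈ S, r i * φ i) x w) =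
        ∑ i ∈ S, r i w • fun x ↦ vec (Γ := Γ) (κ i) (φ i) x w := by
      ext x
      rw [vec_sum, Finset.sum_apply, Finset.sum_apply]
      refine Finset.sum_congr rfl fun i _ ↦ ?_
      have := vec_mul (l := κ i) (f := φ i) (hr i) x
      rw [sub_add_cancel] at this
      rw [this]; rfl
    rw [SetLike.mem_coe, this]
    exact sum_mem fun i _ ↦ Submodule.smul_mem _ _ (Submodule.subset_span ⟨i, rfl⟩)
  have hle := hli.fintype_card_le_finrank
  rw [Module.finrank_pi] at hle
  have hge := finrank_range_le_card (R := ℂ)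
    fun (i : I) (x : SL(2, ℤ) ⧸ Γ) ↦ vec (Γ := Γ) (κ i) (φ i) x UpperHalfPlane.I
  have hcard : Fintype.card I = Fintype.card (SL(2, ℤ) ⧸ Γ) := by
    refine le_antisymm hle ?_
    rwa [Set.finrank, top_le_iff.1 (hspan _), finrank_top, Module.finrank_pi] at hge
  have hli' (w : ℍ) := linearIndependent_of_top_le_span_of_card_eq_finrank (hspan w)
    (by rw [hcard, Module.finrank_pi])
  obtain ⟨e⟩ := Fintype.card_eq.1 hcard.symm
  refine ⟨κ ∘ e, φ ∘ e, fun i ↦ hφ _, fun i ↦ hev _, fun k v hv ↦ ?_, fun k r hr h i ↦ ?_,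
    fun w ↦ (hli' w).comp e e.injective, hli.comp e e.injective⟩
  · obtain ⟨S, r, hr, rfl⟩ := hgen k v hv
    refine ⟨fun i ↦ if e i ∈ S then r (e i) else 0, fun i ↦ ?_, ?_⟩
    · dsimp only
      split_ifs
      · exact hr _
      · exact zero_mem _
    · rw [← e.symm.sum_comp]
      simp
  · have := hind k Finset.univ (r ∘ e.symm) (fun i ↦ by simpa using hr (e.symm i))
      (by rw [← e.sum_comp]; simpa using h) (e i) (Finset.mem_univ _)
    simpa using this

end Frame

instance (k : ℤ) : Module.Finite ℂ (modSub ⊤ k) := by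
  rcases lt_or_ge k 0 with hk | hk
  · have : modSub ⊤ k = ⊥ := (Submodule.eq_bot_iff _).2 fun f hf ↦ modSub_neg_weight hk hf
    rw [this]; infer_instance
  · lift k to ℕ using hk
    exact Module.Finite.equiv (modEquiv (𝒢 := 𝒮ℒ) SL_eq_map_top)

/-- The dimension of the space of modular forms of level one. -/
noncomputable def levelOneDim (k : ℤ) : ℕ := Module.finrank ℂ (modSub ⊤ k)

lemma levelOneDim_neg (hk : k < 0) : levelOneDim k = 0 := by
  have : modSub ⊤ k = ⊥ := (Submodule.eq_bot_iff _).2 fun f hf ↦ modSub_neg_weight hk hf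
  rw [levelOneDim, this, finrank_bot]

lemma levelOneDim_even (k : ℕ) (hk : Even k) :
    levelOneDim k = if k % 12 = 2 then k / 12 else k / 12 + 1 := by
  rw [levelOneDim, ← (modEquiv (𝒢 := 𝒮ℒ) SL_eq_map_top).finrank_eq, Module.finrank,
    ModularForm.dimension_level_one k hk]
  have : k ≡ 2 [MOD 12] ↔ k % 12 = 2 := Iff.rfl
  simp only [this]
  split_ifs <;> simp

section Frame

variable {X : Type*} [Fintype X] {κ : X → ℤ} {φ : X → ℍ → ℂ}

lemma finrank_modSub (hφ : ∀ i, φ i ∈ modSub Γ (κ i))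
    (hgen : ∀ v ∈ modSub Γ k, ∃ r : X → ℍ → ℂ, (∀ i, r i ∈ modSub ⊤ (k - κ i)) ∧
        v = ∑ i, r i * φ i)
    (hind : ∀ r : X → ℍ → ℂ, (∀ i, r i ∈ modSub ⊤ (k - κ i)) →
        ∑ i, r i * φ i = 0 → ∀ i, r i = 0) :
    Module.Finite ℂ (modSub Γ k) ∧
      Module.finrank ℂ (modSub Γ k) = ∑ i, levelOneDim (k - κ i) := by
  let L : (Π i, modSub ⊤ (k - κ i)) →ₗ[ℂ] modSub Γ k :=
    { toFun r := ⟨∑ i, (r i : ℍ → ℂ) * φ i, sum_mem fun i _ ↦ by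
        simpa using mul_mem_modSub (modSub_mono le_top (r i).2) (hφ i)⟩
      map_add' r s := by
        ext1
        simp [add_mul, Finset.sum_add_distrib]
      map_smul' c r := by
        ext1
        simp [Finset.smul_sum] }
  have hL : Function.Bijective L := by
    refine ⟨(injective_iff_map_eq_zero L).2 fun r hr ↦ ?_, fun v ↦ ?_⟩
    · have := hind (fun i ↦ r i) (fun i ↦ (r i).2) (congrArg Subtype.val hr)
      ext i : 2
      exact this i
    · obtain ⟨r, hr, h⟩ := hgen v v.2
      exact ⟨fun i ↦ ⟨r i, hr i⟩, Subtype.ext h.symm⟩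
  let e := LinearEquiv.ofBijective L hL
  refine ⟨Module.Finite.equiv e, ?_⟩
  rw [← e.finrank_eq, Module.finrank_pi_fintype]
  rfl

end Frame

section Pairing

variable [Fintype (SL(2, ℤ) ⧸ Γ)]

variable (Γ) in
/-- The pairing of two forms of level `Γ` into forms of level one. -/
noncomputable def pairing (k l : ℤ) (f g : ℍ → ℂ) : ℍ → ℂ :=
  ∑ x : SL(2, ℤ) ⧸ Γ, vec k f x * vec l g x

lemma pairing_mem (hf : f ∈ cuspSub Γ k) (hg : g ∈ modSub Γ l) :
    pairing Γ k l f g ∈ cuspSub ⊤ (k + l) := by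
  have hinv (γ : SL(2, ℤ)) : pairing Γ k l f g ∣[k + l] γ = pairing Γ k l f g := by
    rw [pairing, SlashAction.sum_slash, ← Equiv.sum_comp (MulAction.toPerm γ)]
    refine Finset.sum_congr rfl fun x _ ↦ ?_
    rw [mul_slash_SL2, MulAction.toPerm_apply, vec_slash hf.2.1, vec_slash hg.2.1, inv_smul_smul]
  refine ⟨?_, fun γ _ ↦ hinv γ, fun γ ↦ ?_⟩
  · refine Finset.sum_induction _ (fun h : ℍ → ℂ ↦ MDiff h) (fun _ _ h₁ h₂ ↦ h₁.add h₂)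
      mdifferentiable_const fun x _ ↦ (vec_mdiff hf.1 x).mul (vec_mdiff hg.1 x)
  · rw [hinv, pairing]
    simpa using isZero_sum_smul (fun _ ↦ 1) fun x : SL(2, ℤ) ⧸ Γ ↦
      isZero_mul_isBounded (show IsZeroAtImInfty (vec k f x) from hf.2.2 _) (vec_bdd hg x)

lemma pairing_div_mem (hf : f ∈ cuspSub Γ k) (hg : g ∈ modSub Γ l) :
    pairing Γ k l f g / discriminant ∈ modSub ⊤ (k + l - 12) :=
  top_div_disc (cuspSub_le_modSub (pairing_mem hf hg))
    (by
      have h := (pairing_mem hf hg).2.2 1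
      rwa [SlashAction.slash_one] at h)

lemma finrank_cuspSub {X : Type*} [Fintype X] {κ : X → ℤ} {φ : X → ℍ → ℂ}
    (hφ : ∀ i, φ i ∈ modSub Γ (κ i))
    (hinj : ∀ w (v : SL(2, ℤ) ⧸ Γ → ℂ), (∀ i, ∑ x, v x * vec (κ i) (φ i) x w = 0) → v = 0)
    (hsurj : ∀ r : X → ℍ → ℂ, (∀ i, r i ∈ modSub ⊤ (k + κ i - 12)) →
      ∃ s ∈ cuspSub Γ k, ∀ i, pairing Γ k (κ i) s (φ i) = discriminant * r i) :
    Module.finrank ℂ (cuspSub Γ k) = ∑ i, levelOneDim (k + κ i - 12) := by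
  let L : cuspSub Γ k →ₗ[ℂ] (Π i, modSub ⊤ (k + κ i - 12)) :=
    { toFun s i := ⟨pairing Γ k (κ i) s (φ i) / discriminant, pairing_div_mem s.2 (hφ i)⟩
      map_add' r s := by
        ext i : 2
        simp only [pairing, Submodule.coe_add, vec_add, add_mul, Finset.sum_add_distrib,
          Pi.add_apply]
        ext w
        exact add_div _ _ _
      map_smul' c r := by
        ext i : 2
        simp only [pairing, Submodule.coe_smul, vec_smul, smul_mul_assoc, ← Finset.smul_sum,
          smul_div_assoc]
        rfl }
  have hL : Function.Bijective L := by
    refine ⟨(injective_iff_map_eq_zero L).2 fun s hs ↦ ?_, fun r ↦ ?_⟩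
    · have h1 (i : X) : pairing Γ k (κ i) s (φ i) = 0 := by
        have : pairing Γ k (κ i) s (φ i) / discriminant = 0 :=
          congrArg Subtype.val (congrFun hs i)
        rw [← mul_div_disc (f := pairing Γ k (κ i) s (φ i)), this, mul_zero]
      have h2 (w : ℍ) := hinj w (fun x ↦ vec k s x w) fun i ↦ by
        simpa [pairing] using congrFun (h1 i) w
      ext w
      rw [← vec_one s.2.2.1]
      exact congrFun (h2 w) _
    · obtain ⟨s, hs, h⟩ := hsurj (fun i ↦ r i) fun i ↦ (r i).2
      refine ⟨⟨s, hs⟩, ?_⟩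
      ext i w
      change (pairing Γ k (κ i) s (φ i) / discriminant) w = _
      rw [h, Pi.div_apply, Pi.mul_apply, mul_div_cancel_left₀ _ (discriminant_ne_zero w)]
  rw [(LinearEquiv.ofBijective L hL).finrank_eq, Module.finrank_pi_fintype]
  rfl

end Pairing

/-- Solutions of linear systems with convergent invertible coefficients are bounded. -/
lemma isBigO_solution {α n : Type*} [Fintype n] [DecidableEq n] {F : Filter α}
    {C : α → Matrix n n ℂ} {Φ : Matrix n n ℂ} (hC : Tendsto C F (𝓝 Φ)) (hΦ : Φ.det ≠ 0)
    {W r : α → n → ℂ} {q : α → ℂ} (hr : ∀ i, (fun a ↦ r a i) =O[F] (1 : α → ℝ))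
    (h : ∀ a, C a *ᵥ W a = q a • r a) (j : n) : (fun a ↦ W a j) =O[F] q := by
  have hdet : Tendsto (fun a ↦ (C a).det) F (𝓝 Φ.det) :=
    (continuous_id.matrix_det.tendsto Φ).comp hC
  have hadj : Tendsto (fun a ↦ (C a).adjugate) F (𝓝 Φ.adjugate) :=
    (continuous_id.matrix_adjugate.tendsto Φ).comp hC
  have h1 (i : n) : (fun a ↦ ((C a).det)⁻¹ * (C a).adjugate j i) =O[F] (1 : α → ℝ) := by
    have := (hdet.inv₀ hΦ).mul (tendsto_pi_nhds.1 (tendsto_pi_nhds.1 hadj j) i)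
    exact this.isBigO_one ℝ
  have h2 : (fun a ↦ ∑ i, ((C a).det)⁻¹ * (C a).adjugate j i * r a i) =O[F] (1 : α → ℝ) := by
    have := Asymptotics.IsBigO.sum (s := Finset.univ) fun i (_ : i ∈ Finset.univ) ↦
      (h1 i).mul (hr i)
    exact this.congr (fun _ ↦ by simp) (fun _ ↦ by simp)
  have h3 : (fun a ↦ q a * ∑ i, ((C a).det)⁻¹ * (C a).adjugate j i * r a i) =O[F] q := by
    have := (Asymptotics.isBigO_refl q F).mul (h2.trans (Asymptotics.isBigO_of_le _
      (g := fun _ ↦ (1 : ℂ)) fun _ ↦ by simp))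
    exact this.congr_right fun _ ↦ mul_one _
  refine h3.congr' ?_ EventuallyEq.rfl
  filter_upwards [hdet.eventually_ne hΦ] with a ha
  have h4 := congrArg (fun v ↦ ((C a).det)⁻¹ • ((C a).adjugate *ᵥ v)) (h a)
  simp only [mulVec_mulVec, adjugate_mul, mulVec_smul, smul_mulVec, one_mulVec] at h4
  rw [smul_smul, inv_mul_cancel₀ ha, one_smul] at h4
  rw [h4]
  simp only [Pi.smul_apply, smul_eq_mul, mulVec, dotProduct, Finset.mul_sum]
  exact Finset.sum_congr rfl fun i _ ↦ by ring

lemma disc_mul_twist_isZero {μ : ℂ} {h : ℍ → ℂ} (hh : h =O[atImInfty] discriminant) :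
    IsZeroAtImInfty (twist μ * h) := by
  have h1 : (twist μ * h) =O[atImInfty]
      fun τ : ℍ ↦ Real.exp (-(2 * Real.pi * (1 - fracExp μ) * τ.im)) := by
    have h2 : twist μ =O[atImInfty] fun τ : ℍ ↦ Real.exp (2 * Real.pi * fracExp μ * τ.im) :=
      Asymptotics.isBigO_of_le _ fun τ ↦ by
        rw [norm_twist, Real.norm_eq_abs, Real.abs_exp]
    refine (h2.mul (hh.trans disc_isBigO_exp)).congr_right fun τ ↦ ?_
    rw [← Real.exp_add]
    congr 1
    ring
  refine h1.trans_tendsto (tendsto_exp_neg ?_)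
  have := Real.pi_pos
  have : 0 < 1 - fracExp μ := by linarith [fracExp_lt_one μ]
  positivity

lemma mdiff_det {n : Type*} [Fintype n] [DecidableEq n] {M : n → n → ℍ → ℂ}
    (h : ∀ i j, MDiff (M i j)) : MDiff fun w ↦ (Matrix.of fun i j ↦ M i j w).det := by
  have h1 : (fun w ↦ (Matrix.of fun i j ↦ M i j w).det) =
      ∑ σ : Equiv.Perm n, ((σ.sign : ℤ) : ℂ) • ∏ i, M (σ i) i := by
    ext w
    simp [det_apply']
  rw [h1]
  refine Finset.sum_induction _ (fun h : ℍ → ℂ ↦ MDiff h) (fun _ _ h₁ h₂ ↦ h₁.add h₂)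
    mdifferentiable_const fun σ _ ↦ MDifferentiable.const_smul _ ?_
  exact Finset.prod_induction _ (fun h : ℍ → ℂ ↦ MDiff h) (fun _ _ h₁ h₂ ↦ h₁.mul h₂)
    mdifferentiable_const fun i _ ↦ h _ _

section Dual

variable [Fintype (SL(2, ℤ) ⧸ Γ)]
  {b : Module.Basis (SL(2, ℤ) ⧸ Γ) ℂ (SL(2, ℤ) ⧸ Γ → ℂ)} {μ : SL(2, ℤ) ⧸ Γ → ℂ}

lemma exists_dual (hb : ∀ j x, b j (ModularGroup.T • x) = μ j * b j x) (hμ : ∀ j, ‖μ j‖ = 1)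
    {κ : SL(2, ℤ) ⧸ Γ → ℤ} {φ : SL(2, ℤ) ⧸ Γ → ℍ → ℂ} (hφ : ∀ i, φ i ∈ modSub Γ (κ i))
    (hli : ∀ w, LinearIndependent ℂ fun i x ↦ vec (Γ := Γ) (κ i) (φ i) x w)
    (hcv : LinearIndependent ℂ fun i ↦ cuspVal b μ (κ i) (φ i))
    {r : SL(2, ℤ) ⧸ Γ → ℍ → ℂ} (hr : ∀ i, r i ∈ modSub ⊤ (k + κ i - 12)) :
    ∃ s ∈ cuspSub Γ k, ∀ i, pairing Γ k (κ i) s (φ i) = discriminant * r i := by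
  classical
  set A : ℍ → Matrix (SL(2, ℤ) ⧸ Γ) (SL(2, ℤ) ⧸ Γ) ℂ :=
    fun w ↦ Matrix.of fun i x ↦ vec (κ i) (φ i) x w with hA
  have hdet (w : ℍ) : (A w).det ≠ 0 := by
    have := (Matrix.linearIndependent_rows_iff_isUnit (A := A w)).1 (hli w)
    exact ((Matrix.isUnit_iff_isUnit_det _).1 this).ne_zero
  set V : SL(2, ℤ) ⧸ Γ → ℍ → ℂ :=
    fun x w ↦ discriminant w * ((A w).cramer (fun i ↦ r i w) x / (A w).det) with hV
  have hAV (i) : ∑ x, V x * vec (κ i) (φ i) x = discriminant * r i := by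
    ext w
    have h := congrFun (Matrix.mulVec_cramer (A w) fun i ↦ r i w) i
    simp only [mulVec, dotProduct, Pi.smul_apply, smul_eq_mul] at h
    simp only [Finset.sum_apply, Pi.mul_apply, hV]
    calc _ = discriminant w * (∑ x, A w i x * (A w).cramer (fun i ↦ r i w) x) / (A w).det := by
          rw [mul_div_assoc, Finset.sum_div, Finset.mul_sum]
          refine Finset.sum_congr rfl fun x _ ↦ ?_
          simp only [hA, of_apply]
          ring
      _ = _ := by rw [h]; field_simp [hdet w]
  have huniq (w : ℍ) (u v : SL(2, ℤ) ⧸ Γ → ℂ)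
      (h : ∀ i, ∑ x, u x * vec (κ i) (φ i) x w = ∑ x, v x * vec (κ i) (φ i) x w) : u = v := by
    refine Matrix.mulVec_injective_of_isUnit
      ((Matrix.isUnit_iff_isUnit_det _).2 (hdet w).isUnit) ?_
    ext i
    simpa [mulVec, dotProduct, hA, mul_comm] using h i
  have hVd (x) : MDiff (V x) := by
    have h1 : MDiff fun w ↦ (A w).det := mdiff_det fun i x ↦ vec_mdiff (hφ i).1 x
    have h2 : MDiff fun w ↦ (A w).cramer (fun i ↦ r i w) x := by
      have := mdiff_det (M := fun i y ↦ if y = x then r i else vec (κ i) (φ i) y) fun i y ↦ by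
        split_ifs
        · exact (hr i).1
        · exact vec_mdiff (hφ i).1 y
      convert this using 2 with w
      rw [cramer_apply]
      congr 1
      ext i y
      rw [updateCol_apply, of_apply]
      split_ifs <;> rfl
    rw [UpperHalfPlane.mdifferentiable_iff] at h1 h2
    refine disc_mem.1.mul ?_
    rw [UpperHalfPlane.mdifferentiable_iff]
    exact h2.div h1 fun z _ ↦ hdet _
  have hVs (x) (γ : SL(2, ℤ)) : (V x) ∣[k] γ = V (γ⁻¹ • x) := by
    ext w
    have := huniq w (fun x ↦ ((V (γ • x)) ∣[k] γ) w) (fun x ↦ V x w) fun i ↦ by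
      have h1 : (discriminant * r i) ∣[k + κ i] γ = discriminant * r i := by
        have := (mul_mem_modSub (cuspSub_le_modSub disc_mem) (hr i)).2.1 γ trivial
        convert this using 2
        ring
      have h2 := congrFun (congrArg (· ∣[k + κ i] γ) (hAV i)) w
      simp only [h1, SlashAction.sum_slash, mul_slash_SL2, vec_slash (hφ i).2.1] at h2
      rw [← hAV, ← Equiv.sum_comp (MulAction.toPerm γ)] at h2
      simpa using h2
    simpa using congrFun this (γ⁻¹ • x)
  have hVz (x) : IsZeroAtImInfty (V x) := by
    set U : SL(2, ℤ) ⧸ Γ → ℍ → ℂ := fun j ↦ ∑ x, b.repr (Pi.single x 1) j • V x with hU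
    have hVU : V x = ∑ j, b j x • U j := by
      simp only [hU, Finset.smul_sum, smul_smul]
      rw [Finset.sum_comm]
      simp only [← Finset.sum_smul, mul_comm (b _ x), sum_repr_mul]
      simp
    have hne (j) (w : ℍ) : twist (μ j) w ≠ 0 := Complex.exp_ne_zero _
    have hΦ : (Matrix.of fun i j ↦ cuspVal b μ (κ i) (φ i) j).det ≠ 0 := by
      have := (Matrix.linearIndependent_rows_iff_isUnit
        (A := Matrix.of fun i j ↦ cuspVal b μ (κ i) (φ i) j)).1 hcv
      exact ((Matrix.isUnit_iff_isUnit_det _).1 this).ne_zero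
    have hC : Tendsto (fun w ↦ Matrix.of fun i j ↦ (twist (μ j) * psi b (κ i) (φ i) j) w)
        atImInfty (𝓝 (Matrix.of fun i j ↦ cuspVal b μ (κ i) (φ i) j)) :=
      tendsto_pi_nhds.2 fun i ↦ tendsto_pi_nhds.2 fun j ↦ cuspVal_tendsto hb hμ (hφ i) j
    have hsys (w : ℍ) : (Matrix.of fun i j ↦ (twist (μ j) * psi b (κ i) (φ i) j) w) *ᵥ
        (fun j ↦ U j w / twist (μ j) w) = discriminant w • fun i ↦ r i w := by
      ext i
      have h := congrFun (hAV i) w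
      simp only [vec_eq_sum_psi b, Finset.sum_apply, Pi.mul_apply, Pi.smul_apply, smul_eq_mul,
        Finset.mul_sum] at h
      simp only [Pi.smul_apply, smul_eq_mul, mulVec, dotProduct, of_apply, Pi.mul_apply, ← h, hU,
        Finset.sum_apply, Finset.sum_div, Finset.mul_sum]
      rw [Finset.sum_comm]
      refine Finset.sum_congr rfl fun x _ ↦ Finset.sum_congr rfl fun j _ ↦ ?_
      field_simp [hne j w]
    have hW := isBigO_solution hC hΦ (fun i ↦ by
      have := (hr i).2.2 1
      rwa [SlashAction.slash_one] at this) hsys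
    rw [hVU]
    refine isZero_sum_smul _ fun j ↦ ?_
    convert disc_mul_twist_isZero (μ := μ j) (hW j) using 1
    ext w
    rw [Pi.mul_apply, mul_div_cancel₀ _ (hne j w)]
  obtain ⟨s, hs, hsV⟩ := equivariant_mem hVs hVd fun x ↦ (hVz x).boundedAtFilter
  refine ⟨s, ⟨hs.1, hs.2.1, fun γ ↦ ?_⟩, fun i ↦ ?_⟩
  · have := hVz ((γ⁻¹ : SL(2, ℤ)) : SL(2, ℤ) ⧸ Γ)
    rwa [← hsV, vec_mk hs.2.1, inv_inv] at this
  · simp only [pairing, hsV, hAV]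

end Dual

/-- The number of points fixed by an element of a group. -/
noncomputable def numFixed (X : Type*) {G : Type*} [Group G] [MulAction G X] (t : G) : ℕ :=
  Nat.card (MulAction.fixedBy X t)

lemma sum_eigenvalues {X : Type*} [Fintype X] {G : Type*} [Group G] [MulAction G X] (t : G)
    {A : X → X → ℂ} (hA : LinearIndependent ℂ A) {c : X → ℂ}
    (h : ∀ i x, A i (t⁻¹ • x) = c i * A i x) : ∑ i, c i = numFixed X t := by
  classical
  set M : Matrix X X ℂ := Matrix.of A
  have hM : IsUnit M.det := (Matrix.isUnit_iff_isUnit_det _).1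
    ((Matrix.linearIndependent_rows_iff_isUnit (A := M)).1 hA)
  set P : Matrix X X ℂ := Matrix.of fun y x ↦ if y = t⁻¹ • x then 1 else 0
  have h1 : M * P = diagonal c * M := by
    ext i x
    rw [diagonal_mul]
    simp [mul_apply, P, M, h]
  have h2 : P = M⁻¹ * (diagonal c * M) := by
    rw [← h1, nonsing_inv_mul_cancel_left _ _ hM]
  have h3 : P.trace = ∑ i, c i := by
    rw [h2, trace_mul_comm, mul_nonsing_inv_cancel_right _ _ hM, trace_diagonal]
  rw [← h3, numFixed, Nat.card_eq_fintype_card, Fintype.card_subtype, Matrix.trace]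
  simp [P, MulAction.mem_fixedBy, eq_inv_smul_iff]

lemma sum_vec_eigenvalues [Fintype (SL(2, ℤ) ⧸ Γ)] {κ : SL(2, ℤ) ⧸ Γ → ℤ}
    {φ : SL(2, ℤ) ⧸ Γ → ℍ → ℂ} (hφ : ∀ i, φ i ∈ modSub Γ (κ i)) {w : ℍ}
    (hli : LinearIndependent ℂ fun i x ↦ vec (Γ := Γ) (κ i) (φ i) x w) {t : SL(2, ℤ)}
    (ht : t • w = w) :
    ∑ i, denom t w ^ (-κ i) = numFixed (SL(2, ℤ) ⧸ Γ) t := by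
  refine sum_eigenvalues t hli fun i x ↦ ?_
  rw [← vec_slash (hφ i).2.1, SL_slash_apply, ht, mul_comm]

/-- The elliptic point of order three. -/
noncomputable def ellThree : ℍ := ⟨⟨1 / 2, √3 / 2⟩, by simp⟩

lemma coe_ellThree : (ellThree : ℂ) = 1 / 2 + √3 / 2 * Complex.I := by
  apply Complex.ext <;> simp [ellThree]

lemma ellThree_sq : (ellThree : ℂ) ^ 2 = -1 / 2 + √3 / 2 * Complex.I := by
  have h : (√3 : ℂ) ^ 2 = 3 := by
    rw [← Complex.ofReal_pow, Real.sq_sqrt (by norm_num)]; norm_num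
  rw [coe_ellThree]
  linear_combination (1 / 4 * Complex.I ^ 2) * h + 3 / 4 * Complex.I_sq

lemma ellThree_sq_eq : (ellThree : ℂ) ^ 2 = ellThree - 1 := by
  rw [ellThree_sq, coe_ellThree]; ring

lemma ellThree_pow_six : (ellThree : ℂ) ^ 6 = 1 := by
  linear_combination ((ellThree : ℂ) ^ 4 + ellThree ^ 3 - ellThree - 1) * ellThree_sq_eq

lemma S_smul_I : ModularGroup.S • UpperHalfPlane.I = UpperHalfPlane.I := by
  ext1
  rw [coe_smul_SL]
  simp [ModularGroup.coe_S]

lemma TS_smul_ellThree : (ModularGroup.T * ModularGroup.S) • ellThree = ellThree := by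
  ext1
  rw [coe_smul_SL]
  have h := ellThree.ne_zero
  have e : (ModularGroup.T * ModularGroup.S).1 = !![1, -1; 1, 0] := by
    simp [ModularGroup.coe_S, ModularGroup.coe_T]
  simp only [e]
  simp
  field_simp
  linear_combination -ellThree_sq_eq

lemma denom_S_I : denom ModularGroup.S UpperHalfPlane.I = Complex.I := by
  rw [denom_SL]
  simp [ModularGroup.coe_S]

lemma denom_TS : denom (ModularGroup.T * ModularGroup.S : SL(2, ℤ)) ellThree = ellThree := by
  rw [denom_SL]
  simp [ModularGroup.coe_S]

lemma sum_weights {X M : Type*} [Fintype X] [AddCommMonoid M] {κ : X → ℤ} (he : ∀ i, Even (κ i))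
    (h0 : ∀ i, 0 ≤ κ i) (h1 : ∀ i, κ i ≤ 10) (F : ℤ → M) :
    ∑ i, F (κ i) = ∑ c ∈ Finset.range 6, Nat.card {i // κ i = 2 * c} • F (2 * c) := by
  classical
  rw [← Finset.sum_fiberwise_of_maps_to (t := Finset.range 6) (g := fun i ↦ (κ i / 2).toNat)
    (fun i _ ↦ by have := h0 i; have := h1 i; simp; omega)]
  refine Finset.sum_congr rfl fun c _ ↦ ?_
  have h (i : X) : (κ i / 2).toNat = c ↔ κ i = 2 * c := by
    obtain ⟨m, hm⟩ := he i
    have := h0 i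
    omega
  simp only [h]
  rw [Nat.card_eq_fintype_card, Fintype.card_subtype, ← Finset.sum_const]
  exact Finset.sum_congr rfl fun i hi ↦ by rw [(Finset.mem_filter.1 hi).2]

section Dims

variable [Fintype (SL(2, ℤ) ⧸ Γ)]
  {b : Module.Basis (SL(2, ℤ) ⧸ Γ) ℂ (SL(2, ℤ) ⧸ Γ → ℂ)} {μ : SL(2, ℤ) ⧸ Γ → ℂ}
  {κ : SL(2, ℤ) ⧸ Γ → ℤ} {φ : SL(2, ℤ) ⧸ Γ → ℍ → ℂ}

/-- In large weights, the leading terms at the regular cusps can be prescribed. -/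
lemma finrank_modSub_eq_add (hb : ∀ j x, b j (ModularGroup.T • x) = μ j * b j x)
    (hμ : ∀ j, ‖μ j‖ = 1) (hφ : ∀ i, φ i ∈ modSub Γ (κ i)) (he : ∀ i, Even (κ i))
    (hcv : LinearIndependent ℂ fun i ↦ cuspVal b μ (κ i) (φ i)) (hk : Even k)
    (hκ : ∀ i, 4 ≤ k - κ i) [Module.Finite ℂ (modSub Γ k)] :
    Module.finrank ℂ (modSub Γ k) = Module.finrank ℂ (cuspSub Γ k) +
      Nat.card {j // μ j = 1} := by
  classical
  let L : modSub Γ k →ₗ[ℂ] ({j // μ j = 1} → ℂ) :=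
    { toFun f j := cuspVal b μ k f j
      map_add' f g := by
        ext j
        simp only [Submodule.coe_add, cuspVal_add hb hμ f.2 g.2, Pi.add_apply]
      map_smul' c f := by
        ext j
        simp only [Submodule.coe_smul, cuspVal_smul hb hμ c f.2, Pi.smul_apply, RingHom.id_apply] }
  have hker : LinearMap.ker L = (cuspSub Γ k).comap (modSub Γ k).subtype := by
    ext f
    rw [LinearMap.mem_ker, Submodule.mem_comap, Submodule.subtype_apply,
      mem_cuspSub_iff hb hμ f.2, funext_iff]
    exact ⟨fun h j hj ↦ h ⟨j, hj⟩, fun h j ↦ h j j.2⟩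
  have hsurj : LinearMap.range L = ⊤ := by
    refine LinearMap.range_eq_top.2 fun v ↦ ?_
    choose e he1 he2 using fun i ↦ exists_eis (hκ i) (hk.sub (he i))
    have hmem (i) : e i * φ i ∈ modSub Γ k := by
      have := mul_mem_modSub (modSub_mono le_top (he1 i)) (hφ i)
      rwa [sub_add_cancel] at this
    have hval (i) : cuspVal b μ k (e i * φ i) = cuspVal b μ (κ i) (φ i) := by
      have := cuspVal_mul hb hμ (he1 i) (he2 i).1 (hφ i)
      rwa [sub_add_cancel, one_smul] at this
    have hspan := hcv.span_eq_top_of_card_eq_finrank' (by rw [Module.finrank_pi])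
    obtain ⟨c, hc⟩ := (Submodule.mem_span_range_iff_exists_fun ℂ).1
      (hspan ▸ Submodule.mem_top : (fun j ↦ if h : μ j = 1 then v ⟨j, h⟩ else 0) ∈ _)
    refine ⟨⟨∑ i, c i • (e i * φ i),
      sum_mem fun i _ ↦ Submodule.smul_mem _ _ (hmem i)⟩, funext fun j ↦ ?_⟩
    change cuspVal b μ k (∑ i, c i • (e i * φ i)) j = v j
    rw [cuspVal_sum hb hμ _ fun i _ ↦ Submodule.smul_mem _ _ (hmem i)]
    simp only [cuspVal_smul hb hμ _ (hmem _), hval]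
    rw [hc]
    exact dif_pos j.2
  have h := L.finrank_range_add_finrank_ker
  rw [hsurj, finrank_top, Module.finrank_pi, hker,
    (Submodule.comapSubtypeEquivOfLe cuspSub_le_modSub).finrank_eq] at h
  rw [← h, add_comm, Nat.card_eq_fintype_card]

end Dims

/-- The dimensions of spaces of forms in terms of the weights of a basis over the ring of
level one forms, and the relations between the numbers of generators of each weight. -/
theorem exists_weights [Γ.FiniteIndex] (hneg : (-1 : SL(2, ℤ)) ∈ Γ) :
    ∃ n : ℕ → ℕ, n 0 = 1 ∧
      (∀ k, Module.finrank ℂ (modSub Γ k) =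
        ∑ c ∈ Finset.range 6, n c * levelOneDim (k - 2 * c)) ∧
      (∀ k, Module.finrank ℂ (cuspSub Γ k) =
        ∑ c ∈ Finset.range 6, n c * levelOneDim (k + 2 * c - 12)) ∧
      Γ.index = ∑ c ∈ Finset.range 6, n c ∧
      Module.finrank ℂ (modSub Γ 24) = Module.finrank ℂ (cuspSub Γ 24) +
        Nat.card (MulAction.orbitRel.Quotient (Subgroup.zpowers ModularGroup.T)
          (SL(2, ℤ) ⧸ Γ)) ∧
      ∑ c ∈ Finset.range 6, n c * (-1 : ℂ) ^ c =
        numFixed (SL(2, ℤ) ⧸ Γ) ModularGroup.S ∧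
      ∑ c ∈ Finset.range 6, n c * ((ellThree : ℂ) ^ (2 * c))⁻¹ =
        numFixed (SL(2, ℤ) ⧸ Γ) (ModularGroup.T * ModularGroup.S) := by
  classical
  have := Fintype.ofFinite (SL(2, ℤ) ⧸ Γ)
  obtain ⟨b, μ, hb, hμ⟩ := exists_eigenbasis (X := SL(2, ℤ) ⧸ Γ) ModularGroup.T
  obtain ⟨κ, φ, hφ, he, hgen, hind, hli, hcv⟩ := exists_frame hneg hb hμ
  have hinj (w) (v : SL(2, ℤ) ⧸ Γ → ℂ) (h : ∀ i, ∑ x, v x * vec (κ i) (φ i) x w = 0) : v = 0 := by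
    have h1 := (Matrix.linearIndependent_rows_iff_isUnit
      (A := Matrix.of fun i x ↦ vec (κ i) (φ i) x w)).1 (hli w)
    refine Matrix.mulVec_injective_of_isUnit h1 ?_
    ext i
    simpa [mulVec, dotProduct, mul_comm] using h i
  have hM (k : ℤ) := finrank_modSub hφ (hgen k) (hind k)
  have hS (k : ℤ) := finrank_cuspSub (k := k) hφ hinj fun r hr ↦ exists_dual hb hμ hφ hli hcv hr
  have hone (m : SL(2, ℤ) ⧸ Γ → ℤ) (i) (hi : m i = 0) (j) :
      (if j = i then 1 else 0 : ℍ → ℂ) ∈ modSub ⊤ (m j) := by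
    split_ifs with hj
    · rw [hj, hi]; exact one_mem
    · exact zero_mem _
  have h0 (i) : 0 ≤ κ i := by
    by_contra! h
    have h1 := modSub_neg_weight h (hφ i)
    have := hind (κ i) _ (hone (fun j ↦ κ i - κ j) i (sub_self _))
      (by simp [h1]) i
    simp at this
  have h10 (i) : κ i ≤ 10 := by
    suffices κ i < 12 by
      obtain ⟨m, hm⟩ := he i
      omega
    by_contra! h
    obtain ⟨s, hs, hs'⟩ := exists_dual (k := 12 - κ i) hb hμ hφ hli hcv
      (hone (fun j ↦ 12 - κ i + κ j - 12) i (by ring))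
    have h1 := congrFun (hs' i) UpperHalfPlane.I
    rw [cuspSub_nonpos (by omega) hs] at h1
    simp [pairing, vec] at h1
    exact discriminant_ne_zero _ h1.symm
  set n : ℕ → ℕ := fun c ↦ Nat.card {i // κ i = 2 * c} with hn
  have hw {M : Type} [AddCommMonoid M] (F : ℤ → M) : ∑ i, F (κ i) = _ := sum_weights he h0 h10 F
  have hM' (k : ℤ) : Module.finrank ℂ (modSub Γ k) =
      ∑ c ∈ Finset.range 6, n c * levelOneDim (k - 2 * c) :=
    (hM k).2.trans (hw fun c ↦ levelOneDim (k - c))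
  refine ⟨n, ?_, hM', fun k ↦ (hS k).trans (hw fun c ↦ levelOneDim (k + c - 12)), ?_, ?_, ?_, ?_⟩
  · have h1 : Module.finrank ℂ (modSub Γ 0) = 1 := by
      refine (finrank_eq_one_iff_of_nonzero' (⟨1, one_mem⟩ : modSub Γ 0) ?_).2 fun w ↦ ?_
      · intro h
        exact one_ne_zero (congrArg Subtype.val h)
      · obtain ⟨c, hc⟩ := modSub_zero_weight w.2
        refine ⟨c, Subtype.ext ?_⟩
        rw [hc]; ext; simp
    have h2 : levelOneDim 0 = 1 := by simpa using levelOneDim_even 0 (by simp)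
    rw [hM'] at h1
    simpa [Finset.sum_range_succ, levelOneDim_neg, h2] using h1
  · rw [Subgroup.index, Nat.card_eq_fintype_card, ← Finset.card_univ, Finset.card_eq_sum_ones]
    exact (hw fun _ ↦ 1).trans (Finset.sum_congr rfl fun c _ ↦ mul_one _)
  · have := (hM 24).1
    rw [finrank_modSub_eq_add hb hμ hφ he hcv (by decide) fun i ↦ by linarith [h10 i],
      card_eigenvalue_one _ b μ hb]
    rfl
  · rw [← sum_vec_eigenvalues hφ (hli _) S_smul_I, denom_S_I, hw fun c ↦ Complex.I ^ (-c)]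
    refine Finset.sum_congr rfl fun c _ ↦ ?_
    rw [nsmul_eq_mul]
    congr 1
    rw [_root_.zpow_neg, _root_.zpow_mul, ← _root_.inv_zpow]
    norm_num
  · rw [← sum_vec_eigenvalues hφ (hli _) TS_smul_ellThree, denom_TS,
      hw fun c ↦ (ellThree : ℂ) ^ (-c)]
    refine Finset.sum_congr rfl fun c _ ↦ ?_
    rw [nsmul_eq_mul, _root_.zpow_neg]
    norm_cast

lemma levelOneDim_eq (m j : ℕ) (hj : j < 6) :
    (levelOneDim (12 * m + 2 * j) : ℤ) = m + 1 - if j = 1 then 1 else 0 := by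
  have := levelOneDim_even (12 * m + 2 * j) ⟨6 * m + j, by ring⟩
  push_cast at this
  rw [this]
  split_ifs <;> omega

lemma levelOneDim_sub (m s c : ℕ) (hs : s < 6) (hc : c < 6) (h : m = 0 → s ≠ 0) :
    (levelOneDim (12 * m + 2 * s - 2 * c) : ℤ) =
      m + (if c ≤ s then 1 else 0) - if s = c + 1 ∨ s + 5 = c then 1 else 0 := by
  by_cases h1 : c ≤ s
  · have := levelOneDim_eq m (s - c) (by omega)
    rw [show (12 * m + 2 * (s - c : ℕ) : ℤ) = 12 * m + 2 * s - 2 * c by omega] at this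
    rw [this]
    split_ifs <;> omega
  · obtain rfl | hm := Nat.eq_zero_or_pos m
    · rw [levelOneDim_neg (by omega)]
      split_ifs <;> omega
    · have := levelOneDim_eq (m - 1) (s + 6 - c) (by omega)
      rw [show (12 * (m - 1 : ℕ) + 2 * (s + 6 - c : ℕ) : ℤ) = 12 * m + 2 * s - 2 * c by
        omega] at this
      rw [this]
      split_ifs <;> omega

lemma levelOneDim_add (m s c : ℕ) (hs : s < 6) (hc : c < 6) (h : m = 0 → s ≠ 0) :
    (levelOneDim (12 * m + 2 * s + 2 * c - 12) : ℤ) =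
      m + (if 6 ≤ s + c then 1 else 0) - (if s + c = 1 ∨ s + c = 7 then 1 else 0)
        + if m = 0 ∧ s + c = 1 then 1 else 0 := by
  by_cases h1 : 6 ≤ s + c
  · have := levelOneDim_eq m (s + c - 6) (by omega)
    rw [show (12 * m + 2 * (s + c - 6 : ℕ) : ℤ) = 12 * m + 2 * s + 2 * c - 12 by omega] at this
    rw [this]
    split_ifs <;> omega
  · obtain rfl | hm := Nat.eq_zero_or_pos m
    · rw [levelOneDim_neg (by omega)]
      split_ifs <;> omega
    · have := levelOneDim_eq (m - 1) (s + c) (by omega)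
      rw [show (12 * (m - 1 : ℕ) + 2 * (s + c : ℕ) : ℤ) = 12 * m + 2 * s + 2 * c - 12 by
        omega] at this
      rw [this]
      split_ifs <;> omega

lemma ellThree_relations {n : ℕ → ℕ} {N : ℕ}
    (h : ∑ c ∈ Finset.range 6, n c * ((ellThree : ℂ) ^ (2 * c))⁻¹ = N) :
    n 1 + n 4 = n 2 + n 5 ∧ (n 0 + n 3 : ℤ) - (n 1 + n 4) = N := by
  have hinv (c : ℕ) (hc : c ≤ 6) : ((ellThree : ℂ) ^ (2 * c))⁻¹ = ellThree ^ (12 - 2 * c) := by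
    refine inv_eq_of_mul_eq_one_right ?_
    rw [← pow_add, show 2 * c + (12 - 2 * c) = 6 * 2 by omega, pow_mul, ellThree_pow_six, one_pow]
  have h4 : (ellThree : ℂ) ^ 4 = -1 / 2 - √3 / 2 * Complex.I := by
    have : (ellThree : ℂ) ^ 4 = - ellThree := by
      linear_combination (ellThree ^ 2 + ellThree : ℂ) * ellThree_sq_eq
    rw [this, coe_ellThree]; ring
  have h8 : (ellThree : ℂ) ^ 8 = ellThree ^ 2 := by
    linear_combination (ellThree : ℂ) ^ 2 * ellThree_pow_six
  have h10 : (ellThree : ℂ) ^ 10 = ellThree ^ 4 := by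
    linear_combination (ellThree : ℂ) ^ 4 * ellThree_pow_six
  have h12 : (ellThree : ℂ) ^ 12 = 1 := by
    linear_combination ((ellThree : ℂ) ^ 6 + 1) * ellThree_pow_six
  simp only [Finset.sum_range_succ, Finset.sum_range_zero, zero_add] at h
  rw [hinv 0 (by simp), hinv 1 (by simp), hinv 2 (by simp), hinv 3 (by simp), hinv 4 (by simp),
    hinv 5 (by simp)] at h
  norm_num at h
  rw [h12, h10, h8, h4, ellThree_pow_six, ellThree_sq] at h
  have hre := congrArg Complex.re h
  have him := congrArg Complex.im h
  simp at hre him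
  have h3 : (0 : ℝ) < √3 := by positivity
  have h5 : (n 1 + n 4 : ℝ) = n 2 + n 5 := by
    have : √3 * ((n 1 + n 4 : ℝ) - (n 2 + n 5)) = 0 := by linarith
    rcases mul_eq_zero.1 this with h | h
    · exact absurd h h3.ne'
    · linarith
  refine ⟨by exact_mod_cast h5, ?_⟩
  have : (n 0 + n 3 : ℝ) - (n 1 + n 4) = N := by linarith
  exact_mod_cast this

theorem finrank_formula [Γ.FiniteIndex] (hneg : (-1 : SL(2, ℤ)) ∈ Γ) (hk : 2 ≤ k)
    (hke : Even k) {ν₀ ν₂ ν₃ ν : ℕ} (h₀ : Γ.index = ν₀)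
    (h₂ : numFixed (SL(2, ℤ) ⧸ Γ) ModularGroup.S = ν₂)
    (h₃ : numFixed (SL(2, ℤ) ⧸ Γ) (ModularGroup.T * ModularGroup.S) = ν₃)
    (h : Nat.card (MulAction.orbitRel.Quotient (Subgroup.zpowers ModularGroup.T)
          (SL(2, ℤ) ⧸ Γ)) = ν) :
    (Module.finrank ℂ (cuspSub Γ k) : ℚ) =
      (if k = 2 then 1 else 0) + (k - 1) / 12 * ν₀ + ((⌊(k : ℚ) / 4⌋ : ℚ) - (k - 1) / 4) * ν₂
        + ((⌊(k : ℚ) / 3⌋ : ℚ) - (k - 1) / 3) * ν₃ - (ν : ℚ) / 2 ∧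
    (Module.finrank ℂ (modSub Γ k) : ℚ) =
      (Module.finrank ℂ (cuspSub Γ k) : ℚ) + ν - (if k = 2 then 1 else 0) := by
  obtain ⟨n, hn, hM, hS, hi, hc, h2, h3⟩ := exists_weights hneg
  rw [h₀] at hi
  rw [h] at hc
  rw [h₂] at h2
  rw [h₃] at h3
  obtain ⟨hr, h3⟩ := ellThree_relations h3
  have hMm (m s : ℕ) (hs : s < 6) (h : m = 0 → s ≠ 0) :
      (Module.finrank ℂ (modSub Γ (12 * m + 2 * s)) : ℤ) = ∑ c ∈ Finset.range 6, (n c : ℤ) *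
        (m + (if c ≤ s then 1 else 0) - if s = c + 1 ∨ s + 5 = c then 1 else 0) := by
    rw [hM]
    push_cast
    exact Finset.sum_congr rfl fun c hc ↦ by
      rw [levelOneDim_sub m s c hs (Finset.mem_range.1 hc) h]
  have hSm (m s : ℕ) (hs : s < 6) (h : m = 0 → s ≠ 0) :
      (Module.finrank ℂ (cuspSub Γ (12 * m + 2 * s)) : ℤ) = ∑ c ∈ Finset.range 6, (n c : ℤ) *
        (m + (if 6 ≤ s + c then 1 else 0) - (if s + c = 1 ∨ s + c = 7 then 1 else 0)
        + if m = 0 ∧ s + c = 1 then 1 else 0) := by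
    rw [hS]
    push_cast
    exact Finset.sum_congr rfl fun c hc ↦ by
      rw [levelOneDim_add m s c hs (Finset.mem_range.1 hc) h]
  have hcusp : (ν : ℤ) = n 0 + n 1 - n 5 := by
    have e1 := hMm 2 0 (by simp) (by simp)
    have e2 := hSm 2 0 (by simp) (by simp)
    have e24 : (12 * (2 : ℕ) + 2 * (0 : ℕ) : ℤ) = 24 := by norm_num
    rw [e24] at e1 e2
    zify at hc
    rw [e1, e2] at hc
    simp [Finset.sum_range_succ] at hc
    linarith
  have hell : (ν₂ : ℤ) = n 0 - n 1 + n 2 - n 3 + n 4 - n 5 := by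
    have : (ν₂ : ℂ) = n 0 - n 1 + n 2 - n 3 + n 4 - n 5 := by
      rw [← h2]
      simp [Finset.sum_range_succ]
      ring
    exact_mod_cast this
  obtain ⟨m, s, hs, rfl⟩ : ∃ m s : ℕ, s < 6 ∧ k = 12 * m + 2 * s := by
    obtain ⟨a, rfl⟩ := hke
    exact ⟨(a / 6).toNat, (a % 6).toNat, by omega, by omega⟩
  have hms : m = 0 → s ≠ 0 := by omega
  have e1 := hMm m s hs hms
  have e2 := hSm m s hs hms
  have hδ : (12 * m + 2 * s : ℤ) = 2 ↔ m = 0 ∧ s = 1 := by omega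
  have hf4 : ⌊((12 * m + 2 * s : ℤ) : ℚ) / 4⌋ = 3 * m + (s / 2 : ℕ) := by
    rw [Int.floor_eq_iff]
    interval_cases s <;> norm_num <;> constructor <;> linarith
  have hf3 : ⌊((12 * m + 2 * s : ℤ) : ℚ) / 3⌋ = 4 * m + (2 * s / 3 : ℕ) := by
    rw [Int.floor_eq_iff]
    interval_cases s <;> norm_num <;> constructor <;> linarith
  rw [hf4, hf3]
  simp only [hδ]
  have e1' := congrArg (fun z : ℤ ↦ (z : ℚ)) e1
  have e2' := congrArg (fun z : ℤ ↦ (z : ℚ)) e2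
  have i1 := congrArg (fun z : ℤ ↦ (z : ℚ)) hcusp
  have i2 := congrArg (fun z : ℤ ↦ (z : ℚ)) hell
  have i3 := congrArg (fun z : ℤ ↦ (z : ℚ)) h3
  have i4 := congrArg (fun z : ℕ ↦ (z : ℚ)) hr
  have i5 := congrArg (fun z : ℕ ↦ (z : ℚ)) hi
  simp only [Finset.sum_range_succ, Finset.sum_range_zero, hn] at e1' e2' i1 i2 i3 i4 i5
  push_cast at e1' e2' i1 i2 i3 i4 i5 ⊢
  rw [e1', e2', i1, i2, ← i3, i5]
  clear hM hS hMm hSm e1 e2 e1' e2' hf4 hf3 i1 i2 i3 i5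
  constructor
  · interval_cases s <;> by_cases hm : m = 0 <;> simp [hm] at hms ⊢ <;> linarith
  · interval_cases s <;> by_cases hm : m = 0 <;> simp [hm] at hms ⊢ <;> linarith

lemma neg_one_mem_plusMinusOne : (-1 : SL(2, ℤ)) ∈ plusMinusOne :=
  Subgroup.mem_zpowers _

lemma mem_plusMinusOne {γ : SL(2, ℤ)} : γ ∈ plusMinusOne ↔ γ = 1 ∨ γ = -1 := by
  constructor
  · rintro ⟨n, rfl⟩
    rcases Int.even_or_odd n with hn | hn
    · exact Or.inl hn.neg_one_zpow
    · exact Or.inr hn.neg_one_zpow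
  · rintro (rfl | rfl)
    exacts [Subgroup.one_mem _, neg_one_mem_plusMinusOne]

lemma mem_sup_plusMinusOne {γ : SL(2, ℤ)} : γ ∈ Γ ⊔ plusMinusOne ↔ γ ∈ Γ ∨ -γ ∈ Γ := by
  rw [← SetLike.mem_coe, Subgroup.mul_normal, Set.mem_mul]
  constructor
  · rintro ⟨a, ha, b, hb, rfl⟩
    rcases mem_plusMinusOne.1 hb with rfl | rfl
    · left; simpa using ha
    · right; simpa using ha
  · rintro (h | h)
    · exact ⟨γ, h, 1, Subgroup.one_mem _, mul_one _⟩
    · exact ⟨-γ, h, -1, neg_one_mem_plusMinusOne, by simp⟩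

lemma neg_one_mem_sup : (-1 : SL(2, ℤ)) ∈ Γ ⊔ plusMinusOne :=
  (le_sup_right : plusMinusOne ≤ _) neg_one_mem_plusMinusOne

lemma index_sup_plusMinusOne (Γ : Subgroup SL(2, ℤ)) :
    (Γ ⊔ plusMinusOne).index = nuZero Γ := by
  rw [nuZero, Subgroup.index_map, QuotientGroup.ker_mk', MonoidHom.range_eq_top_of_surjective _
    (QuotientGroup.mk'_surjective _), Subgroup.index_top, mul_one]

lemma slash_sup (hk : Even k) (h : ∀ γ ∈ Γ, f ∣[k] γ = f) :
    ∀ γ ∈ Γ ⊔ plusMinusOne, f ∣[k] γ = f := by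
  intro γ hγ
  rcases mem_sup_plusMinusOne.1 hγ with hγ | hγ
  · exact h γ hγ
  · have h1 := h _ hγ
    rw [show γ = -1 * -γ by simp, SlashAction.slash_mul, slash_neg_one]
    simpa [hk.neg_one_zpow] using h1

lemma modSub_sup (hk : Even k) : modSub (Γ ⊔ plusMinusOne) k = modSub Γ k :=
  le_antisymm (fun _ h ↦ ⟨h.1, fun γ hγ ↦ h.2.1 γ (le_sup_left (α := Subgroup _) hγ), h.2.2⟩)
    fun _ h ↦ ⟨h.1, slash_sup hk h.2.1, h.2.2⟩

lemma cuspSub_sup (hk : Even k) : cuspSub (Γ ⊔ plusMinusOne) k = cuspSub Γ k :=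
  le_antisymm (fun _ h ↦ ⟨h.1, fun γ hγ ↦ h.2.1 γ (le_sup_left (α := Subgroup _) hγ), h.2.2⟩)
    fun _ h ↦ ⟨h.1, slash_sup hk h.2.1, h.2.2⟩

lemma toPSL_eq_one {γ : SL(2, ℤ)} : toPSL γ = 1 ↔ γ = 1 ∨ γ = -1 := by
  rw [toPSL, MonoidHom.comp_apply, QuotientGroup.mk'_apply, QuotientGroup.eq_one_iff,
    Matrix.SpecialLinearGroup.mem_center_iff]
  constructor
  · rintro ⟨r, hr, h⟩
    have e (i j) := congrFun (congrFun h i) j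
    have h00 := e 0 0
    have h01 := e 0 1
    have h10 := e 1 0
    have h11 := e 1 1
    simp at h00 h01 h10 h11 hr
    have h01' : γ 0 1 = 0 := by exact_mod_cast h01.symm
    have h10' : γ 1 0 = 0 := by exact_mod_cast h10.symm
    have h11' : γ 0 0 = γ 1 1 := by exact_mod_cast h00.symm.trans h11
    rcases hr with rfl | rfl
    · left
      have : γ 0 0 = 1 := by exact_mod_cast h00.symm
      ext i j
      fin_cases i <;> fin_cases j <;> simp [h01', h10', ← h11', this]
    · right
      have : γ 0 0 = -1 := by exact_mod_cast h00.symm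
      ext i j
      fin_cases i <;> fin_cases j <;> simp [h01', h10', ← h11', this]
  · rintro (rfl | rfl)
    · exact ⟨1, by simp, by simp⟩
    · refine ⟨-1, by simp, ?_⟩
      ext i j
      fin_cases i <;> fin_cases j <;> simp

lemma toPSL_eq {γ δ : SL(2, ℤ)} : toPSL γ = toPSL δ ↔ γ = δ ∨ γ = -δ := by
  rw [← mul_inv_eq_one, ← map_inv, ← map_mul, toPSL_eq_one, mul_inv_eq_one, mul_inv_eq_iff_eq_mul,
    neg_mul, one_mul]

lemma orbit_inv_smul_eq_iff {Y : Type*} [MulAction SL(2, ℤ) Y] {y : Y}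
    (hy : (-1 : SL(2, ℤ)) • y = y) (g g' : SL(2, ℤ)) :
    {w : Y | ∃ γ ∈ Γ, γ • g⁻¹ • y = w} = {w : Y | ∃ γ ∈ Γ, γ • g'⁻¹ • y = w} ↔
      ∃ s ∈ MulAction.stabilizer SL(2, ℤ) y,
        s • (g : SL(2, ℤ) ⧸ (Γ ⊔ plusMinusOne)) = (g' : SL(2, ℤ) ⧸ (Γ ⊔ plusMinusOne)) := by
  constructor
  · intro h
    have : g'⁻¹ • y ∈ {w : Y | ∃ γ ∈ Γ, γ • g⁻¹ • y = w} := by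
      rw [h]; exact ⟨1, Γ.one_mem, one_smul _ _⟩
    obtain ⟨γ, hγ, h⟩ := this
    refine ⟨g' * γ * g⁻¹, ?_, ?_⟩
    · rw [MulAction.mem_stabilizer_iff, mul_smul, mul_smul, h, smul_inv_smul]
    · rw [MulAction.Quotient.smul_mk, QuotientGroup.eq]
      refine (le_sup_left : Γ ≤ _) ?_
      have : (g' * γ * g⁻¹ * g)⁻¹ * g' = γ⁻¹ := by group
      rw [smul_eq_mul, this]
      exact Γ.inv_mem hγ
  · rintro ⟨s, hs, h⟩
    rw [MulAction.Quotient.smul_mk, QuotientGroup.eq, mem_sup_plusMinusOne, smul_eq_mul] at h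
    obtain ⟨s', hs', b, hb, rfl⟩ :
        ∃ s' ∈ MulAction.stabilizer SL(2, ℤ) y, ∃ h ∈ Γ, g' = s' * g * h := by
      rcases h with h | h
      · exact ⟨s, hs, _, h, by group⟩
      · refine ⟨s * -1, mul_mem hs hy, _, h, ?_⟩
        rw [mul_neg_one, neg_mul, neg_mul, mul_neg, neg_neg]
        group
    have e (γ : SL(2, ℤ)) : γ • (s' * g * b)⁻¹ • y = (γ * b⁻¹) • g⁻¹ • y := by
      have : s'⁻¹ • y = y := inv_smul_eq_iff.2 (MulAction.mem_stabilizer_iff.1 hs').symm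
      rw [_root_.mul_inv_rev, _root_.mul_inv_rev, mul_smul, mul_smul, mul_smul, this]
    ext w
    constructor
    · rintro ⟨γ, hγ, rfl⟩
      exact ⟨γ * b, Γ.mul_mem hγ hb, by rw [e, mul_inv_cancel_right]⟩
    · rintro ⟨γ, hγ, rfl⟩
      exact ⟨γ * b⁻¹, Γ.mul_mem hγ (Γ.inv_mem hb), (e _).symm⟩

lemma slOnePoint_eq (γ : SL(2, ℤ)) (x : OnePoint ℚ) :
    slOnePoint γ x = Matrix.SpecialLinearGroup.mapGL ℚ γ • x := by
  cases x with
  | infty => rw [smul_infty_eq_ite]; simp [slOnePoint]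
  | coe q => rw [smul_some_eq_ite]; simp [slOnePoint]

/-- The action of `SL(2, ℤ)` on the rational projective line. -/
@[reducible] noncomputable def projectiveLineAction : MulAction SL(2, ℤ) (OnePoint ℚ) where
  smul := slOnePoint
  one_smul x := (slOnePoint_eq 1 x).trans (by rw [map_one, one_smul])
  mul_smul g h x := by
    change slOnePoint (g * h) x = slOnePoint g (slOnePoint h x)
    simp only [slOnePoint_eq, map_mul, mul_smul]

lemma slOnePoint_infty_eq_iff {γ : SL(2, ℤ)} :
    slOnePoint γ ∞ = ∞ ↔ ∃ n : ℤ, γ = ModularGroup.T ^ n ∨ γ = -ModularGroup.T ^ n := by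
  have : slOnePoint γ ∞ = ∞ ↔ γ 1 0 = 0 := by
    rw [slOnePoint_eq, smul_infty_eq_self_iff]; simp
  rw [this]
  constructor
  · intro hc
    have had := γ.det_coe
    rw [det_fin_two, hc, mul_zero, sub_zero] at had
    rcases Int.eq_one_or_neg_one_of_mul_eq_one' had with ⟨ha, hd⟩ | ⟨ha, hd⟩
    · refine ⟨γ 0 1, Or.inl ?_⟩
      ext i j
      fin_cases i <;> fin_cases j <;> simp [ha, hd, hc, ModularGroup.coe_T_zpow]
    · refine ⟨-γ 0 1, Or.inr ?_⟩
      ext i j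
      fin_cases i <;> fin_cases j <;> simp [ha, hd, hc, ModularGroup.coe_T_zpow]
  · rintro ⟨n, rfl | rfl⟩ <;> simp [ModularGroup.coe_T_zpow]

lemma card_cusps (Γ : Subgroup SL(2, ℤ)) :
    Nat.card (MulAction.orbitRel.Quotient (Subgroup.zpowers ModularGroup.T)
      (SL(2, ℤ) ⧸ (Γ ⊔ plusMinusOne))) = numCuspOrbits Γ := by
  let _ := projectiveLineAction
  have hy : (-1 : SL(2, ℤ)) • (∞ : OnePoint ℚ) = ∞ :=
    slOnePoint_infty_eq_iff.2 ⟨0, Or.inr (by simp)⟩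
  have key (g g' : SL(2, ℤ)) :
      (Quotient.mk'' (g : SL(2, ℤ) ⧸ (Γ ⊔ plusMinusOne)) :
        MulAction.orbitRel.Quotient (Subgroup.zpowers ModularGroup.T) _) = Quotient.mk'' ↑g' ↔
      {w : OnePoint ℚ | ∃ γ ∈ Γ, γ • g⁻¹ • ∞ = w} = {w | ∃ γ ∈ Γ, γ • g'⁻¹ • ∞ = w} := by
    rw [eq_comm, Quotient.eq'', orbit_inv_smul_eq_iff hy, MulAction.orbitRel_apply,
      MulAction.mem_orbit_iff]
    constructor
    · rintro ⟨⟨_, n, rfl⟩, h⟩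
      exact ⟨ModularGroup.T ^ n, slOnePoint_infty_eq_iff.2 ⟨n, Or.inl rfl⟩, h⟩
    · rintro ⟨s, hs, h⟩
      obtain ⟨n, rfl | rfl⟩ := slOnePoint_infty_eq_iff.1 hs
      · exact ⟨⟨_, n, rfl⟩, h⟩
      · refine ⟨⟨_, n, rfl⟩, ?_⟩
        rw [← h, ← neg_one_mul, mul_smul, neg_one_smul neg_one_mem_sup]
        rfl
  refine Nat.card_congr (Equiv.ofBijective (fun q ↦ Quotient.liftOn' q (fun x ↦
    Quotient.liftOn' x (fun g ↦ ⟨{w : OnePoint ℚ | ∃ γ ∈ Γ, γ • g⁻¹ • ∞ = w}, g⁻¹ • ∞, rfl⟩)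
      fun g g' h ↦ Subtype.ext ((key g g').1 ?_)) ?_) ⟨?_, ?_⟩)
  · rw [show (g : SL(2, ℤ) ⧸ (Γ ⊔ plusMinusOne)) = g' from Quotient.sound' h]
  · intro x x' h
    induction x using QuotientGroup.induction_on with | H g =>
    induction x' using QuotientGroup.induction_on with | H g' =>
    exact Subtype.ext ((key g g').1 (Quotient.sound' h))
  · intro q q' h
    induction q using Quotient.inductionOn' with | h x =>
    induction q' using Quotient.inductionOn' with | h x' =>
    induction x using QuotientGroup.induction_on with | H g =>
    induction x' using QuotientGroup.induction_on with | H g' =>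
    exact (key g g').2 (congrArg Subtype.val h)
  · rintro ⟨_, c, rfl⟩
    obtain ⟨g, rfl⟩ := exists_mem_SL2 ℤ c
    refine ⟨Quotient.mk'' (g⁻¹ : SL(2, ℤ)), Subtype.ext ?_⟩
    rw [← slOnePoint_eq]
    change {w : OnePoint ℚ | ∃ γ ∈ Γ, γ • (g⁻¹)⁻¹ • ∞ = w} = _
    rw [inv_inv]
    rfl

/-- `A` generates the stabilizer of `w` in `SL(2, ℤ)` up to sign, and has order `p` up to sign. -/
structure IsStabGenerator (w : ℍ) (A : SL(2, ℤ)) (p : ℕ) : Prop where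
  smul_eq : A • w = w
  stab : ∀ s : SL(2, ℤ), s • w = w → ∃ n : ℤ, s = A ^ n ∨ s = -A ^ n
  order : orderOf (toPSL A) = p

lemma map_stab_le {w : ℍ} {A : SL(2, ℤ)} {p : ℕ} (h : IsStabGenerator w A p) (g : SL(2, ℤ)) :
    Subgroup.map toPSL (Γ ⊓ MulAction.stabilizer SL(2, ℤ) (g⁻¹ • w)) ≤
      Subgroup.zpowers (toPSL (g⁻¹ * A * g)) := by
  rintro _ ⟨γ, ⟨-, hγ⟩, rfl⟩
  have h1 : (g * γ * g⁻¹) • w = w := by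
    rw [mul_smul, mul_smul, MulAction.mem_stabilizer_iff.1 hγ, smul_inv_smul]
  obtain ⟨n, hn⟩ := h.stab _ h1
  refine ⟨n, ?_⟩
  have h2 := toPSL_eq.2 hn
  have h3 : γ = g⁻¹ * (g * γ * g⁻¹) * g := by group
  change toPSL (g⁻¹ * A * g) ^ n = toPSL γ
  have h4 : toPSL γ = toPSL (g⁻¹ * A ^ n * g) := by
    rw [h3, map_mul, map_mul, h2, ← map_mul, ← map_mul]
  rw [h4, ← map_zpow]
  congr 1
  simpa using conj_zpow (i := n) (a := g⁻¹) (b := A)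

lemma card_zpowers_conj {w : ℍ} {A : SL(2, ℤ)} {p : ℕ} (h : IsStabGenerator w A p)
    (g : SL(2, ℤ)) : Nat.card (Subgroup.zpowers (toPSL (g⁻¹ * A * g))) = p := by
  rw [Nat.card_zpowers, ← h.order, map_mul, map_mul, map_inv]
  exact (SemiconjBy.orderOf_eq (toPSL g)⁻¹ (by simp [SemiconjBy])).symm

lemma dvd_of_isElliptic {w : ℍ} {A : SL(2, ℤ)} {p n : ℕ} (h : IsStabGenerator w A p)
    {g : SL(2, ℤ)} (hn : IsEllipticPointOfOrder Γ n (g⁻¹ • w)) : n ∣ p := by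
  rw [← hn.2, ← card_zpowers_conj h g]
  exact Subgroup.card_dvd_of_le (map_stab_le h g)

lemma isElliptic_iff {w : ℍ} {A : SL(2, ℤ)} {p : ℕ} (hp : p.Prime) (h : IsStabGenerator w A p)
    (g : SL(2, ℤ)) : IsEllipticPointOfOrder Γ p (g⁻¹ • w) ↔
      A • (g : SL(2, ℤ) ⧸ (Γ ⊔ plusMinusOne)) = g := by
  have hle := map_stab_le (Γ := Γ) h g
  have hcard := card_zpowers_conj h g
  have hB : toPSL (g⁻¹ * A * g) ∈
      Subgroup.map toPSL (Γ ⊓ MulAction.stabilizer SL(2, ℤ) (g⁻¹ • w)) ↔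
      A • (g : SL(2, ℤ) ⧸ (Γ ⊔ plusMinusOne)) = g := by
    rw [eq_comm (b := (g : SL(2, ℤ) ⧸ (Γ ⊔ plusMinusOne))), MulAction.Quotient.smul_mk,
      QuotientGroup.eq, smul_eq_mul, ← mul_assoc, mem_sup_plusMinusOne]
    have hfix : (g⁻¹ * A * g) • g⁻¹ • w = g⁻¹ • w := by
      rw [mul_smul, mul_smul, smul_inv_smul, h.smul_eq]
    constructor
    · rintro ⟨γ, ⟨hγ, -⟩, e⟩
      rcases toPSL_eq.1 e with rfl | rfl
      · exact Or.inl hγ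
      · exact Or.inr hγ
    · rintro (hγ | hγ)
      · exact ⟨_, ⟨hγ, hfix⟩, rfl⟩
      · exact ⟨_, ⟨hγ, by
          change -(g⁻¹ * A * g) • g⁻¹ • w = g⁻¹ • w
          rw [ModularGroup.SL_neg_smul, hfix]⟩,
          toPSL_eq.2 (Or.inr rfl)⟩
  rw [← hB]
  have : Finite (Subgroup.zpowers (toPSL (g⁻¹ * A * g))) :=
    Nat.finite_of_card_ne_zero (by rw [hcard]; exact hp.ne_zero)
  constructor
  · rintro ⟨-, h1⟩
    rw [Subgroup.eq_of_le_of_card_ge hle (by rw [h1, hcard])]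
    exact Subgroup.mem_zpowers _
  · intro h1
    have : Subgroup.map toPSL (Γ ⊓ MulAction.stabilizer SL(2, ℤ) (g⁻¹ • w)) =
        Subgroup.zpowers (toPSL (g⁻¹ * A * g)) :=
      le_antisymm hle ((Subgroup.zpowers_le).2 h1)
    rw [IsEllipticPointOfOrder, this]
    exact ⟨inferInstance, hcard⟩

lemma card_elliptic {w : ℍ} {A : SL(2, ℤ)} {p : ℕ} (hp : p.Prime) (h : IsStabGenerator w A p)
    (hall : ∀ z, IsEllipticPointOfOrder Γ p z → ∃ g : SL(2, ℤ), z = g⁻¹ • w) :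
    numFixed (SL(2, ℤ) ⧸ (Γ ⊔ plusMinusOne)) A = numEllipticOrbits Γ p := by
  have hy : (-1 : SL(2, ℤ)) • w = w := by rw [ModularGroup.SL_neg_smul, one_smul]
  have hzpow (x : SL(2, ℤ) ⧸ (Γ ⊔ plusMinusOne)) (hx : A • x = x) (s : SL(2, ℤ))
      (hs : s • w = w) : s • x = x := by
    have hn (n : ℤ) : A ^ n • x = x :=
      (MulAction.stabilizer SL(2, ℤ) x).zpow_mem hx n
    obtain ⟨n, rfl | rfl⟩ := h.stab s hs
    · exact hn n
    · rw [← neg_one_mul, mul_smul, neg_one_smul neg_one_mem_sup, hn]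
  have key (g g' : SL(2, ℤ)) :
      {z : ℍ | ∃ γ ∈ Γ, γ • g⁻¹ • w = z} = {z | ∃ γ ∈ Γ, γ • g'⁻¹ • w = z} ↔
      ∃ s ∈ MulAction.stabilizer SL(2, ℤ) w,
        s • (g : SL(2, ℤ) ⧸ (Γ ⊔ plusMinusOne)) = (g' : SL(2, ℤ) ⧸ (Γ ⊔ plusMinusOne)) :=
    orbit_inv_smul_eq_iff hy g g'
  let φ (x : SL(2, ℤ) ⧸ (Γ ⊔ plusMinusOne)) : Set ℍ :=
    Quotient.liftOn' x (fun g ↦ {z : ℍ | ∃ γ ∈ Γ, γ • g⁻¹ • w = z})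
      fun g g' h ↦ (key g g').2 ⟨1, Subgroup.one_mem _, by rw [one_smul]; exact Quotient.sound' h⟩
  refine Nat.card_congr (Equiv.ofBijective (fun x ↦ ⟨φ x.1, ?_⟩) ⟨?_, ?_⟩)
  · obtain ⟨x, hx⟩ := x
    induction x using QuotientGroup.induction_on with | H g =>
    exact ⟨g⁻¹ • w, (isElliptic_iff hp h g).2 hx, rfl⟩
  · rintro ⟨x, hx⟩ ⟨x', hx'⟩ he
    induction x using QuotientGroup.induction_on with | H g =>
    induction x' using QuotientGroup.induction_on with | H g' =>
    obtain ⟨s, hs, e⟩ := (key g g').1 (congrArg Subtype.val he)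
    rw [hzpow _ hx s hs] at e
    exact Subtype.ext e
  · rintro ⟨_, z, hz, rfl⟩
    obtain ⟨g, rfl⟩ := hall z hz
    exact ⟨⟨g, (isElliptic_iff hp h g).1 hz⟩, rfl⟩

lemma isStabGenerator_I : IsStabGenerator UpperHalfPlane.I ModularGroup.S 2 where
  smul_eq := S_smul_I
  stab s hs := by
    have := ModularGroup.stabilizer_I.1 hs
    simp only [Finset.mem_insert, Finset.mem_singleton] at this
    rcases this with rfl | rfl | rfl | rfl
    · exact ⟨0, by simp⟩
    · exact ⟨0, by simp⟩
    · exact ⟨1, by simp⟩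
    · exact ⟨1, by simp⟩
  order := by
    refine orderOf_eq_prime ?_ ?_
    · rw [← map_pow, toPSL_eq_one]; decide
    · rw [Ne, toPSL_eq_one]; decide

lemma T_smul_rho : ModularGroup.T • UpperHalfPlane.ρ = ellThree := by
  rw [UpperHalfPlane.modular_T_smul]
  apply UpperHalfPlane.ext
  rw [coe_ellThree, coe_vadd]
  apply Complex.ext <;> norm_num [UpperHalfPlane.ρ]

lemma isStabGenerator_ellThree :
    IsStabGenerator ellThree (ModularGroup.T * ModularGroup.S) 3 where
  smul_eq := TS_smul_ellThree
  stab s hs := by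
    have h1 : (ModularGroup.T⁻¹ * s * ModularGroup.T) • UpperHalfPlane.ρ = UpperHalfPlane.ρ := by
      rw [mul_smul, mul_smul, T_smul_rho, hs, ← T_smul_rho, inv_smul_smul]
    have := ModularGroup.stabilizer_ρ.1 h1
    obtain ⟨u, rfl⟩ : ∃ u, s = ModularGroup.T * u * ModularGroup.T⁻¹ :=
      ⟨ModularGroup.T⁻¹ * s * ModularGroup.T, by group⟩
    rw [show ModularGroup.T⁻¹ * (ModularGroup.T * u * ModularGroup.T⁻¹) * ModularGroup.T = u by
      group] at this
    simp only [Finset.mem_insert, Finset.mem_singleton] at this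
    rcases this with rfl | rfl | rfl | rfl | rfl | rfl
    · exact ⟨0, by simp⟩
    · exact ⟨0, by simp⟩
    · exact ⟨1, by simp [mul_assoc]⟩
    · exact ⟨1, by simp [mul_assoc]⟩
    · exact ⟨2, by decide⟩
    · exact ⟨2, by decide⟩
  order := by
    refine orderOf_eq_prime ?_ ?_
    · rw [← map_pow, toPSL_eq_one]; decide
    · rw [Ne, toPSL_eq_one]; decide

lemma eq_smul_of_isElliptic {n : ℕ} (hn : n ≠ 1) {z : ℍ} (hz : IsEllipticPointOfOrder Γ n z) :
    (∃ g : SL(2, ℤ), z = g⁻¹ • UpperHalfPlane.I) ∨ ∃ g : SL(2, ℤ), z = g⁻¹ • ellThree := by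
  obtain ⟨g, hg⟩ := ModularGroup.exists_smul_mem_fd z
  by_contra! hne
  have h1 := hne.1 g
  have h2 := hne.2 g
  have h3 := hne.2 (ModularGroup.T * g)
  rw [ne_eq, eq_inv_smul_iff] at h1 h2 h3
  rw [mul_smul, ← T_smul_rho, smul_left_cancel_iff] at h3
  rw [← T_smul_rho, UpperHalfPlane.modular_T_smul] at h2
  refine hn (hz.2.symm.trans (Subgroup.card_eq_one.2 ((Subgroup.eq_bot_iff_forall _).2 ?_)))
  rintro _ ⟨γ, ⟨-, hγ⟩, rfl⟩
  have h4 : (g * γ * g⁻¹) • g • z = g • z := by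
    rw [mul_smul, mul_smul, inv_smul_smul, MulAction.mem_stabilizer_iff.1 hγ]
  rw [toPSL_eq_one]
  rcases ModularGroup.stabilizer_of_ne hg h4 h1 h3 h2 with h | h
  · left
    rw [mul_inv_eq_one] at h
    exact mul_eq_left.1 h
  · right
    rw [mul_inv_eq_iff_eq_mul, neg_one_mul, ← mul_neg_one] at h
    exact mul_left_cancel h

lemma card_elliptic_two (Γ : Subgroup SL(2, ℤ)) :
    numFixed (SL(2, ℤ) ⧸ (Γ ⊔ plusMinusOne)) ModularGroup.S = numEllipticOrbits Γ 2 := by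
  refine card_elliptic Nat.prime_two isStabGenerator_I fun z hz ↦ ?_
  obtain h | ⟨g, rfl⟩ := eq_smul_of_isElliptic (by norm_num) hz
  · exact h
  · exact absurd (dvd_of_isElliptic isStabGenerator_ellThree hz) (by norm_num)

lemma card_elliptic_three (Γ : Subgroup SL(2, ℤ)) :
    numFixed (SL(2, ℤ) ⧸ (Γ ⊔ plusMinusOne)) (ModularGroup.T * ModularGroup.S) =
      numEllipticOrbits Γ 3 := by
  refine card_elliptic Nat.prime_three isStabGenerator_ellThree fun z hz ↦ ?_
  obtain ⟨g, rfl⟩ | h := eq_smul_of_isElliptic (by norm_num) hz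
  · exact absurd (dvd_of_isElliptic isStabGenerator_I hz) (by norm_num)
  · exact h

end DimFormula

/-- **Dimension formula for modular and cusp forms of even weight** (Shimura).
Let `Γ'` be a finite-index subgroup of `SL(2, ℤ)` and let `k ≥ 2` be even. Then
`dim S_k(Γ') = δ_{2,k} + ((k−1)/12)·ν₀(Γ') + (⌊k/4⌋ − (k−1)/4)·ν₂(Γ')
   + (⌊k/3⌋ − (k−1)/3)·ν₃(Γ') − ν_∞(Γ')/2`,
and `dim M_k(Γ') = dim S_k(Γ') + ν_∞(Γ') − δ_{2,k}`, where `δ_{2,k} = 1` if `k = 2` and `0`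
otherwise. -/
theorem dim_modular_forms_even_weight (Γ' : Subgroup SL(2, ℤ)) [Γ'.FiniteIndex]
    (k : ℤ) (hk : 2 ≤ k) (hke : Even k) :
    (Module.finrank ℂ (CuspForm Γ' k) : ℚ) =
      (if k = 2 then 1 else 0) + (k - 1) / 12 * nuZero Γ'
        + ((⌊(k : ℚ) / 4⌋ : ℚ) - (k - 1) / 4) * numEllipticOrbits Γ' 2
        + ((⌊(k : ℚ) / 3⌋ : ℚ) - (k - 1) / 3) * numEllipticOrbits Γ' 3
        - (numCuspOrbits Γ' : ℚ) / 2 ∧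
    (Module.finrank ℂ (ModularForm Γ' k) : ℚ) =
      (Module.finrank ℂ (CuspForm Γ' k) : ℚ) + numCuspOrbits Γ'
        - (if k = 2 then 1 else 0) := by
  have : (Γ' ⊔ plusMinusOne).FiniteIndex := Subgroup.finiteIndex_of_le le_sup_left
  rw [(DimFormula.modEquiv (𝒢 := Γ') rfl).finrank_eq,
    (DimFormula.cuspEquiv (𝒢 := Γ') rfl).finrank_eq,
    ← DimFormula.modSub_sup hke, ← DimFormula.cuspSub_sup hke]
  exact DimFormula.finrank_formula DimFormula.neg_one_mem_sup hk hke
    (DimFormula.index_sup_plusMinusOne Γ') (DimFormula.card_elliptic_two Γ')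
    (DimFormula.card_elliptic_three Γ') (DimFormula.card_cusps Γ')
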